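/- Assume Δ>0, hypotheses (H2)–(H3), P_0 a discrete distribution with finite support as described, λ∈(0,1/9), ρ_n=Θ(n^{-λ}), and α_n := γρ_n|ln ρ_n| with γ>0 fixed. Then for every τ∈[0, 2/(γv_K²)): lim_{n→∞} I(X*;Y,Ỹ^{(τ)}|Φ)/m_n = min_{1≤k≤K+1} { I_{P_out}(E[X²·1{|X|≥v_k}],E[X²]) + τ·E[X²·1{|X|<v_k}]/2 + ℙ(|X|≥v_k)/γ }, where X∼P_0. -/

import Mathlib

open MeasureTheory ProbabilityTheory Real

noncomputable section

namespace GLM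

/-- Standard Gaussian measure on ℝ. -/
def stdG : Measure ℝ := gaussianReal 0 1

/-- `n` i.i.d. copies of a measure on ℝ. -/
def iid (n : ℕ) (μ : Measure ℝ) : Measure (Fin n → ℝ) := Measure.pi fun _ => μ

/-- The sparse prior `(1-ρ)δ₀ + ρ P₀`. -/
def sparsePrior (ρ : ℝ) (P0 : Measure ℝ) : Measure ℝ :=
  ENNReal.ofReal (1 - ρ) • Measure.dirac 0 + ENNReal.ofReal ρ • P0

/-- Second moment of a real measure. -/
def secondMoment (P : Measure ℝ) : ℝ := ∫ x, x ^ 2 ∂P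

/-- The transition density `P_out(y|x)`. -/
def Pout (Δ : ℝ) {kA : ℕ} (PA : Measure (Fin kA → ℝ)) (φ : ℝ → (Fin kA → ℝ) → ℝ)
    (y x : ℝ) : ℝ :=
  (Real.sqrt (2 * π * Δ))⁻¹ * ∫ a, Real.exp (-(y - φ x a) ^ 2 / (2 * Δ)) ∂PA

/-- Scalar channel mutual information `I_{P_out}(q, ρ')`. -/
def IPout (Δ : ℝ) {kA : ℕ} (PA : Measure (Fin kA → ℝ)) (φ : ℝ → (Fin kA → ℝ) → ℝ)
    (q ρ' : ℝ) : ℝ :=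
  (∫ v, ∫ a, ∫ z,
      Real.log (Pout Δ PA φ (φ (Real.sqrt ρ' * v) a + Real.sqrt Δ * z) (Real.sqrt ρ' * v))
      ∂stdG ∂PA ∂stdG)
  - ∫ v, ∫ w, ∫ a, ∫ z,
      Real.log (∫ w', Pout Δ PA φ
        (φ (Real.sqrt q * v + Real.sqrt (ρ' - q) * w) a + Real.sqrt Δ * z)
        (Real.sqrt q * v + Real.sqrt (ρ' - q) * w') ∂stdG) ∂stdG ∂PA ∂stdG ∂stdG

/-- `ψ_P(r)` for the scalar additive Gaussian channel with prior `P`. -/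
def psiP (P : Measure ℝ) (r : ℝ) : ℝ :=
  ∫ xs, ∫ z, Real.log (∫ x, Real.exp (r * xs * x + Real.sqrt r * z * x - r * x ^ 2 / 2) ∂P)
    ∂stdG ∂P

/-- `I_{P_{0,n}}(r)`. -/
def IP0 (ρ : ℝ) (P0 : Measure ℝ) (r : ℝ) : ℝ :=
  r * ρ * secondMoment P0 / 2 - psiP (sparsePrior ρ P0) r

/-- Replica symmetric potential. -/
def iRS (Δ : ℝ) {kA : ℕ} (PA : Measure (Fin kA → ℝ)) (φ : ℝ → (Fin kA → ℝ) → ℝ)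
    (P0 : Measure ℝ) (α ρ q r : ℝ) : ℝ :=
  (1 / α) * IP0 ρ P0 (α / ρ * r) + IPout Δ PA φ q (secondMoment P0)
    - r * (secondMoment P0 - q) / 2

/-- density of the observations given signal and matrix. -/
def pCond (Δ : ℝ) {kA : ℕ} (PA : Measure (Fin kA → ℝ)) (φ : ℝ → (Fin kA → ℝ) → ℝ)
    (n m : ℕ) (kn : ℝ) (Φ : Fin m → Fin n → ℝ) (x : Fin n → ℝ) (y : Fin m → ℝ) : ℝ :=
  ∏ μ, Pout Δ PA φ (y μ) ((∑ i, Φ μ i * x i) / Real.sqrt kn)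

/-- marginal density of the observations given the matrix. -/
def pMarg (Δ : ℝ) {kA : ℕ} (PA : Measure (Fin kA → ℝ)) (φ : ℝ → (Fin kA → ℝ) → ℝ)
    (n m : ℕ) (P : Measure ℝ) (kn : ℝ) (Φ : Fin m → Fin n → ℝ) (y : Fin m → ℝ) : ℝ :=
  ∫ x, pCond Δ PA φ n m kn Φ x y ∂(iid n P)

/-- The observations `Y`. -/
def Yobs (Δ : ℝ) {kA : ℕ} (φ : ℝ → (Fin kA → ℝ) → ℝ) (n m : ℕ) (kn : ℝ)
    (Φ : Fin m → Fin n → ℝ) (x : Fin n → ℝ) (a : Fin m → Fin kA → ℝ) (z : Fin m → ℝ) :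
    Fin m → ℝ :=
  fun μ => φ ((∑ i, Φ μ i * x i) / Real.sqrt kn) (a μ) + Real.sqrt Δ * z μ

/-- The conditional mutual information `I(X*;Y|Φ)`. -/
def MI (Δ : ℝ) {kA : ℕ} (PA : Measure (Fin kA → ℝ)) (φ : ℝ → (Fin kA → ℝ) → ℝ)
    (P0 : Measure ℝ) (ρ : ℝ) (n m : ℕ) : ℝ :=
  ∫ x, ∫ Φ, ∫ a, ∫ z,
    Real.log (pCond Δ PA φ n m (n * ρ) Φ x (Yobs Δ φ n m (n * ρ) Φ x a z)
      / pMarg Δ PA φ n m (sparsePrior ρ P0) (n * ρ) Φ (Yobs Δ φ n m (n * ρ) Φ x a z))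
    ∂(iid m stdG) ∂(Measure.pi fun _ : Fin m => PA) ∂(Measure.pi fun _ : Fin m => iid n stdG)
    ∂(iid n (sparsePrior ρ P0))

/-- The truncated second moment E[X^2 * 1(|X| < v)]. -/
def headSM (P : Measure ℝ) (v : ℝ) : ℝ := ∫ x, if |x| < v then x ^ 2 else 0 ∂P

/-- The truncated second moment E[X^2 * 1(|X| >= v)]. -/
def truncSMge (P : Measure ℝ) (v : ℝ) : ℝ := ∫ x, if v ≤ |x| then x ^ 2 else 0 ∂P

/-- The tail probability P(|X| >= v). -/
def tailProb (P : Measure ℝ) (v : ℝ) : ℝ := (P {x | v ≤ |x|}).toReal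

/-- Joint conditional density of (Y, Ytilde) given the signal and the matrix,
where the side channel has signal-to-noise ratio snr. -/
def pCondSide (Δ : ℝ) {kA : ℕ} (PA : Measure (Fin kA → ℝ)) (φ : ℝ → (Fin kA → ℝ) → ℝ)
    (n m : ℕ) (kn snr : ℝ) (Φ : Fin m → Fin n → ℝ) (x : Fin n → ℝ)
    (y : Fin m → ℝ) (yt : Fin n → ℝ) : ℝ :=
  pCond Δ PA φ n m kn Φ x y *
    ∏ i, (Real.sqrt (2 * π))⁻¹ * Real.exp (-(yt i - Real.sqrt snr * x i) ^ 2 / 2)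

/-- Marginal density of (Y, Ytilde) given the matrix. -/
def pMargSide (Δ : ℝ) {kA : ℕ} (PA : Measure (Fin kA → ℝ)) (φ : ℝ → (Fin kA → ℝ) → ℝ)
    (n m : ℕ) (P : Measure ℝ) (kn snr : ℝ) (Φ : Fin m → Fin n → ℝ)
    (y : Fin m → ℝ) (yt : Fin n → ℝ) : ℝ :=
  ∫ x, pCondSide Δ PA φ n m kn snr Φ x y yt ∂(iid n P)

/-- The conditional mutual information I(X*; Y, Ytilde^(τ) | Φ) with side observations
Ytilde_i = √(α τ / ρ) X*_i + Ztilde_i. -/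
def MIside (Δ : ℝ) {kA : ℕ} (PA : Measure (Fin kA → ℝ)) (φ : ℝ → (Fin kA → ℝ) → ℝ)
    (P0 : Measure ℝ) (ρ α τ : ℝ) (n m : ℕ) : ℝ :=
  ∫ x, ∫ Φ, ∫ a, ∫ z, ∫ zt,
    Real.log (pCondSide Δ PA φ n m ((n : ℝ) * ρ) (α * τ / ρ) Φ x
        (Yobs Δ φ n m ((n : ℝ) * ρ) Φ x a z)
        (fun i => Real.sqrt (α * τ / ρ) * x i + zt i)
      / pMargSide Δ PA φ n m (sparsePrior ρ P0) ((n : ℝ) * ρ) (α * τ / ρ) Φ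
        (Yobs Δ φ n m ((n : ℝ) * ρ) Φ x a z)
        (fun i => Real.sqrt (α * τ / ρ) * x i + zt i))
    ∂(iid n stdG) ∂(iid m stdG) ∂(Measure.pi fun _ : Fin m => PA)
    ∂(Measure.pi fun _ : Fin m => iid n stdG) ∂(iid n (sparsePrior ρ P0))

instance : IsProbabilityMeasure stdG := by unfold stdG; infer_instance

instance (n : ℕ) (μ : Measure ℝ) [IsProbabilityMeasure μ] : IsProbabilityMeasure (iid n μ) := by
  unfold iid; infer_instance

/-- The regularity of the activation function used throughout. -/
structure RegularChannel (Δ : ℝ) {kA : ℕ} (φ : ℝ → (Fin kA → ℝ) → ℝ) (B : ℝ) : Prop where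
  pos : 0 < Δ
  meas : Measurable fun p : ℝ × (Fin kA → ℝ) => φ p.1 p.2
  bound : ∀ x a, |φ x a| ≤ B
  cont : ∀ a, Continuous fun x => φ x a

/-- The transition density averaged over a Gaussian perturbation of its input. -/
def avgPout (Δ : ℝ) {kA : ℕ} (PA : Measure (Fin kA → ℝ)) (φ : ℝ → (Fin kA → ℝ) → ℝ)
    (y g c : ℝ) : ℝ :=
  ∫ w, Pout Δ PA φ y (g + c * w) ∂stdG

/-- Lower envelope of the transition density. -/
def loEnv (Δ B y : ℝ) : ℝ :=
  (Real.sqrt (2 * π * Δ))⁻¹ * Real.exp (-(y ^ 2 + 2 * B * |y| + B ^ 2) / (2 * Δ))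

/-- Upper envelope of the transition density. -/
def hiEnv (Δ B y : ℝ) : ℝ :=
  (Real.sqrt (2 * π * Δ))⁻¹ * Real.exp (-(y ^ 2 - 2 * B * |y|) / (2 * Δ))

/-- Slope of the bound on the log-likelihood ratios. -/
def llrSlope (Δ B : ℝ) : ℝ := (4 * B * (B + Real.sqrt Δ) + B ^ 2) / (2 * Δ)

section Channel

variable {Δ : ℝ} {kA : ℕ} {PA : Measure (Fin kA → ℝ)} [IsProbabilityMeasure PA]
  {φ : ℝ → (Fin kA → ℝ) → ℝ} {B : ℝ}

lemma loEnv_pos (hΔ : 0 < Δ) (y : ℝ) : 0 < loEnv Δ B y := by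
  unfold loEnv; positivity

lemma RegularChannel.nonneg (h : RegularChannel Δ φ B) : 0 ≤ B :=
  (abs_nonneg _).trans (h.bound 0 0)

lemma RegularChannel.measurable_integrand (h : RegularChannel Δ φ B) :
    Measurable fun p : (ℝ × ℝ) × (Fin kA → ℝ) =>
      Real.exp (-(p.1.1 - φ p.1.2 p.2) ^ 2 / (2 * Δ)) := by
  have := h.meas.comp ((measurable_snd.comp measurable_fst).prodMk measurable_snd :
    Measurable fun p : (ℝ × ℝ) × (Fin kA → ℝ) => (p.1.2, p.2))
  exact ((((measurable_fst.comp measurable_fst).sub this).pow_const 2).neg.div_const _).exp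

lemma exp_neg_sq_div_le_one (hΔ : 0 < Δ) (t : ℝ) : Real.exp (-t ^ 2 / (2 * Δ)) ≤ 1 := by
  rw [Real.exp_le_one_iff]
  have : 0 ≤ t ^ 2 / (2 * Δ) := by positivity
  rw [neg_div]; linarith

lemma RegularChannel.integrable (h : RegularChannel Δ φ B) (y x : ℝ) :
    Integrable (fun a => Real.exp (-(y - φ x a) ^ 2 / (2 * Δ))) PA := by
  refine Integrable.mono' (integrable_const 1) ?_ ?_
  · exact (h.measurable_integrand.comp (measurable_prodMk_left (x := (y, x)))).aestronglyMeasurable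
  · refine Filter.Eventually.of_forall fun a => ?_
    rw [Real.norm_eq_abs, abs_of_pos (Real.exp_pos _)]
    exact exp_neg_sq_div_le_one h.pos _

lemma RegularChannel.le_Pout (h : RegularChannel Δ φ B) (y x : ℝ) :
    loEnv Δ B y ≤ Pout Δ PA φ y x := by
  unfold loEnv Pout
  gcongr
  have := integral_mono (μ := PA) (integrable_const
    (Real.exp (-(y ^ 2 + 2 * B * |y| + B ^ 2) / (2 * Δ)))) (h.integrable y x) ?_
  · simpa using this
  intro a
  simp only
  have hp := h.pos
  gcongr
  have h1 := abs_le.1 (h.bound x a)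
  have h2 : φ x a ^ 2 ≤ B ^ 2 := sq_le_sq' h1.1 h1.2
  have h3 : |y * φ x a| ≤ |y| * B := by
    rw [abs_mul]; exact mul_le_mul_of_nonneg_left (h.bound x a) (abs_nonneg _)
  nlinarith [abs_le.1 h3]

lemma RegularChannel.Pout_le (h : RegularChannel Δ φ B) (y x : ℝ) :
    Pout Δ PA φ y x ≤ hiEnv Δ B y := by
  unfold hiEnv Pout
  gcongr
  have := integral_mono (μ := PA) (h.integrable y x) (integrable_const
    (Real.exp (-(y ^ 2 - 2 * B * |y|) / (2 * Δ)))) ?_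
  · simpa using this
  intro a
  simp only
  have hp := h.pos
  gcongr
  have h3 : |y * φ x a| ≤ |y| * B := by
    rw [abs_mul]; exact mul_le_mul_of_nonneg_left (h.bound x a) (abs_nonneg _)
  nlinarith [abs_le.1 h3, sq_nonneg (φ x a)]

lemma RegularChannel.Pout_le_const (h : RegularChannel Δ φ B) (y x : ℝ) :
    Pout Δ PA φ y x ≤ (Real.sqrt (2 * π * Δ))⁻¹ := by
  unfold Pout
  have := integral_mono (μ := PA) (h.integrable y x) (integrable_const (1 : ℝ))
    fun a => exp_neg_sq_div_le_one h.pos _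
  simp only [integral_const, probReal_univ, smul_eq_mul, mul_one] at this
  exact mul_le_of_le_one_right (by positivity) this

lemma RegularChannel.Pout_pos (h : RegularChannel Δ φ B) (y x : ℝ) : 0 < Pout Δ PA φ y x :=
  (loEnv_pos h.pos y).trans_le (h.le_Pout y x)

lemma RegularChannel.measurable_Pout (h : RegularChannel Δ φ B) :
    Measurable fun p : ℝ × ℝ => Pout Δ PA φ p.1 p.2 := by
  unfold Pout
  exact (h.measurable_integrand.stronglyMeasurable.integral_prod_right (ν := PA)).measurable.const_mul _

lemma RegularChannel.continuous_Pout (h : RegularChannel Δ φ B) :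
    Continuous fun p : ℝ × ℝ => Pout Δ PA φ p.1 p.2 := by
  unfold Pout
  refine continuous_const.mul ?_
  refine continuous_of_dominated (bound := fun _ => 1) ?_ ?_ (integrable_const _) ?_
  · intro p
    exact (h.integrable p.1 p.2).aestronglyMeasurable
  · intro p
    refine Filter.Eventually.of_forall fun a => ?_
    rw [Real.norm_eq_abs, abs_of_pos (Real.exp_pos _)]
    exact exp_neg_sq_div_le_one h.pos _
  · refine Filter.Eventually.of_forall fun a => ?_
    have := (h.cont a).comp (continuous_snd (X := ℝ) (Y := ℝ))
    exact Real.continuous_exp.comp (((continuous_fst.sub this).pow 2).neg.div_const _)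

lemma RegularChannel.measurable_Pout_comp (h : RegularChannel Δ φ B) {E : Type*}
    [MeasurableSpace E] {f g : E → ℝ} (hf : Measurable f) (hg : Measurable g) :
    Measurable fun e => Pout Δ PA φ (f e) (g e) := by
  have h1 : Measurable fun e => (f e, g e) := hf.prodMk hg
  have h2 := (h.measurable_Pout (PA := PA)).comp h1
  exact h2

lemma RegularChannel.measurable_avgPout (h : RegularChannel Δ φ B) {E : Type*}
    [MeasurableSpace E] {f g c : E → ℝ} (hf : Measurable f) (hg : Measurable g)
    (hc : Measurable c) : Measurable fun e => avgPout Δ PA φ (f e) (g e) (c e) := by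
  unfold avgPout
  have : Measurable fun p : E × ℝ => Pout Δ PA φ (f p.1) (g p.1 + c p.1 * p.2) :=
    h.measurable_Pout_comp (by fun_prop) (by fun_prop)
  exact (this.stronglyMeasurable.integral_prod_right (ν := stdG)).measurable

lemma RegularChannel.integrable_Pout (h : RegularChannel Δ φ B) {E : Type*}
    [MeasurableSpace E] {μ : Measure E} [IsFiniteMeasure μ] (y : ℝ) {g : E → ℝ}
    (hg : Measurable g) : Integrable (fun e => Pout Δ PA φ y (g e)) μ := by
  refine Integrable.mono' (integrable_const ((Real.sqrt (2 * π * Δ))⁻¹)) ?_ ?_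
  · exact (h.measurable_Pout_comp measurable_const hg).aestronglyMeasurable
  · refine Filter.Eventually.of_forall fun a => ?_
    rw [Real.norm_eq_abs, abs_of_pos (h.Pout_pos _ _)]
    exact h.Pout_le_const _ _

lemma RegularChannel.le_avgPout (h : RegularChannel Δ φ B) (y g c : ℝ) :
    loEnv Δ B y ≤ avgPout Δ PA φ y g c := by
  have := integral_mono (μ := stdG) (integrable_const (loEnv Δ B y))
    (h.integrable_Pout (PA := PA) y (g := fun w => g + c * w) (by fun_prop))
    fun w => h.le_Pout _ _
  simpa [avgPout] using this

lemma RegularChannel.avgPout_le (h : RegularChannel Δ φ B) (y g c : ℝ) :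
    avgPout Δ PA φ y g c ≤ hiEnv Δ B y := by
  have := integral_mono (μ := stdG)
    (h.integrable_Pout (PA := PA) y (g := fun w => g + c * w) (by fun_prop))
    (integrable_const (hiEnv Δ B y)) fun w => h.Pout_le _ _
  simpa [avgPout] using this

lemma RegularChannel.avgPout_pos (h : RegularChannel Δ φ B) (y g c : ℝ) :
    0 < avgPout Δ PA φ y g c :=
  (loEnv_pos h.pos y).trans_le (h.le_avgPout y g c)

lemma RegularChannel.continuous_avgPout (h : RegularChannel Δ φ B) :
    Continuous fun p : ℝ × ℝ × ℝ => avgPout Δ PA φ p.1 p.2.1 p.2.2 := by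
  unfold avgPout
  refine continuous_of_dominated (bound := fun _ => (Real.sqrt (2 * π * Δ))⁻¹) ?_ ?_
    (integrable_const _) ?_
  · intro p
    exact (h.integrable_Pout _ (by fun_prop)).aestronglyMeasurable
  · intro p
    refine Filter.Eventually.of_forall fun a => ?_
    rw [Real.norm_eq_abs, abs_of_pos (h.Pout_pos _ _)]
    exact h.Pout_le_const _ _
  · refine Filter.Eventually.of_forall fun w => ?_
    exact (h.continuous_Pout (PA := PA)).comp
      (by fun_prop : Continuous fun p : ℝ × ℝ × ℝ => (p.1, p.2.1 + p.2.2 * w))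

lemma abs_log_sub_log_le_of_env (hΔ : 0 < Δ) {y p q : ℝ}
    (hp : loEnv Δ B y ≤ p) (hp' : p ≤ hiEnv Δ B y) (hq : loEnv Δ B y ≤ q)
    (hq' : q ≤ hiEnv Δ B y) :
    |Real.log p - Real.log q| ≤ (4 * B * |y| + B ^ 2) / (2 * Δ) := by
  have key : Real.log (hiEnv Δ B y) - Real.log (loEnv Δ B y) = (4 * B * |y| + B ^ 2) / (2 * Δ) := by
    have : (0 : ℝ) < (Real.sqrt (2 * π * Δ))⁻¹ := by positivity
    unfold hiEnv loEnv
    rw [Real.log_mul this.ne' (Real.exp_ne_zero _), Real.log_mul this.ne' (Real.exp_ne_zero _),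
      Real.log_exp, Real.log_exp]
    ring
  have hl := loEnv_pos (B := B) hΔ y
  have a1 := Real.log_le_log hl hp
  have a2 := Real.log_le_log hl hq
  have a3 := Real.log_le_log (hl.trans_le hp) hp'
  have a4 := Real.log_le_log (hl.trans_le hq) hq'
  rw [abs_le]; constructor <;> linarith

lemma RegularChannel.slope_bound (h : RegularChannel Δ φ B) (x : ℝ) (a : Fin kA → ℝ) (z : ℝ) :
    (4 * B * |φ x a + Real.sqrt Δ * z| + B ^ 2) / (2 * Δ) ≤ llrSlope Δ B * (1 + |z|) := by
  have hp := h.pos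
  have hB := h.nonneg
  have h1 : |φ x a + Real.sqrt Δ * z| ≤ B + Real.sqrt Δ * |z| := by
    refine (abs_add_le _ _).trans (add_le_add (h.bound x a) ?_)
    rw [abs_mul, abs_of_nonneg (Real.sqrt_nonneg _)]
  unfold llrSlope
  rw [div_mul_eq_mul_div]
  gcongr
  have hz := abs_nonneg z
  have hs := Real.sqrt_nonneg Δ
  nlinarith [mul_le_mul_of_nonneg_left h1 hB, mul_nonneg hB hs, mul_nonneg (mul_nonneg hB hs) hz,
    mul_nonneg (mul_nonneg hB hB) hz]

lemma integrable_abs_stdG : Integrable (fun z : ℝ => |z|) stdG := by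
  have : MemLp (id : ℝ → ℝ) 1 stdG := memLp_id_gaussianReal 1
  exact (memLp_one_iff_integrable.1 this).abs

lemma integrable_one_add_abs_stdG (c : ℝ) : Integrable (fun z : ℝ => c * (1 + |z|)) stdG :=
  ((integrable_const 1).add integrable_abs_stdG).const_mul c

lemma gaussianPDF_eq_ofReal (hΔ : 0 < Δ) (c y : ℝ) : gaussianPDF c Δ.toNNReal y =
    ENNReal.ofReal ((Real.sqrt (2 * π * Δ))⁻¹ * Real.exp (-(y - c) ^ 2 / (2 * Δ))) := by
  unfold gaussianPDF gaussianPDFReal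
  simp only [Real.coe_toNNReal _ hΔ.le]

lemma lintegral_stdG_affine (hΔ : 0 < Δ) (c : ℝ) {F : ℝ → ENNReal} (hF : Measurable F) :
    ∫⁻ z, F (c + Real.sqrt Δ * z) ∂stdG
      = ∫⁻ y, F y * ENNReal.ofReal
        ((Real.sqrt (2 * π * Δ))⁻¹ * Real.exp (-(y - c) ^ 2 / (2 * Δ))) := by
  have hmap : stdG.map (fun z => c + Real.sqrt Δ * z) = gaussianReal c Δ.toNNReal := by
    have : (fun z => c + Real.sqrt Δ * z) = (fun x => c + x) ∘ (fun z => Real.sqrt Δ * z) := rfl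
    rw [this, ← Measure.map_map (by fun_prop) (by fun_prop), stdG, gaussianReal_map_const_mul,
      gaussianReal_map_const_add]
    congr 1
    · ring
    · ext; simp [Real.sq_sqrt hΔ.le, hΔ.le]
  rw [← lintegral_map hF (by fun_prop), hmap,
    gaussianReal_of_var_ne_zero _ (by simpa using hΔ),
    lintegral_withDensity_eq_lintegral_mul _ (measurable_gaussianPDF _ _) hF]
  simp_rw [Pi.mul_apply, gaussianPDF_eq_ofReal hΔ, mul_comm]

lemma RegularChannel.lintegral_output (h : RegularChannel Δ φ B) (u : ℝ) {F : ℝ → ENNReal}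
    (hF : Measurable F) :
    ∫⁻ p, F (φ u p.1 + Real.sqrt Δ * p.2) ∂(PA.prod stdG)
      = ∫⁻ y, F y * ENNReal.ofReal (Pout Δ PA φ y u) := by
  have hm : Measurable fun a => φ u a := h.meas.comp measurable_prodMk_left
  have hp := h.pos
  rw [lintegral_prod]
  swap
  · have h1 : Measurable fun p : (Fin kA → ℝ) × ℝ => φ u p.1 := hm.comp measurable_fst
    exact (hF.comp (h1.add (measurable_snd.const_mul _))).aemeasurable
  simp_rw [lintegral_stdG_affine hp _ hF]
  have hg : Measurable fun p : (Fin kA → ℝ) × ℝ => ENNReal.ofReal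
      ((Real.sqrt (2 * π * Δ))⁻¹ * Real.exp (-(p.2 - φ u p.1) ^ 2 / (2 * Δ))) := by
    have h1 : Measurable fun p : (Fin kA → ℝ) × ℝ => φ u p.1 := hm.comp measurable_fst
    exact (((((measurable_snd.sub h1).pow_const 2).neg.div_const _).exp).const_mul _).ennreal_ofReal
  rw [lintegral_lintegral_swap]
  · refine lintegral_congr fun y => ?_
    have hg' : Measurable fun a => ENNReal.ofReal
        ((Real.sqrt (2 * π * Δ))⁻¹ * Real.exp (-(y - φ u a) ^ 2 / (2 * Δ))) := by
      have h2 := hg.comp (measurable_prodMk_right (y := y))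
      exact h2
    rw [lintegral_const_mul _ hg', Pout, ← integral_const_mul,
      ofReal_integral_eq_lintegral_ofReal
      ((h.integrable y u).const_mul _) (Filter.Eventually.of_forall fun a => by positivity)]
  · exact ((hF.comp measurable_snd).mul hg).aemeasurable

lemma RegularChannel.lintegral_Pout (h : RegularChannel Δ φ B) (u : ℝ) :
    ∫⁻ y, ENNReal.ofReal (Pout Δ PA φ y u) = 1 := by
  have := h.lintegral_output (PA := PA) u (F := fun _ => 1) measurable_const
  simpa using this.symm

lemma RegularChannel.ofReal_avgPout (h : RegularChannel Δ φ B) (y g c : ℝ) :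
    ENNReal.ofReal (avgPout Δ PA φ y g c)
      = ∫⁻ w, ENNReal.ofReal (Pout Δ PA φ y (g + c * w)) ∂stdG := by
  unfold avgPout
  rw [ofReal_integral_eq_lintegral_ofReal (h.integrable_Pout y (by fun_prop))]
  exact Filter.Eventually.of_forall fun w => (h.Pout_pos _ _).le

lemma RegularChannel.lintegral_avgPout (h : RegularChannel Δ φ B) (g c : ℝ) :
    ∫⁻ y, ENNReal.ofReal (avgPout Δ PA φ y g c) = 1 := by
  simp_rw [h.ofReal_avgPout]
  rw [lintegral_lintegral_swap]
  · simp [h.lintegral_Pout]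
  · exact (h.measurable_Pout_comp (by fun_prop) (by fun_prop)).ennreal_ofReal.aemeasurable

end Channel

/-- Normalized scalar product of a row of the matrix with a signal. -/
def dotp {n : ℕ} (k : ℝ) (x : Fin n → ℝ) (Φ : Fin n → ℝ) : ℝ := (∑ i, Φ i * x i) / Real.sqrt k

/-- Normalized squared norm of a signal. -/
def nsq {n : ℕ} (k : ℝ) (x : Fin n → ℝ) : ℝ := (∑ i, x i ^ 2) / k

section Gaussian

lemma map_mul_stdG (c : ℝ) : stdG.map (fun w => c * w) = gaussianReal 0 (c ^ 2).toNNReal := by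
  rw [stdG, gaussianReal_map_const_mul]
  congr 1
  · simp
  · ext; simp [sq_nonneg]

@[fun_prop]
lemma measurable_dotp {n : ℕ} (k : ℝ) (x : Fin n → ℝ) : Measurable (dotp k x) := by
  unfold dotp; fun_prop

lemma nsq_nonneg {n : ℕ} {k : ℝ} (hk : 0 ≤ k) (x : Fin n → ℝ) : 0 ≤ nsq k x := by
  unfold nsq; positivity

lemma dotp_add {n : ℕ} (k : ℝ) (u v : Fin n → ℝ) (Φ : Fin n → ℝ) :
    dotp k (u + v) Φ = dotp k u Φ + dotp k v Φ := by
  simp [dotp, mul_add, Finset.sum_add_distrib, add_div]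

lemma iIndepFun_coord (n : ℕ) : iIndepFun (fun (i : Fin n) (Φ : Fin n → ℝ) => Φ i) (iid n stdG) :=
  iIndepFun_pi (X := fun _ => id) fun _ => aemeasurable_id

lemma map_coord (n : ℕ) (i : Fin n) (P : Measure ℝ) [IsProbabilityMeasure P] :
    (iid n P).map (fun Φ => Φ i) = P :=
  (measurePreserving_eval (fun _ : Fin n => P) i).map_eq

lemma map_sum_mul_stdG {n : ℕ} (x : Fin n → ℝ) (s : Finset (Fin n)) :
    (iid n stdG).map (∑ i ∈ s, fun Φ => Φ i * x i)
      = gaussianReal 0 (∑ i ∈ s, x i ^ 2).toNNReal := by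
  have hI : iIndepFun (fun (i : Fin n) (Φ : Fin n → ℝ) => Φ i * x i) (iid n stdG) :=
    (iIndepFun_coord n).comp (fun i t => t * x i) fun i => by fun_prop
  induction s using Finset.induction_on with
  | empty =>
    simp only [Finset.sum_empty, toNNReal_zero, gaussianReal_zero_var]
    have : (0 : (Fin n → ℝ) → ℝ) = fun _ => 0 := rfl
    rw [this, Measure.map_const]
    simp
  | insert i s hi ih =>
    have h1 : (iid n stdG).map (fun Φ => Φ i * x i) = gaussianReal 0 (x i ^ 2).toNNReal := by
      rw [← map_mul_stdG]
      nth_rewrite 2 [← map_coord n i stdG]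
      rw [Measure.map_map (by fun_prop) (by fun_prop)]
      congr 1; ext Φ; simp [mul_comm]
    rw [Finset.sum_insert hi, gaussianReal_add_gaussianReal_of_indepFun
      (hI.indepFun_finsetSum_of_notMem (fun i => by fun_prop) hi).symm h1 ih, Finset.sum_insert hi,
      ← Real.toNNReal_add (sq_nonneg _) (Finset.sum_nonneg fun i _ => sq_nonneg _)]
    simp

lemma map_dotp {n : ℕ} {k : ℝ} (hk : 0 ≤ k) (x : Fin n → ℝ) :
    (iid n stdG).map (dotp k x) = stdG.map (fun w => Real.sqrt (nsq k x) * w) := by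
  rw [map_mul_stdG, Real.sq_sqrt (nsq_nonneg hk x)]
  have : dotp k x = (fun t => (Real.sqrt k)⁻¹ * t) ∘ (∑ i, fun Φ : Fin n → ℝ => Φ i * x i) := by
    ext Φ; simp [dotp, div_eq_inv_mul]
  rw [this, ← Measure.map_map (by fun_prop) (by fun_prop), map_sum_mul_stdG,
    gaussianReal_map_const_mul]
  congr 1
  · simp
  · ext
    have h0 : 0 ≤ ∑ i, x i ^ 2 := by positivity
    rw [NNReal.coe_mul, Real.coe_toNNReal _ h0, Real.coe_toNNReal _ (nsq_nonneg hk x)]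
    simp [nsq, Real.sq_sqrt hk, div_eq_inv_mul]

lemma indepFun_dotp {n : ℕ} (k : ℝ) {ι : Type*} [Fintype ι] {x : ι → Fin n → ℝ} {v : Fin n → ℝ}
    (h : ∀ i, v i ≠ 0 → ∀ j, x j i = 0) :
    IndepFun (fun Φ j => dotp k (x j) Φ) (dotp k v) (iid n stdG) := by
  classical
  set T : Finset (Fin n) := Finset.univ.filter fun i => v i ≠ 0
  have hd := (iIndepFun_coord n).indepFun_finset Tᶜ T disjoint_compl_left fun i => by fun_prop
  have key (y : Fin n → ℝ) (U : Finset (Fin n)) (hy : ∀ i, i ∉ U → y i = 0) :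
      dotp k y = (fun g : U → ℝ => (∑ i, g i * y i) / Real.sqrt k) ∘
        (fun (Φ : Fin n → ℝ) (i : U) => Φ i) := by
    ext Φ
    simp only [dotp, Function.comp]
    congr 1
    rw [Finset.sum_coe_sort U (fun i => Φ i * y i)]
    symm
    apply Finset.sum_subset (Finset.subset_univ _)
    intro i _ hi
    simp [hy i hi]
  have hx : ∀ j i, i ∉ Tᶜ → x j i = 0 := fun j i hi => h i (by simpa [T] using hi) j
  have hv : ∀ i, i ∉ T → v i = 0 := fun i hi => by simpa [T] using hi
  simp_rw [key (x _) _ (hx _), key v _ hv]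
  exact hd.comp (φ := fun (g : (Tᶜ : Finset (Fin n)) → ℝ) j =>
    (∑ i, g i * x j i) / Real.sqrt k) (by fun_prop) (by fun_prop)

lemma lintegral_dotp_family {n : ℕ} {k : ℝ} (hk : 0 ≤ k) {ι : Type*} [Fintype ι]
    {x : ι → Fin n → ℝ} {v : Fin n → ℝ} (h : ∀ i, v i ≠ 0 → ∀ j, x j i = 0)
    {H : (ι → ℝ) → ℝ → ENNReal} (hH : Measurable fun p : (ι → ℝ) × ℝ => H p.1 p.2) :
    ∫⁻ Φ, H (fun j => dotp k (x j) Φ) (dotp k v Φ) ∂(iid n stdG)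
      = ∫⁻ Φ, ∫⁻ w, H (fun j => dotp k (x j) Φ) (Real.sqrt (nsq k v) * w) ∂stdG
        ∂(iid n stdG) := by
  have hx : Measurable fun Φ j => dotp k (x j) Φ := by fun_prop
  have h1 := lintegral_map (μ := iid n stdG) hH
    (g := fun Φ => (fun j => dotp k (x j) Φ, dotp k v Φ)) (by fun_prop)
  rw [(indepFun_iff_map_prod_eq_prod_map_map (by fun_prop) (by fun_prop)).1 (indepFun_dotp k h),
    map_dotp hk] at h1
  refine h1.symm.trans ?_
  have : IsProbabilityMeasure (stdG.map fun w => Real.sqrt (nsq k v) * w) :=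
    Measure.isProbabilityMeasure_map (by fun_prop)
  have h2 (e : ι → ℝ) : Measurable (H e) := by
    have h3 := hH.comp (measurable_prodMk_left (x := e))
    exact h3
  rw [lintegral_prod _ hH.aemeasurable, lintegral_map hH.lintegral_prod_right' hx]
  refine lintegral_congr fun e => ?_
  exact lintegral_map (h2 _) (by fun_prop)

end Gaussian

/-- The observation associated to the channel input `g` and the noise `p`. -/
def out (Δ : ℝ) {kA : ℕ} (φ : ℝ → (Fin kA → ℝ) → ℝ) (g : ℝ) (p : (Fin kA → ℝ) × ℝ) : ℝ :=
  φ g p.1 + Real.sqrt Δ * p.2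

/-- The law of the noise of one observation. -/
def noise {kA : ℕ} (PA : Measure (Fin kA → ℝ)) : Measure ((Fin kA → ℝ) × ℝ) := PA.prod stdG

/-- The law of one row of the matrix together with the noise of the observation. -/
def rowLaw (n : ℕ) {kA : ℕ} (PA : Measure (Fin kA → ℝ)) :
    Measure ((Fin n → ℝ) × ((Fin kA → ℝ) × ℝ)) := (iid n stdG).prod (noise PA)

instance {kA : ℕ} (PA : Measure (Fin kA → ℝ)) [IsProbabilityMeasure PA] :
    IsProbabilityMeasure (noise PA) := by unfold noise; infer_instance

instance (n : ℕ) {kA : ℕ} (PA : Measure (Fin kA → ℝ)) [IsProbabilityMeasure PA] :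
    IsProbabilityMeasure (rowLaw n PA) := by unfold rowLaw; infer_instance

/-- The log-likelihood ratio between the channel with input `g` and the channel with averaged
input `g' + c w`. -/
def llr (Δ : ℝ) {kA : ℕ} (PA : Measure (Fin kA → ℝ)) (φ : ℝ → (Fin kA → ℝ) → ℝ)
    (g g' c : ℝ) (p : (Fin kA → ℝ) × ℝ) : ℝ :=
  Real.log (Pout Δ PA φ (out Δ φ g p) g) - Real.log (avgPout Δ PA φ (out Δ φ g p) g' c)

/-- The information carried by an observation when the input has a known part of size `a`, an
unknown part of size `b`, and the decoder models the latter with size `c`. -/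
def Jinfo (Δ : ℝ) {kA : ℕ} (PA : Measure (Fin kA → ℝ)) (φ : ℝ → (Fin kA → ℝ) → ℝ)
    (a b c : ℝ) : ℝ :=
  ∫ p : (ℝ × ℝ) × ((Fin kA → ℝ) × ℝ),
    llr Δ PA φ (a * p.1.1 + b * p.1.2) (a * p.1.1) c p.2 ∂((stdG.prod stdG).prod (noise PA))

section Row

variable {Δ : ℝ} {kA : ℕ} {PA : Measure (Fin kA → ℝ)} [IsProbabilityMeasure PA]
  {φ : ℝ → (Fin kA → ℝ) → ℝ} {B : ℝ}

lemma RegularChannel.measurable_out (h : RegularChannel Δ φ B) {E : Type*} [MeasurableSpace E]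
    {g : E → ℝ} {p : E → (Fin kA → ℝ) × ℝ} (hg : Measurable g) (hp : Measurable p) :
    Measurable fun e => out Δ φ (g e) (p e) := by
  unfold out
  have h1 : Measurable fun e => (g e, (p e).1) := hg.prodMk (measurable_fst.comp hp)
  have h2 := h.meas.comp h1
  exact h2.add ((measurable_snd.comp hp).const_mul _)

lemma RegularChannel.measurable_llr (h : RegularChannel Δ φ B) {E : Type*} [MeasurableSpace E]
    {g g' c : E → ℝ} {p : E → (Fin kA → ℝ) × ℝ} (hg : Measurable g) (hg' : Measurable g')
    (hc : Measurable c) (hp : Measurable p) :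
    Measurable fun e => llr Δ PA φ (g e) (g' e) (c e) (p e) := by
  unfold llr
  exact (h.measurable_Pout_comp (h.measurable_out hg hp) hg).log.sub
    (h.measurable_avgPout (h.measurable_out hg hp) hg' hc).log

lemma RegularChannel.abs_llr_le (h : RegularChannel Δ φ B) (g g' c : ℝ)
    (p : (Fin kA → ℝ) × ℝ) : |llr Δ PA φ g g' c p| ≤ llrSlope Δ B * (1 + |p.2|) :=
  (abs_log_sub_log_le_of_env h.pos (h.le_Pout _ _) (h.Pout_le _ _) (h.le_avgPout _ _ _)
    (h.avgPout_le _ _ _)).trans (h.slope_bound _ _ _)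

lemma RegularChannel.abs_log_Pout_sub_le (h : RegularChannel Δ φ B) (g g' : ℝ)
    (p : (Fin kA → ℝ) × ℝ) :
    |Real.log (Pout Δ PA φ (out Δ φ g p) g) - Real.log (Pout Δ PA φ (out Δ φ g p) g')|
      ≤ llrSlope Δ B * (1 + |p.2|) :=
  (abs_log_sub_log_le_of_env h.pos (h.le_Pout _ _) (h.Pout_le _ _) (h.le_Pout _ _)
    (h.Pout_le _ _)).trans (h.slope_bound _ _ _)

lemma integrable_noise_bound {f : ℝ → ℝ} (hf : Integrable f stdG) :
    Integrable (fun p : (Fin kA → ℝ) × ℝ => f p.2) (noise PA) := hf.comp_snd _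

lemma integrable_row_bound {E : Type*} [MeasurableSpace E] (μ : Measure E) [IsProbabilityMeasure μ]
    {f : ℝ → ℝ} (hf : Integrable f stdG) :
    Integrable (fun p : E × ((Fin kA → ℝ) × ℝ) => f p.2.2) (μ.prod (noise PA)) :=
  (integrable_noise_bound hf).comp_snd μ

lemma integrable_exp_abs_stdG (c : ℝ) : Integrable (fun z : ℝ => Real.exp (c * (1 + |z|))) stdG := by
  have := (integrable_exp_mul_abs (X := id) (t := c) (μ := stdG)
    (integrable_exp_mul_gaussianReal c) (integrable_exp_mul_gaussianReal (-c))).const_mul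
    (Real.exp c)
  refine this.congr (Filter.Eventually.of_forall fun z => ?_)
  simp only [id]
  rw [← Real.exp_add]; ring_nf

lemma RegularChannel.integrable_llr (h : RegularChannel Δ φ B) {E : Type*} [MeasurableSpace E]
    (μ : Measure E) [IsProbabilityMeasure μ] {g g' c : E → ℝ} (hg : Measurable g)
    (hg' : Measurable g') (hc : Measurable c) :
    Integrable (fun p : E × ((Fin kA → ℝ) × ℝ) => llr Δ PA φ (g p.1) (g' p.1) (c p.1) p.2)
      (μ.prod (noise PA)) := by
  refine Integrable.mono' (integrable_row_bound μ (integrable_one_add_abs_stdG (llrSlope Δ B)))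
    (h.measurable_llr (hg.comp measurable_fst) (hg'.comp measurable_fst) (hc.comp measurable_fst)
      measurable_snd).aestronglyMeasurable (Filter.Eventually.of_forall fun p => ?_)
  exact h.abs_llr_le _ _ _ _

lemma RegularChannel.lintegral_out (h : RegularChannel Δ φ B) (u : ℝ) {F : ℝ → ENNReal}
    (hF : Measurable F) :
    ∫⁻ p, F (out Δ φ u p) ∂(noise PA) = ∫⁻ y, F y * ENNReal.ofReal (Pout Δ PA φ y u) :=
  h.lintegral_output u hF

lemma RegularChannel.lintegral_div_avgPout (h : RegularChannel Δ φ B) (g c : ℝ)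
    {F : ℝ → ENNReal} (hF : Measurable F) :
    ∫⁻ w, ∫⁻ p, F (out Δ φ (g + c * w) p)
        / ENNReal.ofReal (avgPout Δ PA φ (out Δ φ (g + c * w) p) g c) ∂(noise PA) ∂stdG
      = ∫⁻ y, F y := by
  have hm : Measurable fun y => F y / ENNReal.ofReal (avgPout Δ PA φ y g c) :=
    hF.div (h.measurable_avgPout measurable_id measurable_const measurable_const).ennreal_ofReal
  simp_rw [h.lintegral_out (PA := PA) _ hm]
  have hP : Measurable fun p : ℝ × ℝ => ENNReal.ofReal (Pout Δ PA φ p.2 (g + c * p.1)) :=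
    (h.measurable_Pout_comp (by fun_prop) (by fun_prop)).ennreal_ofReal
  rw [lintegral_lintegral_swap]
  · refine lintegral_congr fun y => ?_
    have hP' : Measurable fun w => ENNReal.ofReal (Pout Δ PA φ y (g + c * w)) :=
      (h.measurable_Pout_comp (by fun_prop) (by fun_prop)).ennreal_ofReal
    rw [lintegral_const_mul _ hP', ← h.ofReal_avgPout, ENNReal.div_mul_cancel]
    · simpa using h.avgPout_pos y g c
    · exact ENNReal.ofReal_ne_top
  · exact ((hm.comp measurable_snd).mul hP).aemeasurable

lemma RegularChannel.lintegral_row_ratio (h : RegularChannel Δ φ B) {n : ℕ} {k : ℝ} (hk : 0 ≤ k)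
    {x u v : Fin n → ℝ} (hv : ∀ i, v i ≠ 0 → x i = 0 ∧ u i = 0) :
    ∫⁻ r, ENNReal.ofReal (Pout Δ PA φ (out Δ φ (dotp k (u + v) r.1) r.2) (dotp k x r.1)
      / avgPout Δ PA φ (out Δ φ (dotp k (u + v) r.1) r.2) (dotp k u r.1) (Real.sqrt (nsq k v)))
      ∂(rowLaw n PA) = 1 := by
  set c := Real.sqrt (nsq k v)
  have hm : Measurable fun q : ((Fin 2 → ℝ) × ℝ) × ((Fin kA → ℝ) × ℝ) =>
      ENNReal.ofReal (Pout Δ PA φ (out Δ φ (q.1.1 1 + q.1.2) q.2) (q.1.1 0)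
      / avgPout Δ PA φ (out Δ φ (q.1.1 1 + q.1.2) q.2) (q.1.1 1) c) := by
    have ho : Measurable fun q : ((Fin 2 → ℝ) × ℝ) × ((Fin kA → ℝ) × ℝ) =>
      out Δ φ (q.1.1 1 + q.1.2) q.2 := h.measurable_out (by fun_prop) (by fun_prop)
    exact ((h.measurable_Pout_comp ho (by fun_prop)).div
      (h.measurable_avgPout ho (by fun_prop) measurable_const)).ennreal_ofReal
  have hm' : Measurable fun r : (Fin n → ℝ) × ((Fin kA → ℝ) × ℝ) =>
      ENNReal.ofReal (Pout Δ PA φ (out Δ φ (dotp k (u + v) r.1) r.2) (dotp k x r.1)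
      / avgPout Δ PA φ (out Δ φ (dotp k (u + v) r.1) r.2) (dotp k u r.1) c) := by
    have ho : Measurable fun r : (Fin n → ℝ) × ((Fin kA → ℝ) × ℝ) =>
      out Δ φ (dotp k (u + v) r.1) r.2 := h.measurable_out (by fun_prop) (by fun_prop)
    exact ((h.measurable_Pout_comp ho (by fun_prop)).div
      (h.measurable_avgPout ho (by fun_prop) measurable_const)).ennreal_ofReal
  rw [rowLaw, lintegral_prod _ hm'.aemeasurable]
  simp_rw [dotp_add]
  refine (lintegral_dotp_family hk (x := ![x, u]) (v := v)
    (fun i hi j => by fin_cases j <;> simp [hv i hi]) (H := fun e t => ∫⁻ p, ENNReal.ofReal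
    (Pout Δ PA φ (out Δ φ (e 1 + t) p) (e 0) / avgPout Δ PA φ (out Δ φ (e 1 + t) p) (e 1) c)
      ∂(noise PA)) hm.lintegral_prod_right').trans ?_
  have hdiv (t y g : ℝ) : ENNReal.ofReal (t / avgPout Δ PA φ y g c)
      = ENNReal.ofReal t / ENNReal.ofReal (avgPout Δ PA φ y g c) :=
    ENNReal.ofReal_div_of_pos (h.avgPout_pos _ _ _)
  simp_rw [hdiv]
  have hone (Φ : Fin n → ℝ) := (h.lintegral_div_avgPout (PA := PA) (dotp k u Φ) c
    (F := fun y => ENNReal.ofReal (Pout Δ PA φ y (dotp k x Φ)))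
    (h.measurable_Pout_comp measurable_id measurable_const).ennreal_ofReal).trans
    (h.lintegral_Pout (dotp k x Φ))
  refine (lintegral_congr hone).trans (by simp)

lemma RegularChannel.integral_row_llr (h : RegularChannel Δ φ B) {n : ℕ} {k : ℝ} (hk : 0 ≤ k)
    {u v : Fin n → ℝ} (hv : ∀ i, v i ≠ 0 → u i = 0) (c : ℝ) :
    ∫ r, llr Δ PA φ (dotp k (u + v) r.1) (dotp k u r.1) c r.2 ∂(rowLaw n PA)
      = Jinfo Δ PA φ (Real.sqrt (nsq k u)) (Real.sqrt (nsq k v)) c := by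
  have h1 : (rowLaw n PA).map (Prod.map (fun Φ => (dotp k u Φ, dotp k v Φ)) id)
      = ((stdG.prod stdG).prod (noise PA)).map (Prod.map (Prod.map
        (fun w => Real.sqrt (nsq k u) * w) (fun w => Real.sqrt (nsq k v) * w)) id) := by
    rw [rowLaw, ← Measure.map_prod_map _ _ (by fun_prop) measurable_id,
      ← Measure.map_prod_map _ _ (by fun_prop) measurable_id,
      ← Measure.map_prod_map _ _ (by fun_prop) (by fun_prop), ← map_dotp hk, ← map_dotp hk]
    congr 1
    have := (indepFun_dotp k (x := fun _ : Unit => u) (v := v) fun i hi _ => hv i hi).comp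
      (measurable_pi_apply ()) measurable_id
    exact (indepFun_iff_map_prod_eq_prod_map_map (by fun_prop) (by fun_prop)).1 this
  have hm : Measurable fun q : (ℝ × ℝ) × ((Fin kA → ℝ) × ℝ) =>
      llr Δ PA φ (q.1.1 + q.1.2) q.1.1 c q.2 :=
    h.measurable_llr (by fun_prop) (by fun_prop) measurable_const measurable_snd
  have e1 := integral_map (μ := rowLaw n PA)
    (φ := Prod.map (fun Φ => (dotp k u Φ, dotp k v Φ)) id) (by fun_prop) hm.aestronglyMeasurable
  have e2 := integral_map (μ := (stdG.prod stdG).prod (noise PA)) (φ := Prod.map (Prod.map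
        (fun w => Real.sqrt (nsq k u) * w) (fun w => Real.sqrt (nsq k v) * w)) id)
    (by fun_prop) hm.aestronglyMeasurable
  rw [h1, e2] at e1
  simp_rw [dotp_add]
  exact e1.symm

end Row

section Info

lemma exp_le_one_add_add_sq (t : ℝ) : Real.exp t ≤ 1 + t + t ^ 2 * Real.exp |t| := by
  rcases le_total 0 t with ht | ht
  · rw [abs_of_nonneg ht]
    have h1 : 1 - t ≤ Real.exp (-t) := by linarith [Real.add_one_le_exp (-t)]
    have h2 : Real.exp t * Real.exp (-t) = 1 := by rw [← Real.exp_add]; simp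
    have h3 := mul_le_mul_of_nonneg_left h1 (Real.exp_pos t).le
    nlinarith [Real.exp_pos t, mul_le_mul_of_nonneg_left h3 ht]
  · have h1 : 1 - t ≤ Real.exp (-t) := by linarith [Real.add_one_le_exp (-t)]
    have h2 : Real.exp t * Real.exp (-t) = 1 := by rw [← Real.exp_add]; simp
    have h3 := mul_le_mul_of_nonneg_left h1 (Real.exp_pos t).le
    have h5 : Real.exp t ≤ 1 + t + t ^ 2 := by nlinarith [sq_nonneg t, mul_nonneg (sq_nonneg t) (neg_nonneg.2 ht)]
    have h6 : 1 ≤ Real.exp |t| := Real.one_le_exp (abs_nonneg t)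
    nlinarith [sq_nonneg t]

lemma sq_mul_exp_le {b : ℝ} (hb : 0 ≤ b) : b ^ 2 * Real.exp b ≤ 2 * Real.exp (2 * b) := by
  have := Real.quadratic_le_exp_of_nonneg hb
  rw [two_mul b, Real.exp_add]
  nlinarith [Real.exp_pos b]

lemma integral_log_nonpos {E : Type*} [MeasurableSpace E] {μ : Measure E} [IsProbabilityMeasure μ]
    {f : E → ℝ} (hf : Measurable f) (hpos : ∀ e, 0 < f e)
    (h1 : ∫⁻ e, ENNReal.ofReal (f e) ∂μ ≤ 1) (hlog : Integrable (fun e => Real.log (f e)) μ) :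
    ∫ e, Real.log (f e) ∂μ ≤ 0 := by
  have hint : Integrable f μ := by
    refine ⟨hf.aestronglyMeasurable, ?_⟩
    rw [hasFiniteIntegral_iff_ofReal (Filter.Eventually.of_forall fun e => (hpos e).le)]
    exact h1.trans_lt ENNReal.one_lt_top
  have h2 : ∫ e, f e ∂μ ≤ 1 := by
    rw [integral_eq_lintegral_of_nonneg_ae (Filter.Eventually.of_forall fun e => (hpos e).le)
      hf.aestronglyMeasurable]
    exact ENNReal.toReal_le_of_le_ofReal zero_le_one (by simpa using h1)
  calc ∫ e, Real.log (f e) ∂μ ≤ ∫ e, (f e - 1) ∂μ :=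
        integral_mono hlog (hint.sub (integrable_const 1)) fun e => Real.log_le_sub_one_of_pos (hpos e)
    _ = ∫ e, f e ∂μ - 1 := by rw [integral_sub hint (integrable_const 1)]; simp
    _ ≤ 0 := by linarith

/-- A bound on the second order term of the moment generating function of the log-likelihood
ratios. -/
def mgfConst (Δ B : ℝ) : ℝ := ∫ z, 2 * Real.exp (2 * llrSlope Δ B * (1 + |z|)) ∂stdG

variable {Δ : ℝ} {kA : ℕ} {PA : Measure (Fin kA → ℝ)} [IsProbabilityMeasure PA]
  {φ : ℝ → (Fin kA → ℝ) → ℝ} {B : ℝ}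

lemma integral_row_bound {E : Type*} [MeasurableSpace E] (μ : Measure E) [IsProbabilityMeasure μ]
    (f : ℝ → ℝ) :
    ∫ p : E × ((Fin kA → ℝ) × ℝ), f p.2.2 ∂(μ.prod (noise PA)) = ∫ z, f z ∂stdG := by
  have h1 := integral_fun_snd (μ := μ) (ν := noise PA) (fun p : (Fin kA → ℝ) × ℝ => f p.2)
  have h2 := integral_fun_snd (μ := PA) (ν := stdG) f
  rw [h1, noise, h2]; simp

lemma RegularChannel.abs_Jinfo_le (h : RegularChannel Δ φ B) (a b c : ℝ) :
    |Jinfo Δ PA φ a b c| ≤ ∫ z, llrSlope Δ B * (1 + |z|) ∂stdG := by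
  rw [← integral_row_bound (PA := PA) (stdG.prod stdG), ← Real.norm_eq_abs]
  exact norm_integral_le_of_norm_le
    (integrable_row_bound _ (integrable_one_add_abs_stdG (llrSlope Δ B)))
    (Filter.Eventually.of_forall fun p => h.abs_llr_le _ _ _ _)

lemma RegularChannel.continuous_llr (h : RegularChannel Δ φ B) {E : Type*} [TopologicalSpace E]
    {g g' c : E → ℝ} (hg : Continuous g) (hg' : Continuous g') (hc : Continuous c)
    (p : (Fin kA → ℝ) × ℝ) : Continuous fun e => llr Δ PA φ (g e) (g' e) (c e) p := by
  have ho : Continuous fun e => out Δ φ (g e) p := by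
    unfold out
    exact ((h.cont p.1).comp hg).add continuous_const
  unfold llr
  have h1 : Continuous fun e => Pout Δ PA φ (out Δ φ (g e) p) (g e) :=
    (h.continuous_Pout (PA := PA)).comp (ho.prodMk hg)
  have h2 : Continuous fun e => avgPout Δ PA φ (out Δ φ (g e) p) (g' e) (c e) :=
    (h.continuous_avgPout (PA := PA)).comp (ho.prodMk (hg'.prodMk hc))
  exact (h1.log fun e => (h.Pout_pos _ _).ne').sub (h2.log fun e => (h.avgPout_pos _ _ _).ne')

lemma RegularChannel.continuous_Jinfo (h : RegularChannel Δ φ B) {E : Type*} [TopologicalSpace E]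
    [FirstCountableTopology E] {a b c : E → ℝ} (ha : Continuous a) (hb : Continuous b)
    (hc : Continuous c) : Continuous fun e => Jinfo Δ PA φ (a e) (b e) (c e) := by
  unfold Jinfo
  refine continuous_of_dominated (bound := fun p => llrSlope Δ B * (1 + |p.2.2|)) ?_ ?_
    (integrable_row_bound _ (integrable_one_add_abs_stdG (llrSlope Δ B))) ?_
  · intro e
    exact (h.measurable_llr (by fun_prop) (by fun_prop) (by fun_prop)
      (by fun_prop)).aestronglyMeasurable
  · intro e
    exact Filter.Eventually.of_forall fun p => h.abs_llr_le _ _ _ _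
  · exact Filter.Eventually.of_forall fun p =>
      h.continuous_llr (by fun_prop) (by fun_prop) (by fun_prop) _

lemma RegularChannel.integrable_exp_llr (h : RegularChannel Δ φ B) {E : Type*} [MeasurableSpace E]
    (μ : Measure E) [IsProbabilityMeasure μ] {g g' : E → ℝ} (hg : Measurable g)
    (hg' : Measurable g') (c t : ℝ) :
    Integrable (fun p : E × ((Fin kA → ℝ) × ℝ) =>
      Real.exp (t * llr Δ PA φ (g p.1) (g' p.1) c p.2)) (μ.prod (noise PA)) := by
  refine Integrable.mono' (integrable_row_bound μ (integrable_exp_abs_stdG (|t| * llrSlope Δ B)))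
    ?_ (Filter.Eventually.of_forall fun p => ?_)
  · exact ((h.measurable_llr (hg.comp measurable_fst) (hg'.comp measurable_fst) measurable_const
      measurable_snd).const_mul t).exp.aestronglyMeasurable
  · rw [Real.norm_eq_abs, abs_of_pos (Real.exp_pos _), Real.exp_le_exp]
    refine (le_abs_self _).trans ?_
    rw [abs_mul, mul_assoc]
    exact mul_le_mul_of_nonneg_left (h.abs_llr_le _ _ _ _) (abs_nonneg _)

lemma RegularChannel.integral_exp_llr_le (h : RegularChannel Δ φ B) {E : Type*}
    [MeasurableSpace E] (μ : Measure E) [IsProbabilityMeasure μ] {g g' : E → ℝ}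
    (hg : Measurable g) (hg' : Measurable g') (c : ℝ) {θ : ℝ} (hθ : 0 ≤ θ) (hθ1 : θ ≤ 1) :
    ∫ p, Real.exp (-θ * llr Δ PA φ (g p.1) (g' p.1) c p.2) ∂(μ.prod (noise PA))
      ≤ Real.exp (θ * (-(∫ p, llr Δ PA φ (g p.1) (g' p.1) c p.2 ∂(μ.prod (noise PA)))
        + θ * mgfConst Δ B)) := by
  have hL := h.integrable_llr (PA := PA) μ hg hg' (measurable_const (a := c))
  have hb : Integrable (fun z : ℝ => 2 * Real.exp (2 * llrSlope Δ B * (1 + |z|))) stdG :=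
    (integrable_exp_abs_stdG _).const_mul 2
  have hb' := integrable_row_bound (PA := PA) μ hb
  have key : ∫ p, Real.exp (-θ * llr Δ PA φ (g p.1) (g' p.1) c p.2) ∂(μ.prod (noise PA))
      ≤ ∫ p, ((1 + -θ * llr Δ PA φ (g p.1) (g' p.1) c p.2)
        + θ ^ 2 * (2 * Real.exp (2 * llrSlope Δ B * (1 + |p.2.2|)))) ∂(μ.prod (noise PA)) := by
    refine integral_mono (h.integrable_exp_llr μ hg hg' c (-θ))
      (((integrable_const 1).add (hL.const_mul (-θ))).add (hb'.const_mul (θ ^ 2))) fun p => ?_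
    simp only
    set L := llr Δ PA φ (g p.1) (g' p.1) c p.2
    have hLb : |L| ≤ llrSlope Δ B * (1 + |p.2.2|) := h.abs_llr_le _ _ _ _
    set b := llrSlope Δ B * (1 + |p.2.2|)
    have hb0 : 0 ≤ b := (abs_nonneg _).trans hLb
    refine (exp_le_one_add_add_sq _).trans ?_
    gcongr 1 + _ + ?_
    have e1 : |(-θ * L)| ≤ b := by
      rw [abs_mul, abs_neg, abs_of_nonneg hθ]
      nlinarith [abs_nonneg L]
    have e2 : L ^ 2 ≤ b ^ 2 := sq_le_sq' (by linarith [abs_le.1 hLb]) (abs_le.1 hLb).2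
    calc (-θ * L) ^ 2 * Real.exp |(-θ * L)| = θ ^ 2 * (L ^ 2 * Real.exp |(-θ * L)|) := by ring
      _ ≤ θ ^ 2 * (b ^ 2 * Real.exp b) := by gcongr
      _ ≤ θ ^ 2 * (2 * Real.exp (2 * b)) := mul_le_mul_of_nonneg_left (sq_mul_exp_le hb0) (sq_nonneg θ)
      _ = _ := by rw [mul_assoc 2 (llrSlope Δ B)]
  refine key.trans ?_
  have i1 : Integrable (fun p : E × ((Fin kA → ℝ) × ℝ) =>
      1 + -θ * llr Δ PA φ (g p.1) (g' p.1) c p.2) (μ.prod (noise PA)) :=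
    (integrable_const 1).add (hL.const_mul (-θ))
  rw [integral_add i1 (hb'.const_mul (θ ^ 2)),
    integral_add (integrable_const 1) (hL.const_mul (-θ)), integral_const_mul, integral_const_mul,
    integral_row_bound (PA := PA) μ (fun z => 2 * Real.exp (2 * llrSlope Δ B * (1 + |z|)))]
  simp only [integral_const, probReal_univ, smul_eq_mul, mul_one]
  refine le_trans (le_of_eq ?_) (Real.add_one_le_exp _)
  rw [mgfConst]; ring

lemma conv_map_mul_stdG (s c : ℝ) :
    (stdG.map fun w => s * w) ∗ (stdG.map fun w => c * w)
      = stdG.map fun w => Real.sqrt (s ^ 2 + c ^ 2) * w := by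
  rw [map_mul_stdG, map_mul_stdG, map_mul_stdG, gaussianReal_conv_gaussianReal,
    Real.sq_sqrt (by positivity), ← Real.toNNReal_add (sq_nonneg _) (sq_nonneg _), add_zero]

lemma map_add_mul_stdG (s c : ℝ) :
    (stdG.prod stdG).map (fun p => s * p.1 + c * p.2)
      = stdG.map fun w => Real.sqrt (s ^ 2 + c ^ 2) * w := by
  rw [← conv_map_mul_stdG, Measure.conv, Measure.map_prod_map _ _ (by fun_prop) (by fun_prop),
    Measure.map_map (by fun_prop) (by fun_prop)]
  rfl

lemma RegularChannel.lintegral_avgPout_shift (h : RegularChannel Δ φ B) (y g s c : ℝ) :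
    ∫⁻ w, ENNReal.ofReal (avgPout Δ PA φ y (g + s * w) c) ∂stdG
      = ENNReal.ofReal (avgPout Δ PA φ y g (Real.sqrt (s ^ 2 + c ^ 2))) := by
  simp_rw [h.ofReal_avgPout]
  have hm : Measurable fun t => ENNReal.ofReal (Pout Δ PA φ y (g + t)) :=
    (h.measurable_Pout_comp (by fun_prop) (by fun_prop)).ennreal_ofReal
  have h1 := lintegral_map (μ := stdG) hm
    (g := fun w => Real.sqrt (s ^ 2 + c ^ 2) * w) (by fun_prop)
  rw [← map_add_mul_stdG, lintegral_map hm (by fun_prop), lintegral_prod] at h1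
  · simp_rw [← add_assoc] at h1
    exact h1
  · have h2 : Measurable fun p : ℝ × ℝ => s * p.1 + c * p.2 := by fun_prop
    exact (hm.comp h2).aemeasurable

end Info

section Concavity

variable {Δ : ℝ} {kA : ℕ} {PA : Measure (Fin kA → ℝ)} [IsProbabilityMeasure PA]
  {φ : ℝ → (Fin kA → ℝ) → ℝ} {B : ℝ}

lemma RegularChannel.lintegral_peel (h : RegularChannel Δ φ B) {n : ℕ} {k : ℝ} (hk : 0 ≤ k)
    {ι : Type} [Fintype ι] {x : ι → Fin n → ℝ} (j : ι) {v : Fin n → ℝ}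
    (hv : ∀ i, v i ≠ 0 → ∀ j, x j i = 0) {F : ℝ → (ι → ℝ) → ENNReal}
    (hF : Measurable fun p : ℝ × (ι → ℝ) => F p.1 p.2) :
    ∫⁻ r, F (out Δ φ (dotp k (x j + v) r.1) r.2) (fun j => dotp k (x j) r.1)
      / ENNReal.ofReal (avgPout Δ PA φ (out Δ φ (dotp k (x j + v) r.1) r.2) (dotp k (x j) r.1)
        (Real.sqrt (nsq k v))) ∂(rowLaw n PA)
      = ∫⁻ Φ, (∫⁻ y, F y (fun j => dotp k (x j) Φ)) ∂(iid n stdG) := by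
  set c := Real.sqrt (nsq k v)
  have hm : Measurable fun q : ((ι → ℝ) × ℝ) × ((Fin kA → ℝ) × ℝ) =>
      F (out Δ φ (q.1.1 j + q.1.2) q.2) q.1.1
      / ENNReal.ofReal (avgPout Δ PA φ (out Δ φ (q.1.1 j + q.1.2) q.2) (q.1.1 j) c) := by
    have ho : Measurable fun q : ((ι → ℝ) × ℝ) × ((Fin kA → ℝ) × ℝ) =>
      out Δ φ (q.1.1 j + q.1.2) q.2 := h.measurable_out (by fun_prop) (by fun_prop)
    have h1 : Measurable fun q : ((ι → ℝ) × ℝ) × ((Fin kA → ℝ) × ℝ) => q.1.1 := by fun_prop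
    exact (hF.comp (ho.prodMk h1)).div
      (h.measurable_avgPout ho (by fun_prop) measurable_const).ennreal_ofReal
  have hm' : Measurable fun r : (Fin n → ℝ) × ((Fin kA → ℝ) × ℝ) =>
      F (out Δ φ (dotp k (x j + v) r.1) r.2) (fun j => dotp k (x j) r.1)
      / ENNReal.ofReal (avgPout Δ PA φ (out Δ φ (dotp k (x j + v) r.1) r.2) (dotp k (x j) r.1)
        c) := by
    have ho : Measurable fun r : (Fin n → ℝ) × ((Fin kA → ℝ) × ℝ) =>
      out Δ φ (dotp k (x j + v) r.1) r.2 := h.measurable_out (by fun_prop) (by fun_prop)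
    have h1 : Measurable fun r : (Fin n → ℝ) × ((Fin kA → ℝ) × ℝ) =>
      fun j => dotp k (x j) r.1 := by fun_prop
    exact (hF.comp (ho.prodMk h1)).div
      (h.measurable_avgPout ho (by fun_prop) measurable_const).ennreal_ofReal
  rw [rowLaw, lintegral_prod _ hm'.aemeasurable]
  simp_rw [dotp_add]
  refine (lintegral_dotp_family hk hv (H := fun e t => ∫⁻ p, F (out Δ φ (e j + t) p) e
    / ENNReal.ofReal (avgPout Δ PA φ (out Δ φ (e j + t) p) (e j) c) ∂(noise PA))
    hm.lintegral_prod_right').trans ?_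
  refine lintegral_congr fun Φ => h.lintegral_div_avgPout (PA := PA) (dotp k (x j) Φ) c
    (F := fun y => F y (fun j => dotp k (x j) Φ)) ?_
  exact hF.comp (measurable_id.prodMk measurable_const)

lemma RegularChannel.lintegral_three_point (h : RegularChannel Δ φ B) {n : ℕ} {k : ℝ} (hk : 0 ≤ k)
    {u s₁ s₂ : Fin n → ℝ} (h₂ : ∀ i, s₂ i ≠ 0 → u i = 0 ∧ s₁ i = 0) (c₁ c₂ : ℝ) :
    ∫⁻ Φ, (∫⁻ y, ENNReal.ofReal (avgPout Δ PA φ y (dotp k (u + s₁) Φ) c₁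
          * avgPout Δ PA φ y (dotp k (u + s₂) Φ) c₂
          / avgPout Δ PA φ y (dotp k u Φ) (Real.sqrt (nsq k s₂ + c₂ ^ 2)))) ∂(iid n stdG) = 1 := by
  set c₀ := Real.sqrt (nsq k s₂ + c₂ ^ 2) with hc₀
  have hm2 : Measurable fun q : ((Fin 2 → ℝ) × ℝ) × ℝ =>
      ENNReal.ofReal (avgPout Δ PA φ q.2 (q.1.1 1) c₁
      * avgPout Δ PA φ q.2 (q.1.1 0 + q.1.2) c₂ / avgPout Δ PA φ q.2 (q.1.1 0) c₀) :=
    (((h.measurable_avgPout (by fun_prop) (by fun_prop) measurable_const).mul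
      (h.measurable_avgPout (by fun_prop) (by fun_prop) measurable_const)).div
      (h.measurable_avgPout (by fun_prop) (by fun_prop) measurable_const)).ennreal_ofReal
  simp_rw [dotp_add k u s₂]
  refine (lintegral_dotp_family hk (x := ![u, u + s₁]) (v := s₂)
    (fun i hi j => by fin_cases j <;> simp [h₂ i hi]) (H := fun e t => ∫⁻ y, ENNReal.ofReal
    (avgPout Δ PA φ y (e 1) c₁ * avgPout Δ PA φ y (e 0 + t) c₂
      / avgPout Δ PA φ y (e 0) c₀)) hm2.lintegral_prod_right').trans ?_
  simp only [Matrix.cons_val_zero, Matrix.cons_val_one]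
  have hone (Φ : Fin n → ℝ) : ∫⁻ w, (∫⁻ y, ENNReal.ofReal (avgPout Δ PA φ y (dotp k (u + s₁) Φ) c₁
          * avgPout Δ PA φ y (dotp k u Φ + Real.sqrt (nsq k s₂) * w) c₂
          / avgPout Δ PA φ y (dotp k u Φ) c₀)) ∂stdG = 1 := by
    have hm3 : Measurable fun q : ℝ × ℝ => ENNReal.ofReal
        (avgPout Δ PA φ q.2 (dotp k (u + s₁) Φ) c₁
        * avgPout Δ PA φ q.2 (dotp k u Φ + Real.sqrt (nsq k s₂) * q.1) c₂
        / avgPout Δ PA φ q.2 (dotp k u Φ) c₀) :=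
      (((h.measurable_avgPout (by fun_prop) (by fun_prop) measurable_const).mul
        (h.measurable_avgPout (by fun_prop) (by fun_prop) measurable_const)).div
        (h.measurable_avgPout (by fun_prop) (by fun_prop) measurable_const)).ennreal_ofReal
    rw [lintegral_lintegral_swap hm3.aemeasurable]
    refine (lintegral_congr fun y => ?_).trans
      (h.lintegral_avgPout (PA := PA) (dotp k (u + s₁) Φ) c₁)
    have h5 : 0 ≤ avgPout Δ PA φ y (dotp k (u + s₁) Φ) c₁ / avgPout Δ PA φ y (dotp k u Φ) c₀ :=
      div_nonneg (h.avgPout_pos _ _ _).le (h.avgPout_pos _ _ _).le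
    have h4 (w : ℝ) : ENNReal.ofReal (avgPout Δ PA φ y (dotp k (u + s₁) Φ) c₁
        * avgPout Δ PA φ y (dotp k u Φ + Real.sqrt (nsq k s₂) * w) c₂
        / avgPout Δ PA φ y (dotp k u Φ) c₀)
        = ENNReal.ofReal (avgPout Δ PA φ y (dotp k (u + s₁) Φ) c₁
          / avgPout Δ PA φ y (dotp k u Φ) c₀)
        * ENNReal.ofReal (avgPout Δ PA φ y (dotp k u Φ + Real.sqrt (nsq k s₂) * w) c₂) := by
      rw [← ENNReal.ofReal_mul h5]
      congr 1; ring
    simp_rw [h4]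
    have hw : Measurable fun w : ℝ => ENNReal.ofReal
        (avgPout Δ PA φ y (dotp k u Φ + Real.sqrt (nsq k s₂) * w) c₂) :=
      (h.measurable_avgPout (by fun_prop) (by fun_prop) measurable_const).ennreal_ofReal
    rw [lintegral_const_mul _ hw, h.lintegral_avgPout_shift, Real.sq_sqrt (nsq_nonneg hk _),
      ← ENNReal.ofReal_mul h5, ← hc₀, div_mul_cancel₀ _ (h.avgPout_pos _ _ _).ne']
  exact (lintegral_congr hone).trans (by simp)

lemma RegularChannel.lintegral_four_point (h : RegularChannel Δ φ B) {n : ℕ} {k : ℝ} (hk : 0 ≤ k)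
    {u s₁ s₂ s₃ : Fin n → ℝ} (h₂ : ∀ i, s₂ i ≠ 0 → u i = 0 ∧ s₁ i = 0)
    (h₃ : ∀ i, s₃ i ≠ 0 → u i = 0 ∧ s₁ i = 0 ∧ s₂ i = 0) (c₁ c₂ : ℝ) :
    ∫⁻ r, ENNReal.ofReal
      (avgPout Δ PA φ (out Δ φ (dotp k (u + s₁ + s₂ + s₃) r.1) r.2) (dotp k (u + s₁) r.1) c₁
        * avgPout Δ PA φ (out Δ φ (dotp k (u + s₁ + s₂ + s₃) r.1) r.2) (dotp k (u + s₂) r.1) c₂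
        / avgPout Δ PA φ (out Δ φ (dotp k (u + s₁ + s₂ + s₃) r.1) r.2) (dotp k u r.1)
          (Real.sqrt (nsq k s₂ + c₂ ^ 2))
        / avgPout Δ PA φ (out Δ φ (dotp k (u + s₁ + s₂ + s₃) r.1) r.2)
          (dotp k (u + s₁ + s₂) r.1) (Real.sqrt (nsq k s₃))) ∂(rowLaw n PA) = 1 := by
  have hF : Measurable fun p : ℝ × (Fin 4 → ℝ) => ENNReal.ofReal
      (avgPout Δ PA φ p.1 (p.2 1) c₁ * avgPout Δ PA φ p.1 (p.2 2) c₂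
        / avgPout Δ PA φ p.1 (p.2 0) (Real.sqrt (nsq k s₂ + c₂ ^ 2))) :=
    (((h.measurable_avgPout (by fun_prop) (by fun_prop) measurable_const).mul
      (h.measurable_avgPout (by fun_prop) (by fun_prop) measurable_const)).div
      (h.measurable_avgPout (by fun_prop) (by fun_prop) measurable_const)).ennreal_ofReal
  refine (lintegral_congr fun r => ENNReal.ofReal_div_of_pos (h.avgPout_pos _ _ _)).trans ?_
  exact (h.lintegral_peel hk (x := ![u, u + s₁, u + s₂, u + s₁ + s₂]) 3 (v := s₃)
    (fun i hi j => by fin_cases j <;> simp [h₃ i hi]) (F := fun y e => ENNReal.ofReal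
      (avgPout Δ PA φ y (e 1) c₁ * avgPout Δ PA φ y (e 2) c₂
        / avgPout Δ PA φ y (e 0) (Real.sqrt (nsq k s₂ + c₂ ^ 2)))) hF).trans
    (h.lintegral_three_point hk h₂ c₁ c₂)

/-- The information as a function of the known and unknown powers of the input. -/
def Iinfo (Δ : ℝ) {kA : ℕ} (PA : Measure (Fin kA → ℝ)) (φ : ℝ → (Fin kA → ℝ) → ℝ)
    (q r : ℝ) : ℝ := Jinfo Δ PA φ (Real.sqrt q) (Real.sqrt r) (Real.sqrt r)

lemma RegularChannel.integral_llr_combination (h : RegularChannel Δ φ B) {E : Type*}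
    [MeasurableSpace E] {μ : Measure E} [IsProbabilityMeasure μ] {g g₀ g₁ g₂ g₃ : E → ℝ}
    (hg : Measurable g) (hg₀ : Measurable g₀) (hg₁ : Measurable g₁) (hg₂ : Measurable g₂)
    (hg₃ : Measurable g₃) {c₀ c₁ c₂ c₃ : ℝ}
    (hle : ∫⁻ p, ENNReal.ofReal
      (avgPout Δ PA φ (out Δ φ (g p.1) p.2) (g₂ p.1) c₂
        * avgPout Δ PA φ (out Δ φ (g p.1) p.2) (g₃ p.1) c₃
        / avgPout Δ PA φ (out Δ φ (g p.1) p.2) (g₁ p.1) c₁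
        / avgPout Δ PA φ (out Δ φ (g p.1) p.2) (g₀ p.1) c₀) ∂(μ.prod (noise PA)) ≤ 1) :
    ∫ p, llr Δ PA φ (g p.1) (g₀ p.1) c₀ p.2 ∂(μ.prod (noise PA))
      + ∫ p, llr Δ PA φ (g p.1) (g₁ p.1) c₁ p.2 ∂(μ.prod (noise PA))
      ≤ ∫ p, llr Δ PA φ (g p.1) (g₂ p.1) c₂ p.2 ∂(μ.prod (noise PA))
      + ∫ p, llr Δ PA φ (g p.1) (g₃ p.1) c₃ p.2 ∂(μ.prod (noise PA)) := by
  have j0 := h.integrable_llr (PA := PA) μ hg hg₀ (measurable_const (a := c₀))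
  have j1 := h.integrable_llr (PA := PA) μ hg hg₁ (measurable_const (a := c₁))
  have j2 := h.integrable_llr (PA := PA) μ hg hg₂ (measurable_const (a := c₂))
  have j3 := h.integrable_llr (PA := PA) μ hg hg₃ (measurable_const (a := c₃))
  have ho : Measurable fun p : E × ((Fin kA → ℝ) × ℝ) => out Δ φ (g p.1) p.2 :=
    h.measurable_out (by fun_prop) (by fun_prop)
  have hlog (p : E × ((Fin kA → ℝ) × ℝ)) :
      (llr Δ PA φ (g p.1) (g₀ p.1) c₀ p.2 + llr Δ PA φ (g p.1) (g₁ p.1) c₁ p.2)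
        - (llr Δ PA φ (g p.1) (g₂ p.1) c₂ p.2 + llr Δ PA φ (g p.1) (g₃ p.1) c₃ p.2)
      = Real.log (avgPout Δ PA φ (out Δ φ (g p.1) p.2) (g₂ p.1) c₂
        * avgPout Δ PA φ (out Δ φ (g p.1) p.2) (g₃ p.1) c₃
        / avgPout Δ PA φ (out Δ φ (g p.1) p.2) (g₁ p.1) c₁
        / avgPout Δ PA φ (out Δ φ (g p.1) p.2) (g₀ p.1) c₀) := by
    have p1 (y g c : ℝ) := (h.avgPout_pos (PA := PA) y g c).ne'
    rw [Real.log_div (div_ne_zero (mul_ne_zero (p1 _ _ _) (p1 _ _ _)) (p1 _ _ _)) (p1 _ _ _),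
      Real.log_div (mul_ne_zero (p1 _ _ _) (p1 _ _ _)) (p1 _ _ _),
      Real.log_mul (p1 _ _ _) (p1 _ _ _)]
    unfold llr; ring
  have h7 := integral_sub (j0.add j1) (j2.add j3)
  have h8 := integral_add j0 j1
  have h9 := integral_add j2 j3
  have hint := (j0.add j1).sub (j2.add j3)
  simp only [Pi.add_apply] at h7
  have h10 := integral_log_nonpos (μ := μ.prod (noise PA))
    ((((h.measurable_avgPout ho (by fun_prop) measurable_const).mul
      (h.measurable_avgPout ho (by fun_prop) measurable_const)).div
      (h.measurable_avgPout ho (by fun_prop) measurable_const)).div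
      (h.measurable_avgPout ho (by fun_prop) measurable_const))
    (fun e => div_pos (div_pos (mul_pos (h.avgPout_pos _ _ _) (h.avgPout_pos _ _ _))
      (h.avgPout_pos _ _ _)) (h.avgPout_pos _ _ _)) hle
    (hint.congr (Filter.Eventually.of_forall hlog))
  have h11 := (integral_congr_ae (μ := μ.prod (noise PA))
    (Filter.Eventually.of_forall hlog)).trans_le h10
  linarith

lemma Iinfo_row (h : RegularChannel Δ φ B) {n : ℕ} {k : ℝ} (hk : 0 ≤ k) {x a b : Fin n → ℝ}
    (hab : ∀ i, b i ≠ 0 → a i = 0) (e : a + b = x) {q r : ℝ} (hq : nsq k a = q)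
    (hr : nsq k b = r) :
    ∫ p, llr Δ PA φ (dotp k x p.1) (dotp k a p.1) (Real.sqrt r) p.2 ∂(rowLaw n PA)
      = Iinfo Δ PA φ q r := by
  rw [← e, h.integral_row_llr hk hab, Iinfo, hq, hr]

lemma RegularChannel.Iinfo_four_point (h : RegularChannel Δ φ B) {n : ℕ} {k : ℝ} (hk : 0 ≤ k)
    {u s₁ s₂ s₃ : Fin n → ℝ} (h₁ : ∀ i, s₁ i ≠ 0 → u i = 0)
    (h₂ : ∀ i, s₂ i ≠ 0 → u i = 0 ∧ s₁ i = 0)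
    (h₃ : ∀ i, s₃ i ≠ 0 → u i = 0 ∧ s₁ i = 0 ∧ s₂ i = 0) {q d r : ℝ}
    (hu : nsq k u = q) (hs₁ : nsq k s₁ = d) (hs₂ : nsq k s₂ = d) (hs₃ : nsq k s₃ = r)
    (hadd : ∀ {a b : Fin n → ℝ}, (∀ i, b i ≠ 0 → a i = 0) → nsq k (a + b) = nsq k a + nsq k b) :
    Iinfo Δ PA φ (q + 2 * d) r + Iinfo Δ PA φ q (r + 2 * d)
      ≤ 2 * Iinfo Δ PA φ (q + d) (r + d) := by
  have hd : 0 ≤ d := hs₁ ▸ nsq_nonneg hk _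
  have hr : 0 ≤ r := hs₃ ▸ nsq_nonneg hk _
  have e23 : nsq k (s₂ + s₃) = r + d := by
    rw [hadd fun i hi => (h₃ i hi).2.2, hs₂, hs₃, add_comm]
  have e13 : nsq k (s₁ + s₃) = r + d := by
    rw [hadd fun i hi => (h₃ i hi).2.1, hs₁, hs₃, add_comm]
  have d1 : ∀ i, (s₁ + (s₂ + s₃)) i ≠ 0 → u i = 0 := by
    intro i; by_contra! hc
    have a1 := mt (h₁ i) hc.2
    have a2 := mt (fun g => (h₂ i g).1) hc.2
    have a3 := mt (fun g => (h₃ i g).1) hc.2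
    simp_all
  have d2 : ∀ i, (s₂ + s₃) i ≠ 0 → (u + s₁) i = 0 := by
    intro i hi
    by_cases g : s₃ i = 0
    · have g2 : s₂ i ≠ 0 := by simpa [g] using hi
      simp [h₂ i g2]
    · simp [h₃ i g]
  have d3 : ∀ i, (s₁ + s₃) i ≠ 0 → (u + s₂) i = 0 := by
    intro i hi
    by_cases g : s₃ i = 0
    · have g2 : s₁ i ≠ 0 := by simpa [g] using hi
      have g3 : s₂ i = 0 := by by_contra g4; exact g2 (h₂ i g4).2
      simp [h₁ i g2, g3]
    · simp [h₃ i g]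
  have d0 : ∀ i, s₃ i ≠ 0 → (u + s₁ + s₂) i = 0 := fun i hi => by simp [h₃ i hi]
  have e0 := Iinfo_row (PA := PA) h hk d0 rfl (q := q + 2 * d) (r := r)
    (by rw [hadd (b := s₂) fun i hi => by simp [h₂ i hi], hadd h₁, hu, hs₁, hs₂]; ring) hs₃
  have e1 := Iinfo_row (PA := PA) h hk (x := u + s₁ + s₂ + s₃) d1 (by abel) (q := q)
    (r := r + 2 * d) hu (by
      rw [hadd, hs₁, e23]
      · ring
      · intro i; by_contra! hc
        have a2 := mt (fun g => (h₂ i g).2) hc.2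
        have a3 := mt (fun g => (h₃ i g).2.1) hc.2
        simp_all)
  have e2 := Iinfo_row (PA := PA) h hk (x := u + s₁ + s₂ + s₃) d2 (by abel) (q := q + d)
    (r := r + d) (by rw [hadd h₁, hu, hs₁]) e23
  have e3 := Iinfo_row (PA := PA) h hk (x := u + s₁ + s₂ + s₃) d3 (by abel) (q := q + d)
    (r := r + d) (by rw [hadd fun i hi => (h₂ i hi).1, hu, hs₂]) e13
  have h4 := h.lintegral_four_point (PA := PA) hk h₂ h₃ (Real.sqrt (r + d)) (Real.sqrt (r + d))
  rw [Real.sq_sqrt (by positivity), hs₂, hs₃, show d + (r + d) = r + 2 * d by ring] at h4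
  obtain ⟨x, hx⟩ : ∃ x, x = u + s₁ + s₂ + s₃ := ⟨_, rfl⟩
  obtain ⟨b, hb⟩ : ∃ b, b = u + s₁ + s₂ := ⟨_, rfl⟩
  rw [← hx, ← hb] at e0 h4
  rw [← hx] at e1 e2 e3
  have hlin := h.integral_llr_combination (PA := PA) (μ := iid n stdG) (g := dotp k x)
    (g₀ := dotp k b) (g₁ := dotp k u) (g₂ := dotp k (u + s₁)) (g₃ := dotp k (u + s₂))
    (by fun_prop) (by fun_prop) (by fun_prop) (by fun_prop) (by fun_prop) (c₀ := Real.sqrt r)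
    (c₁ := Real.sqrt (r + 2 * d)) (c₂ := Real.sqrt (r + d)) (c₃ := Real.sqrt (r + d)) h4.le
  rw [rowLaw] at e0 e1 e2 e3
  linarith

lemma RegularChannel.Iinfo_midpoint (h : RegularChannel Δ φ B) {q r d : ℝ} (hq : 0 ≤ q)
    (hr : 0 ≤ r) (hd : 0 ≤ d) :
    Iinfo Δ PA φ (q + 2 * d) r + Iinfo Δ PA φ q (r + 2 * d)
      ≤ 2 * Iinfo Δ PA φ (q + d) (r + d) := by
  have hs (i : Fin 4) {t : ℝ} (ht : 0 ≤ t) : nsq 1 (Pi.single i (Real.sqrt t)) = t := by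
    simp [nsq, Pi.single_apply, Real.sq_sqrt ht, ite_pow]
  have hn {i j : Fin 4} (hij : i ≠ j) {t t' : ℝ} (l : Fin 4)
      (hl : (Pi.single i t : Fin 4 → ℝ) l ≠ 0) : (Pi.single j t' : Fin 4 → ℝ) l = 0 := by
    by_cases g : l = i
    · subst g; simp [hij]
    · simp [g] at hl
  refine h.Iinfo_four_point zero_le_one (u := Pi.single 0 (Real.sqrt q))
    (s₁ := Pi.single 1 (Real.sqrt d)) (s₂ := Pi.single 2 (Real.sqrt d))
    (s₃ := Pi.single 3 (Real.sqrt r)) (hn (by decide))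
    (fun l hl => ⟨hn (by decide) l hl, hn (by decide) l hl⟩)
    (fun l hl => ⟨hn (by decide) l hl, hn (by decide) l hl, hn (by decide) l hl⟩)
    (hs _ hq) (hs _ hd) (hs _ hd) (hs _ hr) fun {a b} hab => ?_
  unfold nsq
  rw [← add_div, ← Finset.sum_add_distrib]
  congr 1
  refine Finset.sum_congr rfl fun i _ => ?_
  by_cases g : b i = 0
  · simp [g]
  · simp [hab i g]

end Concavity

section ScalarInfo

/-- Midpoint concave continuous functions on an interval are bounded below by their endpoint
values. -/
lemma min_endpoints_le {g : ℝ → ℝ} {lo hi : ℝ} (hg : ContinuousOn g (Set.Icc lo hi))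
    (hmid : ∀ x d, lo ≤ x → 0 ≤ d → x + 2 * d ≤ hi → g (x + 2 * d) + g x ≤ 2 * g (x + d))
    {x : ℝ} (hx : x ∈ Set.Icc lo hi) : min (g lo) (g hi) ≤ g x := by
  obtain ⟨x₀, hx₀, hmin⟩ := isCompact_Icc.exists_isMinOn ⟨x, hx⟩ hg
  have hS : IsCompact (Set.Icc lo hi ∩ g ⁻¹' Set.Iic (g x₀)) :=
    isCompact_Icc.of_isClosed_subset (hg.preimage_isClosed_of_isClosed isClosed_Icc isClosed_Iic)
      Set.inter_subset_left
  obtain ⟨x₁, ⟨hx₁, hle⟩, hleast⟩ := hS.exists_isLeast ⟨x₀, hx₀, le_refl (g x₀)⟩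
  have hx₁g : g x₁ ≤ g x := (show g x₁ ≤ g x₀ from hle).trans (hmin hx)
  set d := min (x₁ - lo) (hi - x₁) with hd
  have hd0 : 0 ≤ d := le_min (by linarith [hx₁.1]) (by linarith [hx₁.2])
  have hd1 : d ≤ x₁ - lo := min_le_left _ _
  have hd2 : d ≤ hi - x₁ := min_le_right _ _
  rcases hd0.eq_or_lt with h0 | h0
  · rcases min_choice (x₁ - lo) (hi - x₁) with hc | hc
    · have : lo = x₁ := by linarith
      exact (min_le_left _ _).trans (this ▸ hx₁g)
    · have : hi = x₁ := by linarith
      exact (min_le_right _ _).trans (this ▸ hx₁g)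
  · exfalso
    have h1 := hmid (x₁ - d) d (by linarith) hd0 (by linarith)
    rw [show x₁ - d + 2 * d = x₁ + d by ring, sub_add_cancel] at h1
    have h2 : g x₀ ≤ g (x₁ + d) := hmin ⟨by linarith, by linarith⟩
    have h4 : g x₁ ≤ g x₀ := hle
    have h3 : g (x₁ - d) ≤ g x₀ := by linarith
    have := hleast (⟨⟨by linarith, by linarith⟩, h3⟩ :
      x₁ - d ∈ Set.Icc lo hi ∩ g ⁻¹' Set.Iic (g x₀))
    linarith

variable {Δ : ℝ} {kA : ℕ} {PA : Measure (Fin kA → ℝ)} [IsProbabilityMeasure PA]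
  {φ : ℝ → (Fin kA → ℝ) → ℝ} {B : ℝ}

lemma RegularChannel.continuous_Iinfo (h : RegularChannel Δ φ B) {E : Type*} [TopologicalSpace E]
    [FirstCountableTopology E] {a b : E → ℝ} (ha : Continuous a) (hb : Continuous b) :
    Continuous fun e => Iinfo Δ PA φ (a e) (b e) :=
  h.continuous_Jinfo ha.sqrt hb.sqrt hb.sqrt

/-- The information plus an affine function of the power split is at least its value at one of the
endpoints. -/
lemma RegularChannel.min_Iinfo_le (h : RegularChannel Δ φ B) {S lo hi a b q : ℝ} (hlo : 0 ≤ lo)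
    (hhi : hi ≤ S) (hq : q ∈ Set.Icc lo hi) :
    min (Iinfo Δ PA φ lo (S - lo) + (a * lo + b)) (Iinfo Δ PA φ hi (S - hi) + (a * hi + b))
      ≤ Iinfo Δ PA φ q (S - q) + (a * q + b) := by
  refine min_endpoints_le (g := fun q => Iinfo Δ PA φ q (S - q) + (a * q + b)) ?_ ?_ hq
  · exact ((h.continuous_Iinfo continuous_id (by fun_prop)).add (by fun_prop)).continuousOn
  · intro x d hx hd hxd
    have := h.Iinfo_midpoint (PA := PA) (q := x) (r := S - (x + 2 * d)) (d := d)
      (by linarith) (by linarith) hd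
    rw [show S - (x + 2 * d) + 2 * d = S - x by ring,
      show S - (x + 2 * d) + d = S - (x + d) by ring] at this
    linarith

lemma integral_row_unnest {E : Type*} [MeasurableSpace E] (μ : Measure E) [IsProbabilityMeasure μ]
    {F : E × ((Fin kA → ℝ) × ℝ) → ℝ} (hF : Measurable F) {b : ℝ → ℝ} (hb : Integrable b stdG)
    (hle : ∀ p, |F p| ≤ b p.2.2) :
    Integrable F (μ.prod (noise PA)) ∧
      ∫ p, F p ∂(μ.prod (noise PA)) = ∫ e, ∫ a, ∫ z, F (e, (a, z)) ∂stdG ∂PA ∂μ := by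
  have hi : Integrable F (μ.prod (noise PA)) :=
    Integrable.mono' (integrable_row_bound μ hb) hF.aestronglyMeasurable
      (Filter.Eventually.of_forall hle)
  refine ⟨hi, (integral_prod _ hi).trans (integral_congr_ae (Filter.Eventually.of_forall
    fun e => ?_))⟩
  have hi' : Integrable (fun p => F (e, p)) (noise PA) :=
    Integrable.mono' (integrable_noise_bound hb)
      (hF.comp measurable_prodMk_left).aestronglyMeasurable
      (Filter.Eventually.of_forall fun p => hle (e, p))
  exact integral_prod _ hi'

/-- A bound on the logarithm of the transition density along the noise. -/
def logBound (Δ B z : ℝ) : ℝ :=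
  llrSlope Δ B * (1 + |z|) + (|Real.log (Real.sqrt (2 * π * Δ))⁻¹|
    + (2 * B + Real.sqrt Δ * |z|) ^ 2 / (2 * Δ))

lemma integrable_logBound (Δ B : ℝ) : Integrable (logBound Δ B) stdG := by
  have h2 : Integrable (fun z : ℝ => z ^ 2) stdG :=
    (memLp_id_gaussianReal (μ := 0) (v := 1) 2).integrable_sq
  have h3 : (fun z : ℝ => (2 * B + Real.sqrt Δ * |z|) ^ 2)
      = fun z => (2 * B) ^ 2 + (2 * (2 * B) * Real.sqrt Δ) * |z| + Real.sqrt Δ ^ 2 * z ^ 2 := by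
    ext z; rw [← sq_abs z]; ring
  refine (integrable_one_add_abs_stdG _).add ((integrable_const _).add (Integrable.div_const ?_ _))
  rw [h3]
  exact ((integrable_const _).add (integrable_abs_stdG.const_mul _)).add (h2.const_mul _)

lemma RegularChannel.abs_log_le_logBound (h : RegularChannel Δ φ B) (g : ℝ)
    (p : (Fin kA → ℝ) × ℝ) {t : ℝ} (h1 : loEnv Δ B (out Δ φ g p) ≤ t)
    (h2 : t ≤ hiEnv Δ B (out Δ φ g p)) : |Real.log t| ≤ logBound Δ B p.2 := by
  have hp := h.pos
  have e1 := (abs_log_sub_log_le_of_env h.pos h1 h2 le_rfl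
    (h1.trans h2)).trans (h.slope_bound g p.1 p.2)
  have e2 : |Real.log (loEnv Δ B (out Δ φ g p))| ≤ |Real.log (Real.sqrt (2 * π * Δ))⁻¹|
      + (2 * B + Real.sqrt Δ * |p.2|) ^ 2 / (2 * Δ) := by
    unfold loEnv
    rw [Real.log_mul (by positivity) (Real.exp_pos _).ne', Real.log_exp]
    refine (abs_add_le _ _).trans (add_le_add le_rfl ?_)
    have e3 : |out Δ φ g p| ≤ B + Real.sqrt Δ * |p.2| := by
      refine (abs_add_le _ _).trans (add_le_add (h.bound _ _) ?_)
      rw [abs_mul, abs_of_nonneg (Real.sqrt_nonneg _)]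
    have e4 : 0 ≤ out Δ φ g p ^ 2 + 2 * B * |out Δ φ g p| + B ^ 2 := by
      have := h.nonneg; positivity
    rw [neg_div, abs_neg, abs_of_nonneg (by positivity)]
    gcongr
    rw [← sq_abs (out Δ φ g p)]
    nlinarith [abs_nonneg (out Δ φ g p), h.nonneg, mul_nonneg (Real.sqrt_nonneg Δ) (abs_nonneg p.2)]
  have e5 : |Real.log t| ≤ |Real.log t - Real.log (loEnv Δ B (out Δ φ g p))|
      + |Real.log (loEnv Δ B (out Δ φ g p))| := by
    simpa using abs_add_le (Real.log t - Real.log (loEnv Δ B (out Δ φ g p)))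
      (Real.log (loEnv Δ B (out Δ φ g p)))
  unfold logBound
  exact e5.trans (add_le_add e1 e2)

lemma RegularChannel.IPout_eq (h : RegularChannel Δ φ B) {q S : ℝ} (hq : 0 ≤ q) (hqS : q ≤ S) :
    IPout Δ PA φ q S = Iinfo Δ PA φ q (S - q) := by
  set s := Real.sqrt q
  set c := Real.sqrt (S - q)
  have hS : Real.sqrt (s ^ 2 + c ^ 2) = Real.sqrt S := by
    rw [Real.sq_sqrt hq, Real.sq_sqrt (by linarith)]; ring_nf
  have hF : Measurable fun e : ℝ × ((Fin kA → ℝ) × ℝ) =>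
      Real.log (Pout Δ PA φ (out Δ φ e.1 e.2) e.1) :=
    (h.measurable_Pout_comp (h.measurable_out (by fun_prop) (by fun_prop)) (by fun_prop)).log
  have hF1 : Measurable fun p : ℝ × ((Fin kA → ℝ) × ℝ) =>
      Real.log (Pout Δ PA φ (out Δ φ (Real.sqrt S * p.1) p.2) (Real.sqrt S * p.1)) :=
    (h.measurable_Pout_comp (h.measurable_out (by fun_prop) (by fun_prop)) (by fun_prop)).log
  have hF2 : Measurable fun p : (ℝ × ℝ) × ((Fin kA → ℝ) × ℝ) =>
      Real.log (Pout Δ PA φ (out Δ φ (s * p.1.1 + c * p.1.2) p.2) (s * p.1.1 + c * p.1.2)) :=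
    (h.measurable_Pout_comp (h.measurable_out (by fun_prop) (by fun_prop)) (by fun_prop)).log
  have hF3 : Measurable fun p : (ℝ × ℝ) × ((Fin kA → ℝ) × ℝ) =>
      Real.log (avgPout Δ PA φ (out Δ φ (s * p.1.1 + c * p.1.2) p.2) (s * p.1.1) c) :=
    (h.measurable_avgPout (h.measurable_out (by fun_prop) (by fun_prop)) (by fun_prop)
      measurable_const).log
  have u1 := integral_row_unnest (PA := PA) stdG hF1 (integrable_logBound Δ B)
    fun p => h.abs_log_le_logBound _ _ (h.le_Pout _ _) (h.Pout_le _ _)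
  have u2 := integral_row_unnest (PA := PA) (stdG.prod stdG) hF2 (integrable_logBound Δ B)
    fun p => h.abs_log_le_logBound _ _ (h.le_Pout _ _) (h.Pout_le _ _)
  have u3 := integral_row_unnest (PA := PA) (stdG.prod stdG) hF3 (integrable_logBound Δ B)
    fun p => h.abs_log_le_logBound _ _ (h.le_avgPout _ _ _) (h.avgPout_le _ _ _)
  have hmap : ((stdG.prod stdG).prod (noise PA)).map
      (Prod.map (fun p => s * p.1 + c * p.2) id)
      = (stdG.prod (noise PA)).map (Prod.map (fun w => Real.sqrt S * w) id) := by
    rw [← Measure.map_prod_map _ _ (by fun_prop) measurable_id,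
      ← Measure.map_prod_map _ _ (by fun_prop) measurable_id, map_add_mul_stdG, hS]
  have e1 := integral_map (μ := (stdG.prod stdG).prod (noise PA))
    (φ := Prod.map (fun p => s * p.1 + c * p.2) id) (by fun_prop) hF.aestronglyMeasurable
  have e2 := integral_map (μ := stdG.prod (noise PA))
    (φ := Prod.map (fun w => Real.sqrt S * w) id) (by fun_prop) hF.aestronglyMeasurable
  rw [hmap, e2] at e1
  simp only [Prod.map_fst, Prod.map_snd, id] at e1
  have e3 : Iinfo Δ PA φ q (S - q) = _ - _ := integral_sub u2.1 u3.1
  rw [e3, ← e1, u1.2, u3.2, IPout]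
  congr 1
  have hG : Integrable (fun v : ℝ × ℝ => ∫ a, ∫ z, Real.log (avgPout Δ PA φ
      (out Δ φ (s * v.1 + c * v.2) (a, z)) (s * v.1) c) ∂stdG ∂PA) (stdG.prod stdG) := by
    refine u3.1.integral_prod_left.congr (Filter.Eventually.of_forall fun v => ?_)
    have hi' : Integrable (fun p => Real.log (avgPout Δ PA φ
        (out Δ φ (s * v.1 + c * v.2) p) (s * v.1) c)) (noise PA) :=
      Integrable.mono' (integrable_noise_bound (integrable_logBound Δ B))
        (hF3.comp measurable_prodMk_left).aestronglyMeasurable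
        (Filter.Eventually.of_forall fun p =>
          h.abs_log_le_logBound _ _ (h.le_avgPout _ _ _) (h.avgPout_le _ _ _))
    exact integral_prod _ hi'
  exact (integral_prod _ hG).symm

end ScalarInfo

/-- Weight of a vector under a product of discrete laws. -/
def wt {n : ℕ} (w : ℝ → ℝ) (x : Fin n → ℝ) : ℝ := ∏ i, w (x i)

/-- Vectors with coordinates in a finite set. -/
def grid (n : ℕ) (T : Finset ℝ) : Finset (Fin n → ℝ) := Fintype.piFinset fun _ => T

lemma sum_grid_prod {n : ℕ} (T : Finset ℝ) (f : Fin n → ℝ → ℝ) :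
    ∑ x ∈ grid n T, ∏ i, f i (x i) = ∏ i, ∑ t ∈ T, f i t :=
  (Finset.prod_univ_sum (fun _ => T) f).symm

lemma integral_iid_finite {n : ℕ} {P : Measure ℝ} [IsProbabilityMeasure P] {T : Finset ℝ}
    (hT : ∀ᵐ x ∂P, x ∈ T) (f : (Fin n → ℝ) → ℝ) :
    ∫ x, f x ∂(iid n P) = ∑ x ∈ grid n T, wt (fun t => P.real {t}) x * f x := by
  have hae : ∀ᵐ x ∂(iid n P), x ∈ (grid n T : Set (Fin n → ℝ)) := by
    have : ∀ᵐ x ∂(iid n P), ∀ i, x i ∈ T := by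
      rw [ae_all_iff]
      exact fun i => (Measure.tendsto_eval_ae_ae (μ := fun _ : Fin n => P) (i := i)).eventually hT
    filter_upwards [this] with x hx
    simpa [grid] using hx
  rw [← Measure.restrict_eq_self_of_ae_mem hae, setIntegral_finset _ (IntegrableOn.finset)]
  refine Finset.sum_congr rfl fun x _ => ?_
  rw [smul_eq_mul, wt, Measure.real, iid, Measure.pi_singleton, ENNReal.toReal_prod]
  rfl

/-- Standard Gaussian density. -/
def sideDens (t : ℝ) : ℝ := (Real.sqrt (2 * π))⁻¹ * Real.exp (-t ^ 2 / 2)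

lemma sideDens_pos (t : ℝ) : 0 < sideDens t := by unfold sideDens; positivity

@[fun_prop]
lemma continuous_sideDens : Continuous sideDens := by unfold sideDens; fun_prop

@[fun_prop]
lemma measurable_sideDens : Measurable sideDens := continuous_sideDens.measurable

lemma log_sideDens (t : ℝ) :
    Real.log (sideDens t) = Real.log (Real.sqrt (2 * π))⁻¹ - t ^ 2 / 2 := by
  rw [sideDens, Real.log_mul (by positivity) (Real.exp_pos _).ne', Real.log_exp]; ring

/-- Joint law of all the randomness except the signal. -/
def dataLaw (n m : ℕ) {kA : ℕ} (PA : Measure (Fin kA → ℝ)) :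
    Measure ((Fin m → (Fin n → ℝ) × ((Fin kA → ℝ) × ℝ)) × (Fin n → ℝ)) :=
  (Measure.pi fun _ : Fin m => rowLaw n PA).prod (iid n stdG)

instance (n m : ℕ) {kA : ℕ} (PA : Measure (Fin kA → ℝ)) [IsProbabilityMeasure PA] :
    IsProbabilityMeasure (dataLaw n m PA) := by unfold dataLaw; infer_instance

/-- Likelihood of `x` for the observations generated by `X`. -/
def lik (Δ : ℝ) {kA : ℕ} (PA : Measure (Fin kA → ℝ)) (φ : ℝ → (Fin kA → ℝ) → ℝ) {n m : ℕ}
    (k s : ℝ) (X x : Fin n → ℝ)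
    (ω : (Fin m → (Fin n → ℝ) × ((Fin kA → ℝ) × ℝ)) × (Fin n → ℝ)) : ℝ :=
  (∏ μ, Pout Δ PA φ (out Δ φ (dotp k X (ω.1 μ).1) (ω.1 μ).2) (dotp k x (ω.1 μ).1))
    * ∏ i, sideDens (Real.sqrt s * X i + ω.2 i - Real.sqrt s * x i)

/-- Marginal likelihood of the observations generated by `X`. -/
def margLik (Δ : ℝ) {kA : ℕ} (PA : Measure (Fin kA → ℝ)) (φ : ℝ → (Fin kA → ℝ) → ℝ) {n m : ℕ}
    (T : Finset ℝ) (w : ℝ → ℝ) (k s : ℝ) (X : Fin n → ℝ)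
    (ω : (Fin m → (Fin n → ℝ) × ((Fin kA → ℝ) × ℝ)) × (Fin n → ℝ)) : ℝ :=
  ∑ x ∈ grid n T, wt w x * lik Δ PA φ k s X x ω

/-- Slope of the bound on the side log-likelihood ratios for signals bounded by `R`. -/
def sideSlope (s R : ℝ) : ℝ := 2 * (2 * Real.sqrt s * R) + (2 * Real.sqrt s * R) ^ 2

/-- Bound on the log-likelihood ratios. -/
def dataBound (L D : ℝ) {kA n m : ℕ}
    (ω : (Fin m → (Fin n → ℝ) × ((Fin kA → ℝ) × ℝ)) × (Fin n → ℝ)) : ℝ :=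
  (∑ μ, L * (1 + |(ω.1 μ).2.2|)) + ∑ i, D * (1 + |ω.2 i|)

lemma abs_log_sideDens_sub_le {s R X x x' : ℝ} (hX : |X| ≤ R) (hx : |x| ≤ R) (hx' : |x'| ≤ R)
    (z : ℝ) :
    |Real.log (sideDens (Real.sqrt s * X + z - Real.sqrt s * x))
      - Real.log (sideDens (Real.sqrt s * X + z - Real.sqrt s * x'))|
      ≤ sideSlope s R * (1 + |z|) := by
  rw [log_sideDens, log_sideDens, sideSlope]
  have hs := Real.sqrt_nonneg s
  obtain ⟨S, hS⟩ : ∃ S, S = Real.sqrt s := ⟨_, rfl⟩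
  rw [← hS] at hs ⊢
  have hc (y : ℝ) (hy : |y| ≤ R) : |S * (X - y)| ≤ 2 * S * R := by
    rw [abs_mul, abs_of_nonneg hs]
    have := (abs_sub X y).trans (add_le_add hX hy)
    nlinarith
  have h1 := hc x hx
  have h2 := hc x' hx'
  have hz := abs_nonneg z
  obtain ⟨a, ha⟩ : ∃ a, a = S * (X - x) := ⟨_, rfl⟩
  obtain ⟨b, hb⟩ : ∃ b, b = S * (X - x') := ⟨_, rfl⟩
  obtain ⟨D, hD⟩ : ∃ D, D = 2 * S * R := ⟨_, rfl⟩
  rw [← ha, ← hD] at h1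
  rw [← hb, ← hD] at h2
  rw [← hD]
  have hD0 : 0 ≤ D := (abs_nonneg _).trans h1
  have e : Real.log (√(2 * π))⁻¹ - (S * X + z - S * x) ^ 2 / 2
      - (Real.log (√(2 * π))⁻¹ - (S * X + z - S * x') ^ 2 / 2)
      = (b - a) * z + (b ^ 2 - a ^ 2) / 2 := by rw [ha, hb]; ring
  rw [e]
  have h3 : |(b - a) * z| ≤ 2 * D * |z| := by
    rw [abs_mul]
    exact mul_le_mul_of_nonneg_right (((abs_sub b a).trans (add_le_add h2 h1)).trans
      (by linarith)) hz
  have h4 : a ^ 2 ≤ D ^ 2 := sq_le_sq' (abs_le.1 h1).1 (abs_le.1 h1).2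
  have h5 : b ^ 2 ≤ D ^ 2 := sq_le_sq' (abs_le.1 h2).1 (abs_le.1 h2).2
  have h6 : |(b ^ 2 - a ^ 2) / 2| ≤ D ^ 2 := by
    rw [abs_le]; constructor <;> nlinarith [sq_nonneg a, sq_nonneg b]
  refine (abs_add_le _ _).trans ?_
  nlinarith [mul_nonneg (sq_nonneg D) hz]

lemma exp_bounds_of_abs_log_sub_le {a b c : ℝ} (ha : 0 < a) (hb : 0 < b)
    (h : |Real.log a - Real.log b| ≤ c) : Real.exp (-c) * a ≤ b ∧ b ≤ Real.exp c * a := by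
  have h1 := abs_le.1 h
  constructor
  · rw [← Real.log_le_log_iff (by positivity) hb, Real.log_mul (Real.exp_pos _).ne' ha.ne',
      Real.log_exp]
    linarith
  · rw [← Real.log_le_log_iff hb (by positivity), Real.log_mul (Real.exp_pos _).ne' ha.ne',
      Real.log_exp]
    linarith

section Data

variable {Δ : ℝ} {kA : ℕ} {PA : Measure (Fin kA → ℝ)} [IsProbabilityMeasure PA]
  {φ : ℝ → (Fin kA → ℝ) → ℝ} {B : ℝ} {n m : ℕ} {k s : ℝ}

lemma integrable_dataBound (L D : ℝ) :
    Integrable (dataBound L D) (dataLaw n m PA) := by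
  have h1 : Integrable (fun r : Fin m → (Fin n → ℝ) × ((Fin kA → ℝ) × ℝ) =>
      ∑ μ, L * (1 + |(r μ).2.2|)) (Measure.pi fun _ : Fin m => rowLaw n PA) := by
    refine integrable_finsetSum _ fun μ _ => ?_
    exact integrable_comp_eval (μ := fun _ : Fin m => rowLaw n PA) (i := μ)
      (integrable_row_bound (PA := PA) (iid n stdG) (integrable_one_add_abs_stdG L))
  have h2 : Integrable (fun z : Fin n → ℝ => ∑ i, D * (1 + |z i|)) (iid n stdG) := by
    refine integrable_finsetSum _ fun i _ => ?_
    exact integrable_comp_eval (μ := fun _ : Fin n => stdG) (i := i)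
      (integrable_one_add_abs_stdG D)
  exact (h1.comp_fst _).add (h2.comp_snd _)

lemma RegularChannel.lik_pos (h : RegularChannel Δ φ B) (X x : Fin n → ℝ)
    (ω : (Fin m → (Fin n → ℝ) × ((Fin kA → ℝ) × ℝ)) × (Fin n → ℝ)) :
    0 < lik Δ PA φ k s X x ω :=
  mul_pos (Finset.prod_pos fun _ _ => h.Pout_pos _ _) (Finset.prod_pos fun _ _ => sideDens_pos _)

lemma RegularChannel.measurable_lik (h : RegularChannel Δ φ B) (X x : Fin n → ℝ) :
    Measurable (lik (m := m) Δ PA φ k s X x) := by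
  unfold lik
  refine Measurable.mul (Finset.measurable_prod _ fun μ _ => ?_)
    (Finset.measurable_prod _ fun i _ => by fun_prop)
  have hd (y : Fin n → ℝ) : Measurable fun ω :
      (Fin m → (Fin n → ℝ) × ((Fin kA → ℝ) × ℝ)) × (Fin n → ℝ) => dotp k y (ω.1 μ).1 :=
    (measurable_dotp k y).comp (by fun_prop)
  exact h.measurable_Pout_comp (h.measurable_out (hd X) (by fun_prop)) (hd x)

lemma RegularChannel.measurable_margLik (h : RegularChannel Δ φ B) (T : Finset ℝ) (w : ℝ → ℝ)
    (X : Fin n → ℝ) : Measurable (margLik (m := m) Δ PA φ T w k s X) :=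
  Finset.measurable_sum _ fun x _ => (h.measurable_lik X x).const_mul _

lemma RegularChannel.abs_log_lik_sub_le (h : RegularChannel Δ φ B) {R : ℝ} {X x : Fin n → ℝ}
    (hX : ∀ i, |X i| ≤ R) (hx : ∀ i, |x i| ≤ R)
    (ω : (Fin m → (Fin n → ℝ) × ((Fin kA → ℝ) × ℝ)) × (Fin n → ℝ)) :
    |Real.log (lik Δ PA φ k s X X ω) - Real.log (lik Δ PA φ k s X x ω)|
      ≤ dataBound (llrSlope Δ B) (sideSlope s R) ω := by
  unfold lik dataBound
  rw [Real.log_mul, Real.log_mul, Real.log_prod, Real.log_prod, Real.log_prod, Real.log_prod]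
  · have e (a b c d : ℝ) : a + b - (c + d) = (a - c) + (b - d) := by ring
    rw [e, ← Finset.sum_sub_distrib, ← Finset.sum_sub_distrib]
    refine (abs_add_le _ _).trans (add_le_add ?_ ?_) <;>
      refine (Finset.abs_sum_le_sum_abs _ _).trans (Finset.sum_le_sum fun j _ => ?_)
    · exact h.abs_log_Pout_sub_le _ _ _
    · exact abs_log_sideDens_sub_le (hX j) (hX j) (hx j) _
  all_goals first
    | exact fun _ _ => (sideDens_pos _).ne'
    | exact fun _ _ => (h.Pout_pos _ _).ne'
    | exact (Finset.prod_pos fun _ _ => sideDens_pos _).ne'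
    | exact (Finset.prod_pos fun _ _ => h.Pout_pos _ _).ne'

lemma sum_wt {T : Finset ℝ} {w : ℝ → ℝ} (h1 : ∑ t ∈ T, w t = 1) :
    ∑ x ∈ grid n T, wt w x = 1 := by
  unfold wt; rw [sum_grid_prod T fun _ => w]; simp [h1]

lemma wt_nonneg {w : ℝ → ℝ} (hw : ∀ t, 0 ≤ w t) (x : Fin n → ℝ) : 0 ≤ wt w x :=
  Finset.prod_nonneg fun _ _ => hw _

lemma abs_le_of_mem_grid {T : Finset ℝ} {x : Fin n → ℝ} (hx : x ∈ grid n T) (i : Fin n) :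
    |x i| ≤ ∑ t ∈ T, |t| := by
  have : x i ∈ T := (Fintype.mem_piFinset.1 hx) i
  exact Finset.single_le_sum (f := fun t => |t|) (fun t _ => abs_nonneg t) this

lemma RegularChannel.margLik_bounds (h : RegularChannel Δ φ B) {T : Finset ℝ} {w : ℝ → ℝ}
    (hw : ∀ t, 0 ≤ w t) (h1 : ∑ t ∈ T, w t = 1) {X : Fin n → ℝ} (hX : X ∈ grid n T)
    (ω : (Fin m → (Fin n → ℝ) × ((Fin kA → ℝ) × ℝ)) × (Fin n → ℝ)) :
    0 < margLik Δ PA φ T w k s X ω ∧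
      |Real.log (lik Δ PA φ k s X X ω / margLik Δ PA φ T w k s X ω)|
        ≤ dataBound (llrSlope Δ B) (sideSlope s (∑ t ∈ T, |t|)) ω := by
  set b := dataBound (llrSlope Δ B) (sideSlope s (∑ t ∈ T, |t|)) ω
  have hb (x) (hx : x ∈ grid n T) := exp_bounds_of_abs_log_sub_le (h.lik_pos X X ω)
    (h.lik_pos X x ω) (h.abs_log_lik_sub_le (PA := PA) (k := k) (s := s)
      (abs_le_of_mem_grid hX) (abs_le_of_mem_grid hx) ω)
  have hp := h.lik_pos (PA := PA) (k := k) (s := s) X X ω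
  have lo : Real.exp (-b) * lik Δ PA φ k s X X ω ≤ margLik Δ PA φ T w k s X ω := by
    rw [← one_mul (Real.exp (-b) * _), ← sum_wt (n := n) h1, Finset.sum_mul]
    exact Finset.sum_le_sum fun x hx => mul_le_mul_of_nonneg_left (hb x hx).1 (wt_nonneg hw x)
  have hi : margLik Δ PA φ T w k s X ω ≤ Real.exp b * lik Δ PA φ k s X X ω := by
    rw [← one_mul (Real.exp b * _), ← sum_wt (n := n) h1, Finset.sum_mul]
    exact Finset.sum_le_sum fun x hx => mul_le_mul_of_nonneg_left (hb x hx).2 (wt_nonneg hw x)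
  have hpos : 0 < margLik Δ PA φ T w k s X ω := lt_of_lt_of_le (by positivity) lo
  refine ⟨hpos, ?_⟩
  rw [Real.log_div hp.ne' hpos.ne', abs_le]
  have l1 := Real.log_le_log (by positivity) lo
  have l2 := Real.log_le_log hpos hi
  rw [Real.log_mul (Real.exp_pos _).ne' hp.ne', Real.log_exp] at l1 l2
  constructor <;> linarith

lemma RegularChannel.integrable_log_lik_div (h : RegularChannel Δ φ B) {T : Finset ℝ} {w : ℝ → ℝ}
    (hw : ∀ t, 0 ≤ w t) (h1 : ∑ t ∈ T, w t = 1) {X : Fin n → ℝ} (hX : X ∈ grid n T) :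
    Integrable (fun ω => Real.log (lik Δ PA φ k s X X ω / margLik Δ PA φ T w k s X ω))
      (dataLaw n m PA) :=
  Integrable.mono' (integrable_dataBound _ _)
    ((h.measurable_lik X X).div (h.measurable_margLik T w X)).log.aestronglyMeasurable
    (Filter.Eventually.of_forall fun ω => (h.margLik_bounds hw h1 hX ω).2)

lemma integral_prod_four {E₁ E₂ E₃ E₄ : Type*} [MeasurableSpace E₁] [MeasurableSpace E₂]
    [MeasurableSpace E₃] [MeasurableSpace E₄] {μ₁ : Measure E₁} {μ₂ : Measure E₂} {μ₃ : Measure E₃}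
    {μ₄ : Measure E₄} [SFinite μ₁] [SFinite μ₂] [SFinite μ₃] [SFinite μ₄]
    {H : (E₁ × (E₂ × E₃)) × E₄ → ℝ} (hH : Integrable H ((μ₁.prod (μ₂.prod μ₃)).prod μ₄)) :
    ∫ p, H p ∂((μ₁.prod (μ₂.prod μ₃)).prod μ₄)
      = ∫ x, ∫ y, ∫ z, ∫ t, H ((x, (y, z)), t) ∂μ₄ ∂μ₃ ∂μ₂ ∂μ₁ := by
  have h1 := hH.integral_prod_left
  rw [integral_prod _ hH, integral_prod _ h1]
  refine integral_congr_ae ?_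
  filter_upwards [h1.prod_right_ae] with x hx
  exact integral_prod _ hx

lemma integral_dataLaw_unnest
    {H : ((Fin m → Fin n → ℝ) × ((Fin m → Fin kA → ℝ) × (Fin m → ℝ))) × (Fin n → ℝ) → ℝ}
    (hH : Integrable (fun ω : (Fin m → (Fin n → ℝ) × ((Fin kA → ℝ) × ℝ)) × (Fin n → ℝ) =>
      H ((fun μ => (ω.1 μ).1, (fun μ => (ω.1 μ).2.1, fun μ => (ω.1 μ).2.2)), ω.2))
      (dataLaw n m PA)) :
    ∫ x, ∫ a, ∫ z, ∫ t, H ((x, (a, z)), t) ∂(iid n stdG) ∂(iid m stdG)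
        ∂(Measure.pi fun _ : Fin m => PA) ∂(Measure.pi fun _ : Fin m => iid n stdG)
      = ∫ ω, H ((fun μ => (ω.1 μ).1, (fun μ => (ω.1 μ).2.1, fun μ => (ω.1 μ).2.2)), ω.2)
        ∂(dataLaw n m PA) := by
  let e₁ := MeasurableEquiv.arrowProdEquivProdArrow (Fin n → ℝ) ((Fin kA → ℝ) × ℝ) (Fin m)
  let e₂ := MeasurableEquiv.arrowProdEquivProdArrow (Fin kA → ℝ) ℝ (Fin m)
  have p₁ : MeasurePreserving e₁ (Measure.pi fun _ : Fin m => rowLaw n PA)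
      ((Measure.pi fun _ => iid n stdG).prod (Measure.pi fun _ => noise PA)) :=
    measurePreserving_arrowProdEquivProdArrow _ _ _ (fun _ => iid n stdG) fun _ => noise PA
  have p₂ : MeasurePreserving e₂ (Measure.pi fun _ : Fin m => noise PA)
      ((Measure.pi fun _ => PA).prod (iid m stdG)) :=
    measurePreserving_arrowProdEquivProdArrow _ _ _ (fun _ => PA) fun _ => stdG
  let e := (e₁.trans ((MeasurableEquiv.refl _).prodCongr e₂)).prodCongr
    (MeasurableEquiv.refl (Fin n → ℝ))
  have p : MeasurePreserving e (dataLaw n m PA)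
      (((Measure.pi fun _ => iid n stdG).prod ((Measure.pi fun _ => PA).prod (iid m stdG))).prod
        (iid n stdG)) :=
    ((((MeasurePreserving.id _).prod p₂).comp p₁).prod (MeasurePreserving.id _))
  have h1 := (p.integrable_comp_emb e.measurableEmbedding (g := H)).1 hH
  rw [← integral_prod_four h1]
  exact (p.integral_comp' H).symm

lemma RegularChannel.MIside_eq (h : RegularChannel Δ φ B) {P0 : Measure ℝ} {ρ α τ : ℝ}
    [IsProbabilityMeasure (sparsePrior ρ P0)] {T : Finset ℝ}
    (hT : ∀ᵐ x ∂(sparsePrior ρ P0), x ∈ T) (h1 : ∑ t ∈ T, (sparsePrior ρ P0).real {t} = 1) :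
    MIside Δ PA φ P0 ρ α τ n m = ∑ X ∈ grid n T, wt (fun t => (sparsePrior ρ P0).real {t}) X *
      ∫ ω, Real.log (lik Δ PA φ (n * ρ) (α * τ / ρ) X X ω
        / margLik Δ PA φ T (fun t => (sparsePrior ρ P0).real {t}) (n * ρ) (α * τ / ρ) X ω)
        ∂(dataLaw n m PA) := by
  unfold MIside
  rw [integral_iid_finite hT]
  refine Finset.sum_congr rfl fun X hX => ?_
  congr 1
  have hmarg (Φ : Fin m → Fin n → ℝ) (y : Fin m → ℝ) (yt : Fin n → ℝ) :
      pMargSide Δ PA φ n m (sparsePrior ρ P0) (n * ρ) (α * τ / ρ) Φ y yt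
        = ∑ x ∈ grid n T, wt (fun t => (sparsePrior ρ P0).real {t}) x
          * pCondSide Δ PA φ n m (n * ρ) (α * τ / ρ) Φ x y yt := integral_iid_finite hT _
  simp_rw [hmarg]
  exact integral_dataLaw_unnest (H := fun p => Real.log
    (pCondSide Δ PA φ n m ((n : ℝ) * ρ) (α * τ / ρ) p.1.1 X
        (Yobs Δ φ n m ((n : ℝ) * ρ) p.1.1 X p.1.2.1 p.1.2.2)
        (fun i => Real.sqrt (α * τ / ρ) * X i + p.2 i)
      / ∑ x ∈ grid n T, wt (fun t => (sparsePrior ρ P0).real {t}) x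
          * pCondSide Δ PA φ n m (n * ρ) (α * τ / ρ) p.1.1 x
          (Yobs Δ φ n m ((n : ℝ) * ρ) p.1.1 X p.1.2.1 p.1.2.2)
        (fun i => Real.sqrt (α * τ / ρ) * X i + p.2 i)))
    (h.integrable_log_lik_div (fun t => measureReal_nonneg) h1 hX)

end Data

/-- Restriction of a vector to a set of coordinates. -/
def restr {n : ℕ} (A : Finset (Fin n)) (x : Fin n → ℝ) : Fin n → ℝ := fun i => if i ∈ A then x i else 0

/-- Support of a vector. -/
def supp {n : ℕ} (x : Fin n → ℝ) : Finset (Fin n) := Finset.univ.filter fun i => x i ≠ 0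

lemma mem_supp {n : ℕ} {x : Fin n → ℝ} {i : Fin n} : i ∈ supp x ↔ x i ≠ 0 := by simp [supp]

lemma integrable_exp_affine_stdG (c t : ℝ) : Integrable (fun z : ℝ => Real.exp (c + t * z)) stdG := by
  simp_rw [Real.exp_add]
  exact (integrable_exp_mul_gaussianReal t).const_mul _

lemma integral_exp_affine_stdG (c t : ℝ) :
    ∫ z, Real.exp (c + t * z) ∂stdG = Real.exp (c + t ^ 2 / 2) := by
  simp_rw [Real.exp_add]
  rw [integral_const_mul]
  have := congrFun (mgf_id_gaussianReal (μ := 0) (v := 1)) t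
  simp only [mgf, id] at this
  rw [stdG, this]; simp

lemma integrable_of_lintegral_ofReal_eq_one {E : Type*} [MeasurableSpace E] {μ : Measure E}
    {f : E → ℝ} (hf : Measurable f) (h0 : ∀ e, 0 ≤ f e)
    (h1 : ∫⁻ e, ENNReal.ofReal (f e) ∂μ = 1) : Integrable f μ ∧ ∫ e, f e ∂μ = 1 := by
  refine ⟨⟨hf.aestronglyMeasurable, ?_⟩, ?_⟩
  · rw [hasFiniteIntegral_iff_ofReal (Filter.Eventually.of_forall h0), h1]
    exact ENNReal.one_lt_top
  · rw [integral_eq_lintegral_of_nonneg_ae (Filter.Eventually.of_forall h0)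
      hf.aestronglyMeasurable, h1]; simp

section Lower

variable {Δ : ℝ} {kA : ℕ} {PA : Measure (Fin kA → ℝ)} [IsProbabilityMeasure PA]
  {φ : ℝ → (Fin kA → ℝ) → ℝ} {B : ℝ} {n m : ℕ} {k s : ℝ}

lemma integral_dataLaw_prod {f : (Fin n → ℝ) × ((Fin kA → ℝ) × ℝ) → ℝ} {g : Fin n → ℝ → ℝ}
    (hf : Integrable f (rowLaw n PA)) (hg : ∀ i, Integrable (g i) stdG) :
    Integrable (fun ω => (∏ μ, f (ω.1 μ)) * ∏ i, g i (ω.2 i)) (dataLaw n m PA) ∧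
      ∫ ω, (∏ μ, f (ω.1 μ)) * ∏ i, g i (ω.2 i) ∂(dataLaw n m PA)
        = (∫ r, f r ∂(rowLaw n PA)) ^ m * ∏ i, ∫ z, g i z ∂stdG := by
  have h1 : Integrable (fun r : Fin m → (Fin n → ℝ) × ((Fin kA → ℝ) × ℝ) => ∏ μ, f (r μ))
      (Measure.pi fun _ : Fin m => rowLaw n PA) := Integrable.fintype_prod fun _ => hf
  have h2 : Integrable (fun z : Fin n → ℝ => ∏ i, g i (z i)) (iid n stdG) :=
    Integrable.fintype_prod hg
  refine ⟨h1.mul_prod h2, ?_⟩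
  have e := integral_prod_mul (μ := Measure.pi fun _ : Fin m => rowLaw n PA) (ν := iid n stdG)
    (fun r : Fin m → (Fin n → ℝ) × ((Fin kA → ℝ) × ℝ) => ∏ μ, f (r μ))
    (fun z : Fin n → ℝ => ∏ i, g i (z i))
  rw [dataLaw, e]
  congr 1
  · exact (integral_fintype_prod_eq_prod fun (_ : Fin m) => f).trans (by simp)
  · exact integral_fintype_prod_eq_prod g

/-- Likelihood of the observations generated by `X` when only the coordinates in `A` are known and
the remaining ones are replaced by Gaussian noise in the main channel and zero in the side one. -/
def baseLik (Δ : ℝ) {kA : ℕ} (PA : Measure (Fin kA → ℝ)) (φ : ℝ → (Fin kA → ℝ) → ℝ) {n m : ℕ}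
    (k s c : ℝ) (X u : Fin n → ℝ)
    (ω : (Fin m → (Fin n → ℝ) × ((Fin kA → ℝ) × ℝ)) × (Fin n → ℝ)) : ℝ :=
  (∏ μ, avgPout Δ PA φ (out Δ φ (dotp k X (ω.1 μ).1) (ω.1 μ).2) (dotp k u (ω.1 μ).1) c)
    * ∏ i, sideDens (Real.sqrt s * X i + ω.2 i - Real.sqrt s * u i)

lemma RegularChannel.baseLik_pos (h : RegularChannel Δ φ B) (c : ℝ) (X u : Fin n → ℝ)
    (ω : (Fin m → (Fin n → ℝ) × ((Fin kA → ℝ) × ℝ)) × (Fin n → ℝ)) :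
    0 < baseLik Δ PA φ k s c X u ω :=
  mul_pos (Finset.prod_pos fun _ _ => h.avgPout_pos _ _ _)
    (Finset.prod_pos fun _ _ => sideDens_pos _)

lemma sideDens_div (a b z : ℝ) :
    sideDens (a + z) / sideDens (b + z) = Real.exp ((b ^ 2 - a ^ 2) / 2 + (b - a) * z) := by
  have h0 : (Real.sqrt (2 * π))⁻¹ ≠ 0 := by positivity
  rw [sideDens, sideDens, mul_div_mul_left _ _ h0, ← Real.exp_sub]
  ring_nf

/-- The likelihood ratios have mean one under the law of the data. -/
lemma RegularChannel.integral_lik_div_base (h : RegularChannel Δ φ B) (hk : 0 ≤ k)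
    {X u x : Fin n → ℝ} (hu : ∀ i, u i = 0 ∨ u i = X i) (hx : ∀ i, u i ≠ X i → x i = 0) :
    Integrable (fun ω => lik Δ PA φ k s X x ω
        / baseLik Δ PA φ k s (Real.sqrt (nsq k (X - u))) X u ω) (dataLaw n m PA) ∧
      ∫ ω, lik Δ PA φ k s X x ω / baseLik Δ PA φ k s (Real.sqrt (nsq k (X - u))) X u ω
        ∂(dataLaw n m PA) = 1 := by
  have hv : ∀ i, (X - u) i ≠ 0 → x i = 0 ∧ u i = 0 := by
    intro i hi
    have hne : u i ≠ X i := fun hc => hi (by simp [hc])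
    exact ⟨hx i hne, (hu i).resolve_right hne⟩
  have hrow := h.lintegral_row_ratio (PA := PA) hk hv
  rw [add_sub_cancel] at hrow
  obtain ⟨c, hc⟩ : ∃ c, c = Real.sqrt (nsq k (X - u)) := ⟨_, rfl⟩
  rw [← hc] at hrow ⊢
  have hd (y : Fin n → ℝ) : Measurable fun r :
      (Fin n → ℝ) × ((Fin kA → ℝ) × ℝ) => dotp k y r.1 := (measurable_dotp k y).comp (by fun_prop)
  have ho := h.measurable_out (hd X) measurable_snd
  have hf := integrable_of_lintegral_ofReal_eq_one
    ((h.measurable_Pout_comp (PA := PA) ho (hd x)).div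
      (h.measurable_avgPout (PA := PA) ho (hd u) (measurable_const (a := c))))
    (fun r => (div_pos (h.Pout_pos _ _) (h.avgPout_pos _ _ _)).le) hrow
  have key := integral_dataLaw_prod (m := m) hf.1 (g := fun i z => Real.exp
    (((Real.sqrt s * (X i - u i)) ^ 2 - (Real.sqrt s * (X i - x i)) ^ 2) / 2
      + (Real.sqrt s * (X i - u i) - Real.sqrt s * (X i - x i)) * z))
    fun i => integrable_exp_affine_stdG _ _
  have e : (fun ω : (Fin m → (Fin n → ℝ) × ((Fin kA → ℝ) × ℝ)) × (Fin n → ℝ) =>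
      lik Δ PA φ k s X x ω / baseLik Δ PA φ k s c X u ω) = fun ω =>
      (∏ μ, Pout Δ PA φ (out Δ φ (dotp k X (ω.1 μ).1) (ω.1 μ).2) (dotp k x (ω.1 μ).1)
        / avgPout Δ PA φ (out Δ φ (dotp k X (ω.1 μ).1) (ω.1 μ).2) (dotp k u (ω.1 μ).1) c)
      * ∏ i, Real.exp (((Real.sqrt s * (X i - u i)) ^ 2 - (Real.sqrt s * (X i - x i)) ^ 2) / 2
      + (Real.sqrt s * (X i - u i) - Real.sqrt s * (X i - x i)) * ω.2 i) := by
    funext ω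
    simp_rw [← sideDens_div]
    have hsh (a b z : ℝ) : Real.sqrt s * a + z - Real.sqrt s * b = Real.sqrt s * (a - b) + z := by
      ring
    simp_rw [lik, baseLik, hsh]
    rw [Finset.prod_div_distrib, Finset.prod_div_distrib, mul_div_mul_comm]
  rw [e]
  refine ⟨key.1, key.2.trans ?_⟩
  have hf2 := hf.2
  simp only [Pi.div_apply] at hf2
  refine (congrArg₂ _ (congrArg (· ^ m) hf2) (Finset.prod_eq_one fun i _ => ?_)).trans (by simp)
  rw [integral_exp_affine_stdG, Real.exp_eq_one_iff]
  rcases eq_or_ne (u i) (X i) with hi | hi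
  · rw [hi]; ring
  · rw [hx i hi, (hu i).resolve_right hi]; ring

/-- Exponential rate of the likelihood when `u` is known. -/
def rate (Δ B : ℝ) {kA : ℕ} (PA : Measure (Fin kA → ℝ)) (φ : ℝ → (Fin kA → ℝ) → ℝ) {n : ℕ} (m : ℕ)
    (k s θ : ℝ) (X u : Fin n → ℝ) : ℝ :=
  m * (Iinfo Δ PA φ (nsq k u) (nsq k (X - u)) - θ * mgfConst Δ B)
    + (1 - θ) * (s * ∑ i, (X i - u i) ^ 2) / 2

lemma RegularChannel.integral_base_rpow_le (h : RegularChannel Δ φ B) (hk : 0 ≤ k) (hs : 0 ≤ s)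
    {θ : ℝ} (hθ : 0 ≤ θ) (hθ1 : θ ≤ 1) {X u : Fin n → ℝ} (hu : ∀ i, u i = 0 ∨ u i = X i) :
    Integrable (fun ω => Real.exp (θ * (Real.log (baseLik Δ PA φ k s
        (Real.sqrt (nsq k (X - u))) X u ω) - Real.log (lik Δ PA φ k s X X ω)
          + rate Δ B PA φ m k s θ X u))) (dataLaw n m PA) ∧
      ∫ ω, Real.exp (θ * (Real.log (baseLik Δ PA φ k s
        (Real.sqrt (nsq k (X - u))) X u ω) - Real.log (lik Δ PA φ k s X X ω)
          + rate Δ B PA φ m k s θ X u)) ∂(dataLaw n m PA) ≤ 1 := by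
  have hb : ∀ i, (X - u) i ≠ 0 → u i = 0 := by
    intro i hi
    exact (hu i).resolve_right fun hc => hi (by simp [hc])
  have hI := Iinfo_row (PA := PA) h hk hb (add_sub_cancel u X) rfl rfl
  have hle := h.integral_exp_llr_le (PA := PA) (iid n stdG) (measurable_dotp k X)
    (measurable_dotp k u) (Real.sqrt (nsq k (X - u))) hθ hθ1
  have hint := h.integrable_exp_llr (PA := PA) (iid n stdG) (measurable_dotp k X)
    (measurable_dotp k u) (Real.sqrt (nsq k (X - u))) (-θ)
  change ∫ r, _ ∂(rowLaw n PA) ≤ Real.exp (θ * (-(∫ r, _ ∂(rowLaw n PA)) + _)) at hle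
  change Integrable _ (rowLaw n PA) at hint
  rw [hI] at hle
  unfold rate
  obtain ⟨I, hI'⟩ : ∃ I, I = Iinfo Δ PA φ (nsq k u) (nsq k (X - u)) := ⟨_, rfl⟩
  rw [← hI'] at hle ⊢
  clear hI hI'
  obtain ⟨c, hc⟩ : ∃ c, c = Real.sqrt (nsq k (X - u)) := ⟨_, rfl⟩
  rw [← hc] at hle hint ⊢
  have key := integral_dataLaw_prod (m := m) hint (g := fun i z => Real.exp
    (-θ * (Real.sqrt s * (X i - u i)) ^ 2 / 2 + (-θ * (Real.sqrt s * (X i - u i))) * z))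
    fun i => integrable_exp_affine_stdG _ _
  obtain ⟨Q, hQ⟩ : ∃ Q, Q = ∑ i, (X i - u i) ^ 2 := ⟨_, rfl⟩
  rw [← hQ]
  have e : (fun ω : (Fin m → (Fin n → ℝ) × ((Fin kA → ℝ) × ℝ)) × (Fin n → ℝ) =>
      Real.exp (θ * (Real.log (baseLik Δ PA φ k s c X u ω) - Real.log (lik Δ PA φ k s X X ω)
          + (m * (I - θ * mgfConst Δ B) + (1 - θ) * (s * Q) / 2)))) = fun ω =>
      ((∏ μ, Real.exp (-θ * llr Δ PA φ (dotp k X (ω.1 μ).1) (dotp k u (ω.1 μ).1) c (ω.1 μ).2))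
      * ∏ i, Real.exp (-θ * (Real.sqrt s * (X i - u i)) ^ 2 / 2
          + (-θ * (Real.sqrt s * (X i - u i))) * ω.2 i)) *
        Real.exp (θ * (m * (I - θ * mgfConst Δ B) + (1 - θ) * (s * Q) / 2)) := by
    funext ω
    rw [← Real.exp_sum, ← Real.exp_sum, ← Real.exp_add, ← Real.exp_add]
    congr 1
    rw [baseLik, lik, Real.log_mul, Real.log_mul, Real.log_prod, Real.log_prod, Real.log_prod,
      Real.log_prod]
    · have e1 : ∑ μ, -θ * llr Δ PA φ (dotp k X (ω.1 μ).1) (dotp k u (ω.1 μ).1) c (ω.1 μ).2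
          = -θ * ∑ μ, Real.log (Pout Δ PA φ (out Δ φ (dotp k X (ω.1 μ).1) (ω.1 μ).2)
              (dotp k X (ω.1 μ).1))
          + θ * ∑ μ, Real.log (avgPout Δ PA φ (out Δ φ (dotp k X (ω.1 μ).1) (ω.1 μ).2)
              (dotp k u (ω.1 μ).1) c) := by
        rw [← Finset.mul_sum]; simp only [llr]; rw [Finset.sum_sub_distrib]; ring
      have e2 : ∑ i, (-θ * (Real.sqrt s * (X i - u i)) ^ 2 / 2
          + (-θ * (Real.sqrt s * (X i - u i))) * ω.2 i)
          = θ * ∑ i, Real.log (sideDens (Real.sqrt s * X i + ω.2 i - Real.sqrt s * u i))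
          - θ * ∑ i, Real.log (sideDens (Real.sqrt s * X i + ω.2 i - Real.sqrt s * X i)) := by
        rw [Finset.mul_sum, Finset.mul_sum, ← Finset.sum_sub_distrib]
        refine Finset.sum_congr rfl fun i _ => ?_
        rw [log_sideDens, log_sideDens]; ring
      rw [e1, e2]; ring
    all_goals first
      | exact fun _ _ => (sideDens_pos _).ne'
      | exact fun _ _ => (h.Pout_pos _ _).ne'
      | exact fun _ _ => (h.avgPout_pos _ _ _).ne'
      | exact (Finset.prod_pos fun _ _ => sideDens_pos _).ne'
      | exact (Finset.prod_pos fun _ _ => h.Pout_pos _ _).ne'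
      | exact (Finset.prod_pos fun _ _ => h.avgPout_pos _ _ _).ne'
  rw [e]
  refine ⟨key.1.mul_const _, ?_⟩
  rw [integral_mul_const, key.2]
  simp_rw [integral_exp_affine_stdG]
  rw [← Real.exp_sum]
  have e3 : ∑ i, (-θ * (Real.sqrt s * (X i - u i)) ^ 2 / 2
      + (-θ * (Real.sqrt s * (X i - u i))) ^ 2 / 2) = -θ * ((1 - θ) * (s * Q) / 2) := by
    rw [hQ, Finset.mul_sum, Finset.mul_sum, Finset.sum_div, Finset.mul_sum]
    refine Finset.sum_congr rfl fun i _ => ?_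
    rw [mul_pow, mul_pow, mul_pow, Real.sq_sqrt hs]; ring
  rw [e3]
  have h0 : 0 ≤ ∫ r, Real.exp (-θ * llr Δ PA φ (dotp k X r.1) (dotp k u r.1) c r.2)
    ∂(rowLaw n PA) := integral_nonneg fun r => (Real.exp_pos _).le
  have h4 := pow_le_pow_left₀ h0 hle m
  rw [← Real.exp_nat_mul] at h4
  refine (mul_le_mul_of_nonneg_right (mul_le_mul_of_nonneg_right h4 (Real.exp_pos _).le)
    (Real.exp_pos _).le).trans ?_
  rw [← Real.exp_add, ← Real.exp_add, Real.exp_le_one_iff]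
  apply le_of_eq; ring

lemma sum_wt_exp_le {T : Finset ℝ} {w : ℝ → ℝ} (hw : ∀ t, 0 ≤ w t) (h1 : ∑ t ∈ T, w t = 1) {L : ℝ}
    (hL : ∑ t ∈ T.filter (· ≠ 0), w t ≤ Real.exp (-L)) (S : Finset (Fin n)) :
    ∑ x ∈ grid n T, wt w x * Real.exp (L * ((S ∩ supp x).card : ℝ)) ≤ 2 ^ S.card := by
  have e (x : Fin n → ℝ) : wt w x * Real.exp (L * ((S ∩ supp x).card : ℝ))
      = ∏ i, (fun (i : Fin n) t => w t * (if i ∈ S ∧ t ≠ 0 then Real.exp L else 1)) i (x i) := by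
    simp only
    rw [Finset.prod_mul_distrib, wt, mul_comm L, Real.exp_nat_mul, ← Finset.prod_const,
      Finset.prod_ite]
    congr 1
    simp only [Finset.prod_const_one, mul_one]
    congr 1
    ext i; simp [supp]
  refine ((Finset.sum_congr rfl fun x _ => e x).trans (sum_grid_prod T
    fun (i : Fin n) t => w t * (if i ∈ S ∧ t ≠ 0 then Real.exp L else 1))).trans_le ?_
  have h2 : ∀ i ∈ (Finset.univ : Finset (Fin n)), ∑ t ∈ T, w t * (if i ∈ S ∧ t ≠ 0 then Real.exp L
      else 1) ≤ if i ∈ S then 2 else 1 := by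
    intro i _
    by_cases hi : i ∈ S
    · simp only [hi, true_and, if_true]
      have h3 : ∀ t ∈ T, w t * (if t ≠ 0 then Real.exp L else 1)
          ≤ w t + (if t ≠ 0 then w t else 0) * Real.exp L := by
        intro t _
        have := hw t
        split_ifs <;> nlinarith [Real.exp_pos L]
      refine (Finset.sum_le_sum h3).trans ?_
      rw [Finset.sum_add_distrib, h1, ← Finset.sum_mul, ← Finset.sum_filter]
      have := mul_le_mul_of_nonneg_right hL (Real.exp_pos L).le
      rw [← Real.exp_add, neg_add_cancel, Real.exp_zero] at this
      linarith
    · simp [hi, h1]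
  refine (Finset.prod_le_prod (fun i _ => Finset.sum_nonneg fun t _ => ?_) h2).trans ?_
  · have := hw t
    split_ifs <;> positivity
  · simp

lemma restr_cases (A : Finset (Fin n)) (X : Fin n → ℝ) (i : Fin n) :
    restr A X i = 0 ∨ restr A X i = X i := by
  unfold restr; split_ifs <;> simp

/-- Lower bound on the information density averaged over the noise, for a fixed signal. -/
lemma RegularChannel.le_integral_log_lik_div (h : RegularChannel Δ φ B) (hk : 0 ≤ k) (hs : 0 ≤ s)
    {θ : ℝ} (hθ : 0 < θ) (hθ1 : θ ≤ 1) {T : Finset ℝ} {w : ℝ → ℝ} (hw : ∀ t, 0 ≤ w t)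
    (h1 : ∑ t ∈ T, w t = 1) {L : ℝ} (hL : ∑ t ∈ T.filter (· ≠ 0), w t ≤ Real.exp (-L))
    {X : Fin n → ℝ} (hX : X ∈ grid n T) {M : ℝ}
    (hM : ∀ A ⊆ supp X, M ≤ rate Δ B PA φ m k s θ X (restr A X) + A.card * L) :
    M - (1 + 1 / θ) * ((supp X).card * Real.log 2)
      ≤ ∫ ω, Real.log (lik Δ PA φ k s X X ω / margLik Δ PA φ T w k s X ω) ∂(dataLaw n m PA) := by
  obtain ⟨base, hbase⟩ : ∃ base : Finset (Fin n) →
      ((Fin m → (Fin n → ℝ) × ((Fin kA → ℝ) × ℝ)) × (Fin n → ℝ)) → ℝ, base = fun A =>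
    baseLik Δ PA φ k s (Real.sqrt (nsq k (X - restr A X))) X (restr A X) := ⟨_, rfl⟩
  have hbpos A ω : 0 < base A ω := by rw [hbase]; exact h.baseLik_pos _ _ _ _
  obtain ⟨u, hu⟩ : ∃ u : Finset (Fin n) →
      ((Fin m → (Fin n → ℝ) × ((Fin kA → ℝ) × ℝ)) × (Fin n → ℝ)) → ℝ, u = fun A ω => Real.exp
    (θ * (Real.log (base A ω) - Real.log (lik Δ PA φ k s X X ω)
      + rate Δ B PA φ m k s θ X (restr A X))) := ⟨_, rfl⟩
  have hupos A ω : 0 < u A ω := by rw [hu]; exact Real.exp_pos _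
  have hui A : Integrable (u A) (dataLaw n m PA) ∧ ∫ ω, u A ω ∂(dataLaw n m PA) ≤ 1 := by
    rw [hu, hbase]
    exact h.integral_base_rpow_le hk hs hθ.le hθ1 (restr_cases A X)
  have hRi x : Integrable (fun ω => lik Δ PA φ k s X x ω / base (supp X ∩ supp x) ω)
      (dataLaw n m PA) ∧ ∫ ω, lik Δ PA φ k s X x ω / base (supp X ∩ supp x) ω
        ∂(dataLaw n m PA) = 1 := by
    rw [hbase]
    refine h.integral_lik_div_base hk (restr_cases _ X) fun i hi => ?_
    by_contra hxi
    refine hi ?_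
    by_cases hXi : X i = 0
    · rcases restr_cases (supp X ∩ supp x) X i with h0 | h0 <;> simp [h0, hXi]
    · simp [restr, mem_supp, hXi, hxi]
  obtain ⟨N, hN⟩ : ∃ N : ℝ, N = 2 ^ (supp X).card := ⟨_, rfl⟩
  have hNpos : 0 < N := by rw [hN]; positivity
  have hNlog : Real.log N = (supp X).card * Real.log 2 := by rw [hN, Real.log_pow]
  obtain ⟨U, hU⟩ : ∃ U : ((Fin m → (Fin n → ℝ) × ((Fin kA → ℝ) × ℝ)) × (Fin n → ℝ)) → ℝ,
      U = fun ω => ∑ A ∈ (supp X).powerset, u A ω := ⟨_, rfl⟩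
  obtain ⟨V, hV⟩ : ∃ V : ((Fin m → (Fin n → ℝ) × ((Fin kA → ℝ) × ℝ)) × (Fin n → ℝ)) → ℝ,
      V = fun ω => ∑ x ∈ grid n T, (wt w x * Real.exp (L * ((supp X ∩ supp x).card : ℝ)))
        * (lik Δ PA φ k s X x ω / base (supp X ∩ supp x) ω) := ⟨_, rfl⟩
  have hUi : Integrable U (dataLaw n m PA) := by
    rw [hU]; exact integrable_finsetSum _ fun A _ => (hui A).1
  have hVi : Integrable V (dataLaw n m PA) := by
    rw [hV]; exact integrable_finsetSum _ fun x _ => (hRi x).1.const_mul _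
  have hUN : ∫ ω, U ω ∂(dataLaw n m PA) ≤ N := by
    rw [hU, integral_finsetSum _ fun A _ => (hui A).1]
    refine (Finset.sum_le_sum fun A _ => (hui A).2).trans ?_
    simp [hN]
  have hVN : ∫ ω, V ω ∂(dataLaw n m PA) ≤ N := by
    rw [hV, integral_finsetSum _ fun x _ => (hRi x).1.const_mul _]
    simp_rw [integral_const_mul, (hRi _).2, mul_one]
    rw [hN]
    exact sum_wt_exp_le hw h1 hL _
  have hpt ω : M - (1 / θ) * (Real.log N + U ω / N - 1) - (Real.log N + V ω / N - 1)
      ≤ Real.log (lik Δ PA φ k s X X ω / margLik Δ PA φ T w k s X ω) := by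
    have hl := h.lik_pos (PA := PA) (k := k) (s := s) X X ω
    have hm := (h.margLik_bounds (PA := PA) (k := k) (s := s) hw h1 hX ω).1
    have hUpos : 0 < U ω := by
      rw [hU]
      exact Finset.sum_pos (fun A _ => hupos A ω) ⟨∅, by simp⟩
    have hle : margLik Δ PA φ T w k s X ω
        ≤ (lik Δ PA φ k s X X ω * Real.exp (-M + 1 / θ * Real.log (U ω))) * V ω := by
      rw [hV, margLik, Finset.mul_sum]
      refine Finset.sum_le_sum fun x _ => ?_
      have hA : supp X ∩ supp x ⊆ supp X := Finset.inter_subset_left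
      obtain ⟨A, hAe⟩ : ∃ A, A = supp X ∩ supp x := ⟨_, rfl⟩
      rw [← hAe] at hA ⊢
      have hlx := h.lik_pos (PA := PA) (k := k) (s := s) X x ω
      have huU : u A ω ≤ U ω := by
        rw [hU]
        exact Finset.single_le_sum (f := fun A => u A ω) (fun A _ => (hupos A ω).le)
          (Finset.mem_powerset.2 hA)
      have hlu := Real.log_le_log (hupos A ω) huU
      rw [hu] at hlu
      simp only [Real.log_exp] at hlu
      have hb : base A ω ≤ lik Δ PA φ k s X X ω * Real.exp (-M + 1 / θ * Real.log (U ω))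
          * Real.exp (L * (A.card : ℝ)) := by
        rw [← Real.log_le_log_iff (hbpos A ω) (by positivity), Real.log_mul (by positivity)
          (Real.exp_pos _).ne', Real.log_mul hl.ne' (Real.exp_pos _).ne', Real.log_exp,
          Real.log_exp]
        have h5 := hM A hA
        have h6 := mul_le_mul_of_nonneg_left hlu (by positivity : 0 ≤ 1 / θ)
        rw [← mul_assoc, one_div_mul_cancel hθ.ne', one_mul] at h6
        linarith
      have h7 := mul_le_mul_of_nonneg_right hb (div_pos hlx (hbpos A ω)).le
      rw [mul_div_cancel₀ _ (hbpos A ω).ne'] at h7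
      have h8 := mul_le_mul_of_nonneg_left h7 (wt_nonneg hw x)
      refine h8.trans (le_of_eq ?_)
      ring
    have hVpos : 0 < V ω := by
      by_contra hc
      have := mul_nonpos_of_nonneg_of_nonpos
        (by positivity : 0 ≤ lik Δ PA φ k s X X ω * Real.exp (-M + 1 / θ * Real.log (U ω)))
        (not_lt.1 hc)
      linarith
    have hlog := Real.log_le_log hm hle
    rw [Real.log_mul (by positivity) hVpos.ne', Real.log_mul hl.ne' (Real.exp_pos _).ne',
      Real.log_exp] at hlog
    have hlogN (t : ℝ) (ht : 0 < t) : Real.log t ≤ Real.log N + t / N - 1 := by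
      have := Real.log_le_sub_one_of_pos (div_pos ht hNpos)
      rw [Real.log_div ht.ne' hNpos.ne'] at this
      linarith
    have g1 := mul_le_mul_of_nonneg_left (hlogN _ hUpos) (by positivity : 0 ≤ 1 / θ)
    have g2 := hlogN _ hVpos
    rw [Real.log_div hl.ne' hm.ne']
    linarith
  have hi1 : Integrable (fun ω => 1 / θ * (Real.log N + U ω / N - 1)) (dataLaw n m PA) :=
    (((integrable_const _).add (hUi.div_const N)).sub (integrable_const _)).const_mul _
  have hi2 : Integrable (fun ω => Real.log N + V ω / N - 1) (dataLaw n m PA) :=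
    ((integrable_const _).add (hVi.div_const N)).sub (integrable_const _)
  have hi0 : Integrable (fun ω => M - 1 / θ * (Real.log N + U ω / N - 1)) (dataLaw n m PA) :=
    (integrable_const _).sub hi1
  have hmono := integral_mono (hi0.sub hi2) (h.integrable_log_lik_div (PA := PA) (k := k) (s := s)
    hw h1 hX) hpt
  refine le_trans ?_ hmono
  have av {f : ((Fin m → (Fin n → ℝ) × ((Fin kA → ℝ) × ℝ)) × (Fin n → ℝ)) → ℝ}
      (hf : Integrable f (dataLaw n m PA)) :
      ∫ ω, (Real.log N + f ω / N - 1) ∂(dataLaw n m PA)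
        = Real.log N + (∫ ω, f ω ∂(dataLaw n m PA)) / N - 1 := by
    have j : Integrable (fun ω => Real.log N + f ω / N) (dataLaw n m PA) :=
      (integrable_const _).add (hf.div_const N)
    rw [integral_sub j (integrable_const _), integral_add (integrable_const _) (hf.div_const N),
      integral_div]
    simp
  have e0 := integral_sub hi0 hi2
  have e1 := integral_sub (integrable_const (μ := dataLaw n m PA) M) hi1
  simp only [Pi.sub_apply] at e0 e1 ⊢
  rw [e0, e1, integral_const_mul, av hUi, av hVi, ← hNlog]
  have a1 : (∫ ω, U ω ∂(dataLaw n m PA)) / N ≤ 1 := (div_le_one hNpos).2 hUN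
  have a2 : (∫ ω, V ω ∂(dataLaw n m PA)) / N ≤ 1 := (div_le_one hNpos).2 hVN
  have a3 : 0 ≤ 1 / θ := by positivity
  simp only [integral_const, probReal_univ, one_smul]
  nlinarith [mul_le_mul_of_nonneg_left a1 a3]

end Lower

/-- Contribution of the large entries to the power of a signal. -/
def bigSq (t x : ℝ) : ℝ := if t ≤ |x| then x ^ 2 else 0

/-- Indicator of the large entries of a signal. -/
def bigInd (t x : ℝ) : ℝ := if t ≤ |x| then 1 else 0

/-- Normalized sum of a function over the entries of a signal. -/
def emp {n : ℕ} (k : ℝ) (f : ℝ → ℝ) (X : Fin n → ℝ) : ℝ := (∑ i, f (X i)) / k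

/-- Potential of a signal of power `S` whose known part has power `q` and normalized size `N`. -/
def potential (Δ : ℝ) {kA : ℕ} (PA : Measure (Fin kA → ℝ)) (φ : ℝ → (Fin kA → ℝ) → ℝ)
    (τ γ q S N : ℝ) : ℝ :=
  Iinfo Δ PA φ q (S - q) + τ * (S - q) / 2 + N / γ

section Threshold

variable {Δ : ℝ} {kA : ℕ} {PA : Measure (Fin kA → ℝ)} [IsProbabilityMeasure PA]
  {φ : ℝ → (Fin kA → ℝ) → ℝ} {B : ℝ} {n m : ℕ} {k s : ℝ}

lemma nsq_sub_restr (k : ℝ) (A : Finset (Fin n)) (X : Fin n → ℝ) :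
    nsq k (X - restr A X) = nsq k X - nsq k (restr A X) := by
  unfold nsq
  rw [← sub_div, ← Finset.sum_sub_distrib]
  congr 1
  refine Finset.sum_congr rfl fun i _ => ?_
  simp only [Pi.sub_apply, restr]
  split_ifs <;> ring

lemma sum_sq_restr_le {t : ℝ} {t' : ℝ} (ht : 0 ≤ t) (htt : t ≤ t') {X : Fin n → ℝ}
    (hgap : ∀ i, |X i| < t' → |X i| ≤ t) (A : Finset (Fin n)) :
    (∑ i, restr A X i ^ 2) - ∑ i, bigSq t' (X i)
      ≤ t ^ 2 * ((A.card : ℝ) - ∑ i, bigInd t' (X i)) := by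
  have hA : (A.card : ℝ) = ∑ i, if i ∈ A then 1 else 0 := by simp
  rw [hA, ← Finset.sum_sub_distrib, ← Finset.sum_sub_distrib, Finset.mul_sum]
  refine Finset.sum_le_sum fun i _ => ?_
  have e := sq_abs (X i)
  have h0 := abs_nonneg (X i)
  unfold restr bigSq bigInd
  split_ifs with h1 h2 h2
  · simp
  · have := hgap i (not_le.1 h2)
    nlinarith
  · nlinarith
  · simp

lemma RegularChannel.exists_threshold_le (h : RegularChannel Δ φ B) (hk : 0 < k) {γ τ : ℝ}
    (hγ : 0 < γ) {K : ℕ} (hK : 0 < K) {t : ℕ → ℝ} (ht : ∀ j, 0 < t j) (hmono : Monotone t)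
    {X : Fin n → ℝ} (h0 : ∀ i, X i ≠ 0 → t 0 ≤ |X i|) (hK' : ∀ i, |X i| < t K)
    (hgap : ∀ j < K, ∀ i, |X i| < t (j + 1) → |X i| ≤ t j) (A : Finset (Fin n)) :
    ∃ j ≤ K, potential Δ PA φ τ γ (emp k (bigSq (t j)) X) (nsq k X) (emp k (bigInd (t j)) X)
      ≤ potential Δ PA φ τ γ (nsq k (restr A X)) (nsq k X) (A.card / k) := by
  have hq0 : emp k (bigSq (t 0)) X = nsq k X := by
    unfold emp nsq
    congr 1
    refine Finset.sum_congr rfl fun i _ => ?_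
    unfold bigSq
    split_ifs with hi
    · rfl
    · rw [not_imp_comm.1 (h0 i) hi]; simp
  have hqK : emp k (bigSq (t K)) X = 0 := by
    unfold emp
    rw [Finset.sum_eq_zero, zero_div]
    intro i _
    simp [bigSq, not_le.2 (hK' i)]
  have hqA : nsq k (restr A X) ≤ nsq k X := by
    unfold nsq
    refine div_le_div_of_nonneg_right (Finset.sum_le_sum fun i _ => ?_) hk.le
    unfold restr
    split_ifs
    · exact le_rfl
    · simpa using sq_nonneg _
  have hex : ∃ j, j < K ∧ emp k (bigSq (t (j + 1))) X ≤ nsq k (restr A X) := by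
    refine ⟨K - 1, by omega, ?_⟩
    rw [Nat.sub_add_cancel hK, hqK]
    exact nsq_nonneg hk.le _
  classical
  obtain ⟨hjK, hlo⟩ := Nat.find_spec hex
  have hhi : nsq k (restr A X) ≤ emp k (bigSq (t (Nat.find hex))) X := by
    rcases Nat.eq_zero_or_pos (Nat.find hex) with hz | hz
    · rw [hz, hq0]; exact hqA
    · have := Nat.find_min hex (Nat.sub_lt hz one_pos)
      rw [Nat.sub_add_cancel (show 1 ≤ Nat.find hex from hz)] at this
      by_contra hc
      exact this ⟨by omega, (not_le.1 hc).le⟩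
  obtain ⟨j, hj⟩ : ∃ j, j = Nat.find hex := ⟨_, rfl⟩
  rw [← hj] at hjK hlo hhi
  have htj := ht j
  have htt : t j ≤ t (j + 1) := hmono (Nat.le_succ j)
  have hcard := sum_sq_restr_le htj.le htt (hgap j hjK) A
  have heq : (∑ i, bigSq (t j) (X i)) - ∑ i, bigSq (t (j + 1)) (X i)
      = t j ^ 2 * ((∑ i, bigInd (t j) (X i)) - ∑ i, bigInd (t (j + 1)) (X i)) := by
    rw [← Finset.sum_sub_distrib, ← Finset.sum_sub_distrib, Finset.mul_sum]
    refine Finset.sum_congr rfl fun i _ => ?_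
    unfold bigSq bigInd
    split_ifs with h1 h2 h2
    · simp
    · have h3 := le_antisymm (hgap j hjK i (not_le.1 h2)) h1
      rw [← sq_abs (X i), h3]; ring
    · exact absurd (htt.trans h2) h1
    · simp
  have hhi' : emp k (bigSq (t j)) X ≤ nsq k X := by
    rw [← hq0]
    unfold emp
    refine div_le_div_of_nonneg_right (Finset.sum_le_sum fun i _ => ?_) hk.le
    have := hmono (Nat.zero_le j)
    unfold bigSq
    split_ifs with h1 h2 h2
    · exact le_rfl
    · exact absurd (this.trans h1) h2
    · positivity
    · exact le_rfl
  have hlo0 : 0 ≤ emp k (bigSq (t (j + 1))) X := by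
    unfold emp
    refine div_nonneg (Finset.sum_nonneg fun i _ => ?_) hk.le
    unfold bigSq; split_ifs <;> positivity
  have key := h.min_Iinfo_le (PA := PA) (S := nsq k X) (a := -τ / 2 + 1 / (γ * t j ^ 2))
    (b := τ * nsq k X / 2 + emp k (bigInd (t (j + 1))) X / γ
      - emp k (bigSq (t (j + 1))) X / (γ * t j ^ 2)) hlo0 hhi' ⟨hlo, hhi⟩
  have e1 : emp k (bigInd (t j)) X / γ = emp k (bigInd (t (j + 1))) X / γ
      + (emp k (bigSq (t j)) X - emp k (bigSq (t (j + 1))) X) / (γ * t j ^ 2) := by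
    unfold emp
    rw [← sub_div, heq]
    field_simp
    ring
  have e2 : emp k (bigInd (t (j + 1))) X / γ
      + (nsq k (restr A X) - emp k (bigSq (t (j + 1))) X) / (γ * t j ^ 2) ≤ A.card / k / γ := by
    unfold emp nsq
    rw [← sub_div]
    have : ((∑ i, restr A X i ^ 2) - ∑ i, bigSq (t (j + 1)) (X i)) / k / (γ * t j ^ 2)
        ≤ t j ^ 2 * ((A.card : ℝ) - ∑ i, bigInd (t (j + 1)) (X i)) / k / (γ * t j ^ 2) := by
      gcongr
    refine (add_le_add_right this _).trans (le_of_eq ?_)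
    field_simp
    ring
  unfold potential
  rcases min_le_iff.1 key with hm | hm
  · refine ⟨j + 1, hjK, ?_⟩
    have e3 : (nsq k (restr A X) - emp k (bigSq (t (j + 1))) X) / (γ * t j ^ 2)
      = 1 / (γ * t j ^ 2) * nsq k (restr A X)
        - 1 / (γ * t j ^ 2) * emp k (bigSq (t (j + 1))) X := by ring
    have e4 : emp k (bigSq (t (j + 1))) X / (γ * t j ^ 2)
      = 1 / (γ * t j ^ 2) * emp k (bigSq (t (j + 1))) X := by ring
    rw [e3] at e2
    rw [e4] at hm
    linarith
  · refine ⟨j, hjK.le, ?_⟩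
    have e3 : (nsq k (restr A X) - emp k (bigSq (t (j + 1))) X) / (γ * t j ^ 2)
      = 1 / (γ * t j ^ 2) * nsq k (restr A X)
        - 1 / (γ * t j ^ 2) * emp k (bigSq (t (j + 1))) X := by ring
    have e4 : emp k (bigSq (t (j + 1))) X / (γ * t j ^ 2)
      = 1 / (γ * t j ^ 2) * emp k (bigSq (t (j + 1))) X := by ring
    have e5 : (emp k (bigSq (t j)) X - emp k (bigSq (t (j + 1))) X) / (γ * t j ^ 2)
      = 1 / (γ * t j ^ 2) * emp k (bigSq (t j)) X
        - 1 / (γ * t j ^ 2) * emp k (bigSq (t (j + 1))) X := by ring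
    rw [e3] at e2
    rw [e5] at e1
    rw [e4] at hm
    linarith

/-- Lower bound on the information density in terms of the empirical potentials. -/
lemma RegularChannel.le_integral_log_of_potential (h : RegularChannel Δ φ B) (hk : 0 < k)
    {γ τ L : ℝ} (hγ : 0 < γ) (hτ : 0 ≤ τ) (hL0 : 0 ≤ L) (hs : s = γ * τ * L)
    (hm : (m : ℝ) = γ * k * L)
    {K : ℕ} (hK : 0 < K) {t : ℕ → ℝ} (ht : ∀ j, 0 < t j) (hmono : Monotone t)
    {θ : ℝ} (hθ : 0 < θ) (hθ1 : θ ≤ 1) {T : Finset ℝ} {w : ℝ → ℝ} (hw : ∀ t, 0 ≤ w t)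
    (h1 : ∑ t ∈ T, w t = 1) (hL : ∑ t ∈ T.filter (· ≠ 0), w t ≤ Real.exp (-L))
    {X : Fin n → ℝ} (hX : X ∈ grid n T)
    (h0 : ∀ i, X i ≠ 0 → t 0 ≤ |X i|) (hK' : ∀ i, |X i| < t K)
    (hgap : ∀ j < K, ∀ i, |X i| < t (j + 1) → |X i| ≤ t j) {Ψ : ℝ}
    (hΨ : ∀ j ≤ K, Ψ ≤ potential Δ PA φ τ γ (emp k (bigSq (t j)) X) (nsq k X)
      (emp k (bigInd (t j)) X)) :
    m * (Ψ - θ * (mgfConst Δ B + τ * nsq k X / 2)) - (1 + 1 / θ) * ((supp X).card * Real.log 2)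
      ≤ ∫ ω, Real.log (lik Δ PA φ k s X X ω / margLik Δ PA φ T w k s X ω) ∂(dataLaw n m PA) := by
  have hs0 : 0 ≤ s := by rw [hs]; positivity
  refine h.le_integral_log_lik_div hk.le hs0 hθ hθ1 hw h1 hL hX fun A _ => ?_
  obtain ⟨j, hj, hle⟩ := h.exists_threshold_le (PA := PA) hk hγ (τ := τ) hK ht hmono h0 hK' hgap A
  have h2 := (hΨ j hj).trans hle
  unfold rate
  unfold potential at h2
  rw [nsq_sub_restr]
  have e1 : ∑ i, (X i - restr A X i) ^ 2 = k * (nsq k X - nsq k (restr A X)) := by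
    rw [← nsq_sub_restr, nsq, mul_div_cancel₀ _ hk.ne']; rfl
  rw [e1]
  have e2 : (1 - θ) * (s * (k * (nsq k X - nsq k (restr A X)))) / 2
      = m * ((1 - θ) * (τ * (nsq k X - nsq k (restr A X)) / 2)) := by
    rw [hm, hs]; ring
  have e3 : (A.card : ℝ) * L = m * (A.card / k / γ) := by
    rw [hm]; field_simp
  rw [e2, e3, ← mul_add, ← mul_add]
  refine mul_le_mul_of_nonneg_left ?_ (Nat.cast_nonneg m)
  have h3 := nsq_nonneg hk.le (restr A X)
  have h4 : 0 ≤ θ * (τ * nsq k (restr A X)) := by positivity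
  have e4 : θ * (mgfConst Δ B + τ * nsq k X / 2) = θ * mgfConst Δ B
    + θ * (τ * nsq k X) / 2 := by ring
  rw [e4]
  have e5 : (1 - θ) * (τ * (nsq k X - nsq k (restr A X)) / 2)
      = τ * (nsq k X - nsq k (restr A X)) / 2 - θ * (τ * nsq k X) / 2
        + θ * (τ * nsq k (restr A X)) / 2 := by ring
  rw [e5]
  linarith

end Threshold

lemma lintegral_pi_prod {E : Type*} [MeasurableSpace E] {n : ℕ} (μ : Measure E)
    [SigmaFinite μ] {f : Fin n → E → ENNReal} (hf : ∀ i, Measurable (f i)) :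
    ∫⁻ x, ∏ i, f i (x i) ∂(Measure.pi fun _ : Fin n => μ) = ∏ i, ∫⁻ e, f i e ∂μ := by
  induction n with
  | zero => simp
  | succ n ih =>
    have hp := (measurePreserving_piFinSuccAbove (fun _ : Fin (n + 1) => μ) 0).symm
    have e := hp.lintegral_comp (f := fun x => ∏ i, f i (x i))
      (Finset.measurable_prod _ fun i _ => (hf i).comp (measurable_pi_apply i))
    refine e.symm.trans ?_
    simp_rw [Fin.prod_univ_succ]
    rw [← ih (f := fun i => f i.succ) fun i => hf i.succ]
    exact lintegral_prod_mul (hf 0).aemeasurable (Finset.measurable_prod _ fun i _ =>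
      (hf (Fin.succ i)).comp (measurable_pi_apply i)).aemeasurable

lemma pi_withDensity {E : Type*} [MeasurableSpace E] {n : ℕ} (μ : Measure E)
    [SigmaFinite μ] {f : Fin n → E → ENNReal} (hf : ∀ i, Measurable (f i))
    [∀ i, SigmaFinite (μ.withDensity (f i))] :
    Measure.pi (fun i => μ.withDensity (f i))
      = (Measure.pi fun _ : Fin n => μ).withDensity fun x => ∏ i, f i (x i) := by
  refine Measure.pi_eq fun S hS => ?_
  rw [withDensity_apply _ (MeasurableSet.univ_pi hS), ← lintegral_indicator (.univ_pi hS)]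
  simp_rw [withDensity_apply _ (hS _), ← lintegral_indicator (hS _)]
  rw [← lintegral_pi_prod μ fun i => (hf i).indicator (hS i)]
  refine lintegral_congr fun x => ?_
  by_cases hx : x ∈ Set.univ.pi S
  · rw [Set.indicator_of_mem hx]
    exact Finset.prod_congr rfl fun i _ =>
      (Set.indicator_of_mem (hx i (Set.mem_univ i)) _).symm
  · rw [Set.indicator_of_notMem hx]
    obtain ⟨i, hi⟩ : ∃ i, x i ∉ S i := by simpa using hx
    exact (Finset.prod_eq_zero (Finset.mem_univ i) (Set.indicator_of_notMem hi _)).symm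

lemma lintegral_sideDens_sub (a : ℝ) : ∫⁻ y, ENNReal.ofReal (sideDens (y - a)) = 1 := by
  have := lintegral_stdG_affine one_pos a (F := fun _ => 1) measurable_const
  simpa [stdG, sideDens] using this.symm

lemma map_add_stdG (a : ℝ) :
    stdG.map (fun z => a + z) = volume.withDensity fun y => ENNReal.ofReal (sideDens (y - a)) := by
  refine Measure.ext_of_lintegral _ fun F hF => ?_
  rw [lintegral_map hF (by fun_prop),
    lintegral_withDensity_eq_lintegral_mul _ (by fun_prop) hF]
  have := lintegral_stdG_affine one_pos a hF
  simpa [stdG, sideDens, mul_comm] using this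

/-- Reference measure for the matrix and the observations. -/
def refLaw (n m : ℕ) : Measure ((Fin m → (Fin n → ℝ) × ℝ) × (Fin n → ℝ)) :=
  (Measure.pi fun _ : Fin m => (iid n stdG).prod volume).prod (Measure.pi fun _ => volume)

/-- The matrix and the observations generated by `X`. -/
def obs (Δ : ℝ) {kA : ℕ} (φ : ℝ → (Fin kA → ℝ) → ℝ) {n m : ℕ} (k s : ℝ) (X : Fin n → ℝ)
    (ω : (Fin m → (Fin n → ℝ) × ((Fin kA → ℝ) × ℝ)) × (Fin n → ℝ)) :
    (Fin m → (Fin n → ℝ) × ℝ) × (Fin n → ℝ) :=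
  (fun μ => ((ω.1 μ).1, out Δ φ (dotp k X (ω.1 μ).1) (ω.1 μ).2), fun i => Real.sqrt s * X i + ω.2 i)

/-- Density of independent observations with main channel density `f` and side signal `u`. -/
def obsDens {n m : ℕ} (s : ℝ) (f : (Fin n → ℝ) × ℝ → ℝ) (u : Fin n → ℝ)
    (o : (Fin m → (Fin n → ℝ) × ℝ) × (Fin n → ℝ)) : ℝ :=
  (∏ μ, f (o.1 μ)) * ∏ i, sideDens (o.2 i - Real.sqrt s * u i)

section Density

variable {Δ : ℝ} {kA : ℕ} {PA : Measure (Fin kA → ℝ)} [IsProbabilityMeasure PA]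
  {φ : ℝ → (Fin kA → ℝ) → ℝ} {B : ℝ} {n m : ℕ} {k s : ℝ}

lemma obsDens_nonneg {f : (Fin n → ℝ) × ℝ → ℝ} (hf : ∀ r, 0 ≤ f r) (u : Fin n → ℝ)
    (o : (Fin m → (Fin n → ℝ) × ℝ) × (Fin n → ℝ)) : 0 ≤ obsDens s f u o :=
  mul_nonneg (Finset.prod_nonneg fun _ _ => hf _) (Finset.prod_nonneg fun _ _ => (sideDens_pos _).le)

lemma measurable_obsDens {f : (Fin n → ℝ) × ℝ → ℝ} (hf : Measurable f) (u : Fin n → ℝ) :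
    Measurable (obsDens (m := m) s f u) := by
  unfold obsDens
  exact (Finset.measurable_prod _ fun μ _ => hf.comp (by fun_prop)).mul
    (Finset.measurable_prod _ fun i _ => by fun_prop)

lemma prod_withDensity_eq_obsDens {f : (Fin n → ℝ) × ℝ → ℝ} (hf : Measurable f)
    (h0 : ∀ r, 0 ≤ f r)
    (h1 : ∀ Φ, ∫⁻ y, ENNReal.ofReal (f (Φ, y)) = 1) (u : Fin n → ℝ) :
    (Measure.pi fun _ : Fin m => ((iid n stdG).prod volume).withDensity
        fun r => ENNReal.ofReal (f r)).prod
      (Measure.pi fun i : Fin n => volume.withDensity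
        fun y => ENNReal.ofReal (sideDens (y - Real.sqrt s * u i)))
      = (refLaw n m).withDensity (fun o => ENNReal.ofReal (obsDens s f u o)) ∧
    ∫⁻ o, ENNReal.ofReal (obsDens s f u o) ∂(refLaw n m) = 1 := by
  have p1 : IsProbabilityMeasure (((iid n stdG).prod volume).withDensity
      fun r => ENNReal.ofReal (f r)) := by
    constructor
    rw [withDensity_apply _ .univ, Measure.restrict_univ, lintegral_prod _ (by fun_prop)]
    simp [h1]
  have p2 (i : Fin n) : IsProbabilityMeasure ((volume : Measure ℝ).withDensity
      fun y => ENNReal.ofReal (sideDens (y - Real.sqrt s * u i))) := by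
    constructor
    rw [withDensity_apply _ .univ, Measure.restrict_univ, lintegral_sideDens_sub]
  have e : (Measure.pi fun _ : Fin m => ((iid n stdG).prod volume).withDensity
        fun r => ENNReal.ofReal (f r)).prod
      (Measure.pi fun i : Fin n => volume.withDensity
        fun y => ENNReal.ofReal (sideDens (y - Real.sqrt s * u i)))
      = (refLaw n m).withDensity fun o => ENNReal.ofReal (obsDens s f u o) := by
    rw [pi_withDensity _ (fun i => by fun_prop), pi_withDensity _ (fun _ => by fun_prop),
      prod_withDensity (Finset.measurable_prod _ fun i _ => by fun_prop)
        (Finset.measurable_prod _ fun i _ => by fun_prop)]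
    · refine congrArg (refLaw n m).withDensity (funext fun o => ?_)
      rw [obsDens, ENNReal.ofReal_mul (Finset.prod_nonneg fun _ _ => h0 _),
        ENNReal.ofReal_prod_of_nonneg fun _ _ => h0 _,
        ENNReal.ofReal_prod_of_nonneg fun _ _ => (sideDens_pos _).le]
  refine ⟨e, ?_⟩
  have h2 := congrArg (fun ν => ν Set.univ) e
  simp only [withDensity_apply _ MeasurableSet.univ, Measure.restrict_univ, measure_univ] at h2
  exact h2.symm

lemma RegularChannel.measurable_obs (h : RegularChannel Δ φ B) (X : Fin n → ℝ) :
    Measurable (obs (m := m) Δ φ k s X) := by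
  unfold obs
  refine Measurable.prodMk (measurable_pi_lambda _ fun μ => Measurable.prodMk (by fun_prop) ?_)
    (by fun_prop)
  exact h.measurable_out ((measurable_dotp k X).comp (by fun_prop)) (by fun_prop)

lemma RegularChannel.map_obs (h : RegularChannel Δ φ B) (X : Fin n → ℝ) :
    (dataLaw n m PA).map (obs Δ φ k s X) = (refLaw n m).withDensity fun o =>
      ENNReal.ofReal (obsDens s (fun r => Pout Δ PA φ r.2 (dotp k X r.1)) X o) := by
  have hd : Measurable fun r : (Fin n → ℝ) × ℝ => dotp k X r.1 :=
    (measurable_dotp k X).comp measurable_fst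
  rw [← (prod_withDensity_eq_obsDens (h.measurable_Pout_comp (PA := PA) measurable_snd hd)
    (fun r => (h.Pout_pos _ _).le) (fun Φ => h.lintegral_Pout (dotp k X Φ)) X).1]
  have hrow : Measurable fun r : (Fin n → ℝ) × ((Fin kA → ℝ) × ℝ) =>
      (r.1, out Δ φ (dotp k X r.1) r.2) :=
    measurable_fst.prodMk (h.measurable_out ((measurable_dotp k X).comp measurable_fst)
      measurable_snd)
  have e1 : (rowLaw n PA).map (fun r => (r.1, out Δ φ (dotp k X r.1) r.2))
      = ((iid n stdG).prod volume).withDensity fun r =>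
        ENNReal.ofReal (Pout Δ PA φ r.2 (dotp k X r.1)) := by
    refine Measure.ext_of_lintegral _ fun F hF => ?_
    have hP : Measurable fun r : (Fin n → ℝ) × ℝ =>
      ENNReal.ofReal (Pout Δ PA φ r.2 (dotp k X r.1)) :=
      (h.measurable_Pout_comp measurable_snd hd).ennreal_ofReal
    rw [lintegral_map hF hrow, lintegral_withDensity_eq_lintegral_mul _ hP hF,
      rowLaw]
    refine (lintegral_prod _ (hF.comp hrow).aemeasurable).trans ?_
    rw [lintegral_prod _ (hP.mul hF).aemeasurable]
    refine lintegral_congr fun Φ => ?_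
    refine (h.lintegral_out (PA := PA) (dotp k X Φ) (F := fun y => F (Φ, y))
      (hF.comp measurable_prodMk_left)).trans (lintegral_congr fun y => ?_)
    exact mul_comm _ _
  have := Measure.isProbabilityMeasure_map (μ := rowLaw n PA) hrow.aemeasurable
  have p2 (i : Fin n) : IsProbabilityMeasure (stdG.map fun z => Real.sqrt s * X i + z) :=
    Measure.isProbabilityMeasure_map (by fun_prop)
  simp_rw [← e1, ← map_add_stdG]
  rw [← Measure.pi_map_pi fun _ => hrow.aemeasurable,
    ← Measure.pi_map_pi (μ := fun _ : Fin n => stdG) fun i => by fun_prop]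
  exact (Measure.map_prod_map _ _ (measurable_pi_lambda _ fun μ =>
    hrow.comp (measurable_pi_apply μ))
    (show Measurable fun (z : Fin n → ℝ) i => Real.sqrt s * X i + z i by fun_prop)).symm

end Density

/-- Total weight of the fiber of `β` above `b`. -/
def fiberWt (T : Finset ℝ) (w β : ℝ → ℝ) (b : ℝ) : ℝ := ∑ a ∈ T with β a = b, w a

section Upper

variable {Δ : ℝ} {kA : ℕ} {PA : Measure (Fin kA → ℝ)} [IsProbabilityMeasure PA]
  {φ : ℝ → (Fin kA → ℝ) → ℝ} {B : ℝ} {n m : ℕ} {k s : ℝ}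

lemma fiberWt_nonneg {T : Finset ℝ} {w : ℝ → ℝ} (hw : ∀ t, 0 ≤ w t) (β : ℝ → ℝ) (b : ℝ) :
    0 ≤ fiberWt T w β b := Finset.sum_nonneg fun _ _ => hw _

lemma le_fiberWt {T : Finset ℝ} {w : ℝ → ℝ} (hw : ∀ t, 0 ≤ w t) (β : ℝ → ℝ) {a : ℝ} (ha : a ∈ T) :
    w a ≤ fiberWt T w β (β a) :=
  Finset.single_le_sum (f := w) (fun _ _ => hw _) (by simp [ha])

/-- Averaged density of the observations over a discrete class of signals is dominated by the
densities of the class representatives. -/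
lemma sum_fiber_le {ι κ : Type*} [DecidableEq κ] (S : Finset ι) (S' : Finset κ) (b : ι → κ)
    (hb : ∀ x ∈ S, b x ∈ S') {p : ι → ℝ} (hp : ∀ x, 0 ≤ p x) {G : κ → ℝ} (hG : ∀ y, 0 ≤ G y) :
    ∑ x ∈ S, p x * (G (b x) / ∑ x ∈ S, p x) ≤ ∑ y ∈ S', G y := by
  rw [← Finset.sum_fiberwise_of_maps_to hb]
  refine Finset.sum_le_sum fun y _ => ?_
  have e : ∑ x ∈ S with b x = y, p x * (G (b x) / ∑ x ∈ S, p x)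
      = G y * ((∑ x ∈ S with b x = y, p x) / ∑ x ∈ S, p x) := by
    rw [Finset.sum_div, Finset.mul_sum]
    refine Finset.sum_congr rfl fun x hx => ?_
    rw [(Finset.mem_filter.1 hx).2]; ring
  rw [e]
  refine mul_le_of_le_one_right (hG y) (div_le_one_of_le₀ ?_ (Finset.sum_nonneg fun _ _ => hp _))
  exact Finset.sum_le_sum_of_subset_of_nonneg (Finset.filter_subset _ _) fun _ _ _ => hp _

/-- Bayesian averaging over a discrete class of models: ratios to the mixture density integrate to
at most one. -/
lemma sum_lintegral_div_mixture_le {ι κ E O : Type*} [DecidableEq κ] [MeasurableSpace E]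
    [MeasurableSpace O] {μ : Measure E} {ν : Measure O} (S : Finset ι) (S' : Finset κ) (b : ι → κ)
    (hb : ∀ x ∈ S, b x ∈ S') {p : ι → ℝ} (hp : ∀ x, 0 ≤ p x) {obs : ι → E → O}
    (hobs : ∀ x, Measurable (obs x)) {ℓ : ι → O → ℝ} (hℓ : ∀ x, Measurable (ℓ x))
    (hℓ0 : ∀ x o, 0 ≤ ℓ x o)
    (hmap : ∀ x, μ.map (obs x) = ν.withDensity fun o => ENNReal.ofReal (ℓ x o))
    {G : κ → O → ℝ} (hG : ∀ y, Measurable (G y)) (hG0 : ∀ y o, 0 ≤ G y o)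
    (hG1 : ∑ y ∈ S', ∫⁻ o, ENNReal.ofReal (G y o) ∂ν ≤ 1) :
    ∑ x ∈ S, ENNReal.ofReal (p x) * ∫⁻ ω, ENNReal.ofReal
      (G (b x) (obs x ω) / ∑ x' ∈ S, p x' * ℓ x' (obs x ω)) ∂μ ≤ 1 := by
  have hH x : Measurable fun o => ENNReal.ofReal (G (b x) o / ∑ x' ∈ S, p x' * ℓ x' o) :=
    ((hG _).div (Finset.measurable_sum _ fun x _ => (hℓ x).const_mul _)).ennreal_ofReal
  have e (x : ι) : ∫⁻ ω, ENNReal.ofReal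
      (G (b x) (obs x ω) / ∑ x' ∈ S, p x' * ℓ x' (obs x ω)) ∂μ
      = ∫⁻ o, ENNReal.ofReal (ℓ x o) * ENNReal.ofReal (G (b x) o / ∑ x' ∈ S, p x' * ℓ x' o) ∂ν := by
    have e1 := lintegral_map (μ := μ) (hH x) (hobs x)
    rw [hmap x, lintegral_withDensity_eq_lintegral_mul _ (hℓ x).ennreal_ofReal (hH x)] at e1
    exact e1.symm
  simp_rw [e]
  have e2 : ∑ x ∈ S, ENNReal.ofReal (p x) * ∫⁻ o, ENNReal.ofReal (ℓ x o)
        * ENNReal.ofReal (G (b x) o / ∑ x' ∈ S, p x' * ℓ x' o) ∂ν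
      = ∫⁻ o, ∑ x ∈ S, ENNReal.ofReal (p x) * (ENNReal.ofReal (ℓ x o)
        * ENNReal.ofReal (G (b x) o / ∑ x' ∈ S, p x' * ℓ x' o)) ∂ν := by
    rw [lintegral_finsetSum]
    · exact Finset.sum_congr rfl fun x _ => (lintegral_const_mul _
        ((hℓ x).ennreal_ofReal.mul (hH _))).symm
    · exact fun x _ => ((hℓ x).ennreal_ofReal.mul (hH _)).const_mul _
  rw [e2]
  have hle o : ∑ x ∈ S, ENNReal.ofReal (p x) * (ENNReal.ofReal (ℓ x o)
        * ENNReal.ofReal (G (b x) o / ∑ x' ∈ S, p x' * ℓ x' o))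
      ≤ ∑ y ∈ S', ENNReal.ofReal (G y o) := by
    have h0 x : 0 ≤ p x * ℓ x o := mul_nonneg (hp x) (hℓ0 x o)
    have h2 := ENNReal.ofReal_le_ofReal (sum_fiber_le S S' b hb h0 (G := fun y => G y o)
      fun y => hG0 y o)
    rw [ENNReal.ofReal_sum_of_nonneg fun x _ => mul_nonneg (h0 x) (div_nonneg (hG0 _ _)
      (Finset.sum_nonneg fun x _ => h0 x)), ENNReal.ofReal_sum_of_nonneg fun y _ => hG0 y o] at h2
    refine (Finset.sum_congr rfl fun x _ => ?_).trans_le h2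
    rw [← ENNReal.ofReal_mul (hℓ0 x o), ← ENNReal.ofReal_mul (hp x), mul_assoc]
  refine (lintegral_mono hle).trans ?_
  rwa [lintegral_finsetSum _ fun y _ => (hG y).ennreal_ofReal]

lemma RegularChannel.sum_wt_lintegral_le (h : RegularChannel Δ φ B) {T : Finset ℝ} {w : ℝ → ℝ}
    (hw : ∀ t, 0 ≤ w t) (h1 : ∑ t ∈ T, w t = 1) (β : ℝ → ℝ) (c : ℝ) :
    ∑ X ∈ grid n T, ENNReal.ofReal (wt w X) * ∫⁻ ω, ENNReal.ofReal
      (wt (fiberWt T w β) (fun i => β (X i)) * baseLik Δ PA φ k s c X (fun i => β (X i)) ω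
        / margLik Δ PA φ T w k s X ω) ∂(dataLaw n m PA) ≤ 1 := by
  have hd (x : Fin n → ℝ) : Measurable fun r : (Fin n → ℝ) × ℝ => dotp k x r.1 :=
    (measurable_dotp k x).comp measurable_fst
  have hma (x : Fin n → ℝ) : Measurable fun r : (Fin n → ℝ) × ℝ =>
      avgPout Δ PA φ r.2 (dotp k x r.1) c :=
    h.measurable_avgPout measurable_snd (hd x) measurable_const
  have hW0 (b : Fin n → ℝ) : 0 ≤ wt (fiberWt T w β) b := wt_nonneg (fiberWt_nonneg hw β) b
  refine sum_lintegral_div_mixture_le (grid n T) (grid n (T.image β)) (fun X i => β (X i))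
    (fun X hX => Fintype.mem_piFinset.2 fun i => Finset.mem_image_of_mem β
      (Fintype.mem_piFinset.1 hX i)) (p := wt w) (wt_nonneg hw)
    (obs := obs (m := m) Δ φ k s) h.measurable_obs
    (ℓ := fun x => obsDens s (fun r => Pout Δ PA φ r.2 (dotp k x r.1)) x)
    (fun x => measurable_obsDens (h.measurable_Pout_comp measurable_snd (hd x)) x)
    (fun x o => obsDens_nonneg (fun r => (h.Pout_pos _ _).le) x o) h.map_obs
    (G := fun x o => wt (fiberWt T w β) x
      * obsDens s (fun r => avgPout Δ PA φ r.2 (dotp k x r.1) c) x o)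
    (fun x => (measurable_obsDens (hma x) x).const_mul _)
    (fun x o => mul_nonneg (hW0 x) (obsDens_nonneg (fun r => (h.avgPout_pos _ _ _).le) x o)) ?_
  have hone (x : Fin n → ℝ) : ∫⁻ o, ENNReal.ofReal (wt (fiberWt T w β) x
      * obsDens s (fun r => avgPout Δ PA φ r.2 (dotp k x r.1) c) x o) ∂(refLaw n m)
      = ENNReal.ofReal (wt (fiberWt T w β) x) := by
    simp_rw [ENNReal.ofReal_mul (hW0 x)]
    rw [lintegral_const_mul _ (measurable_obsDens (hma x) x).ennreal_ofReal,
      (prod_withDensity_eq_obsDens (hma x) (fun r => (h.avgPout_pos r.2 (dotp k x r.1) c).le)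
        (fun Φ => h.lintegral_avgPout (dotp k x Φ) c) x).2, mul_one]
  rw [Finset.sum_congr rfl fun x _ => hone x, ← ENNReal.ofReal_sum_of_nonneg fun x _ => hW0 x,
    sum_wt]
  · simp
  · exact (Finset.sum_fiberwise_of_maps_to (fun a ha => Finset.mem_image_of_mem β ha) w).trans h1

lemma RegularChannel.log_lik_div_base (h : RegularChannel Δ φ B) (X u : Fin n → ℝ) (c : ℝ)
    (ω : (Fin m → (Fin n → ℝ) × ((Fin kA → ℝ) × ℝ)) × (Fin n → ℝ)) :
    Real.log (lik Δ PA φ k s X X ω / baseLik Δ PA φ k s c X u ω) =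
      (∑ μ, llr Δ PA φ (dotp k X (ω.1 μ).1) (dotp k u (ω.1 μ).1) c (ω.1 μ).2)
      + ∑ i, ((Real.sqrt s * (X i - u i)) ^ 2 / 2 + Real.sqrt s * (X i - u i) * ω.2 i) := by
  rw [Real.log_div (h.lik_pos _ _ _).ne' (h.baseLik_pos _ _ _ _).ne', lik, baseLik,
    Real.log_mul, Real.log_mul, Real.log_prod, Real.log_prod, Real.log_prod, Real.log_prod]
  · have e (a b c d : ℝ) : a + b - (c + d) = (a - c) + (b - d) := by ring
    rw [e, ← Finset.sum_sub_distrib, ← Finset.sum_sub_distrib]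
    congr 1
    refine Finset.sum_congr rfl fun i _ => ?_
    rw [log_sideDens, log_sideDens]; ring
  all_goals first
    | exact fun _ _ => (sideDens_pos _).ne'
    | exact fun _ _ => (h.Pout_pos _ _).ne'
    | exact fun _ _ => (h.avgPout_pos _ _ _).ne'
    | exact (Finset.prod_pos fun _ _ => sideDens_pos _).ne'
    | exact (Finset.prod_pos fun _ _ => h.Pout_pos _ _).ne'
    | exact (Finset.prod_pos fun _ _ => h.avgPout_pos _ _ _).ne'

lemma integral_affine_stdG (a b : ℝ) : Integrable (fun z : ℝ => a + b * z) stdG ∧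
    ∫ z, (a + b * z) ∂stdG = a := by
  have h1 : Integrable (fun z : ℝ => z) stdG := by
    unfold stdG
    exact (memLp_id_gaussianReal' 1 (by simp)).integrable (by simp)
  refine ⟨(integrable_const _).add (h1.const_mul _), ?_⟩
  rw [integral_add (integrable_const _) (h1.const_mul _), integral_const_mul]
  have e0 : ∫ z, z ∂stdG = 0 := by unfold stdG; exact integral_id_gaussianReal
  rw [e0]; simp

lemma integral_dataLaw_sum {f : (Fin n → ℝ) × ((Fin kA → ℝ) × ℝ) → ℝ} {g : Fin n → ℝ → ℝ}
    (hf : Integrable f (rowLaw n PA)) (hg : ∀ i, Integrable (g i) stdG) :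
    Integrable (fun ω => (∑ μ, f (ω.1 μ)) + ∑ i, g i (ω.2 i)) (dataLaw n m PA) ∧
      ∫ ω, ((∑ μ, f (ω.1 μ)) + ∑ i, g i (ω.2 i)) ∂(dataLaw n m PA)
        = m * (∫ r, f r ∂(rowLaw n PA)) + ∑ i, ∫ z, g i z ∂stdG := by
  have j1 (μ : Fin m) : Integrable (fun r : Fin m → (Fin n → ℝ) × ((Fin kA → ℝ) × ℝ) => f (r μ))
      (Measure.pi fun _ : Fin m => rowLaw n PA) :=
    integrable_comp_eval (μ := fun _ : Fin m => rowLaw n PA) (i := μ) hf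
  have j2 (i : Fin n) : Integrable (fun z : Fin n → ℝ => g i (z i)) (iid n stdG) :=
    integrable_comp_eval (μ := fun _ : Fin n => stdG) (i := i) (hg i)
  have i1 : Integrable (fun r : Fin m → (Fin n → ℝ) × ((Fin kA → ℝ) × ℝ) => ∑ μ, f (r μ))
      (Measure.pi fun _ : Fin m => rowLaw n PA) := integrable_finsetSum _ fun μ _ => j1 μ
  have i2 : Integrable (fun z : Fin n → ℝ => ∑ i, g i (z i)) (iid n stdG) :=
    integrable_finsetSum _ fun i _ => j2 i
  refine ⟨(i1.comp_fst _).add (i2.comp_snd _), ?_⟩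
  have f1 := integral_fun_fst (μ := Measure.pi fun _ : Fin m => rowLaw n PA) (ν := iid n stdG)
    (fun r => ∑ μ, f (r μ))
  have f2 := integral_fun_snd (μ := Measure.pi fun _ : Fin m => rowLaw n PA) (ν := iid n stdG)
    (fun z => ∑ i, g i (z i))
  simp only [probReal_univ, one_smul] at f1 f2
  have e := integral_add (μ := dataLaw n m PA) (i1.comp_fst (iid n stdG))
    (i2.comp_snd (Measure.pi fun _ : Fin m => rowLaw n PA))
  refine e.trans (congrArg₂ _ (f1.trans ?_) (f2.trans ?_))
  · rw [integral_finsetSum _ fun μ _ => j1 μ]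
    refine (Finset.sum_congr rfl fun μ _ => integral_comp_eval
      (μ := fun _ : Fin m => rowLaw n PA) (i := μ) hf.aestronglyMeasurable).trans ?_
    simp
  · rw [integral_finsetSum _ fun i _ => j2 i]
    exact Finset.sum_congr rfl fun i _ => integral_comp_eval
      (μ := fun _ : Fin n => stdG) (i := i) (hg i).aestronglyMeasurable

lemma RegularChannel.integral_log_lik_div_base (h : RegularChannel Δ φ B) (hk : 0 ≤ k) (hs : 0 ≤ s)
    {X u : Fin n → ℝ} (hu : ∀ i, u i = 0 ∨ u i = X i) (c : ℝ) :
    Integrable (fun ω => Real.log (lik Δ PA φ k s X X ω / baseLik Δ PA φ k s c X u ω))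
      (dataLaw n m PA) ∧
    ∫ ω, Real.log (lik Δ PA φ k s X X ω / baseLik Δ PA φ k s c X u ω) ∂(dataLaw n m PA)
      = m * Jinfo Δ PA φ (Real.sqrt (nsq k u)) (Real.sqrt (nsq k (X - u))) c
        + s * (∑ i, (X i - u i) ^ 2) / 2 := by
  have hv : ∀ i, (X - u) i ≠ 0 → u i = 0 := fun i hi =>
    (hu i).resolve_right fun hc => hi (by simp [hc])
  have hrow := h.integral_row_llr (PA := PA) hk hv c
  have huX : u + (X - u) = X := add_sub_cancel u X
  rw [huX] at hrow
  have hir : Integrable (fun r : (Fin n → ℝ) × ((Fin kA → ℝ) × ℝ) =>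
      llr Δ PA φ (dotp k X r.1) (dotp k u r.1) c r.2) (rowLaw n PA) :=
    h.integrable_llr (PA := PA) (iid n stdG) (g := dotp k X) (g' := dotp k u) (c := fun _ => c)
      (measurable_dotp k X) (measurable_dotp k u) measurable_const
  simp_rw [h.log_lik_div_base]
  have key := integral_dataLaw_sum (m := m) (PA := PA) hir (g := fun i z =>
    (Real.sqrt s * (X i - u i)) ^ 2 / 2 + Real.sqrt s * (X i - u i) * z)
    fun i => (integral_affine_stdG ((Real.sqrt s * (X i - u i)) ^ 2 / 2)
      (Real.sqrt s * (X i - u i))).1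
  have hg (i : Fin n) : ∫ z, ((Real.sqrt s * (X i - u i)) ^ 2 / 2
      + Real.sqrt s * (X i - u i) * z) ∂stdG = s * (X i - u i) ^ 2 / 2 := by
    rw [(integral_affine_stdG _ _).2, mul_pow, Real.sq_sqrt hs]
  simp_rw [hrow, hg, ← Finset.sum_div, ← Finset.mul_sum] at key
  exact key

end Upper

section UpperBound

variable {Δ : ℝ} {kA : ℕ} {PA : Measure (Fin kA → ℝ)} [IsProbabilityMeasure PA]
  {φ : ℝ → (Fin kA → ℝ) → ℝ} {B : ℝ} {n m : ℕ} {k s : ℝ}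

lemma sum_integral_log_le {ι E : Type*} [MeasurableSpace E] {μ : Measure E}
    [IsProbabilityMeasure μ] (S : Finset ι) {p q : ι → ℝ} (hp : ∀ x, 0 ≤ p x)
    (hp1 : ∑ x ∈ S, p x = 1) (hpq : ∀ x ∈ S, p x ≤ q x) {a b Z : ι → E → ℝ}
    (ha : ∀ x ∈ S, ∀ ω, 0 < a x ω) (hb : ∀ x ∈ S, ∀ ω, 0 < b x ω) (hZ : ∀ x ∈ S, ∀ ω, 0 < Z x ω)
    (haZ : ∀ x ∈ S, Integrable (fun ω => Real.log (a x ω / Z x ω)) μ)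
    (hab : ∀ x ∈ S, Integrable (fun ω => Real.log (a x ω / b x ω)) μ)
    (h1 : ∑ x ∈ S, ENNReal.ofReal (p x) * ∫⁻ ω, ENNReal.ofReal (q x * b x ω / Z x ω) ∂μ ≤ 1) :
    ∑ x ∈ S, p x * ∫ ω, Real.log (a x ω / Z x ω) ∂μ
      ≤ ∑ x ∈ S, p x * ((∫ ω, Real.log (a x ω / b x ω) ∂μ) - Real.log (q x)) := by
  set J : ι → ENNReal := fun x => ∫⁻ ω, ENNReal.ofReal (q x * b x ω / Z x ω) ∂μ
  have hJ x (hx : x ∈ S) : ENNReal.ofReal (p x) * J x ≤ 1 :=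
    (Finset.single_le_sum (f := fun x => ENNReal.ofReal (p x) * J x) (fun _ _ => zero_le) hx).trans h1
  have key x (hx : x ∈ S) : p x * ∫ ω, Real.log (a x ω / Z x ω) ∂μ
      ≤ p x * ((∫ ω, Real.log (a x ω / b x ω) ∂μ) - Real.log (q x))
        + (ENNReal.ofReal (p x) * J x).toReal - p x := by
    rcases (hp x).eq_or_lt with h0 | h0
    · simp [← h0]
    have hq : 0 < q x := h0.trans_le (hpq x hx)
    have hJx : J x ≠ ⊤ := fun ht => by
      have := hJ x hx
      rw [ht, ENNReal.mul_top (by simpa using h0)] at this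
      exact absurd this (by simp)
    have e ω : q x * b x ω / Z x ω = Real.exp (Real.log (a x ω / Z x ω)
        - Real.log (a x ω / b x ω) + Real.log (q x)) := by
      rw [Real.exp_add, Real.exp_sub, Real.exp_log hq,
        Real.exp_log (div_pos (ha x hx ω) (hZ x hx ω)),
        Real.exp_log (div_pos (ha x hx ω) (hb x hx ω))]
      have := (ha x hx ω).ne'
      have := (hb x hx ω).ne'
      have := (hZ x hx ω).ne'
      field_simp
    have iℓ := ((haZ x hx).sub (hab x hx)).add (integrable_const (Real.log (q x)))
    have iR : Integrable (fun ω => q x * b x ω / Z x ω) μ := by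
      refine ⟨?_, ?_⟩
      · simp_rw [e]
        exact Real.measurable_exp.comp_aemeasurable iℓ.aemeasurable |>.aestronglyMeasurable
      · rw [hasFiniteIntegral_iff_ofReal (Filter.Eventually.of_forall fun ω =>
          (div_pos (mul_pos hq (hb x hx ω)) (hZ x hx ω)).le)]
        exact lt_top_iff_ne_top.2 hJx
    have hR : ∫ ω, q x * b x ω / Z x ω ∂μ = (J x).toReal :=
      integral_eq_lintegral_of_nonneg_ae (Filter.Eventually.of_forall fun ω =>
          (div_pos (mul_pos hq (hb x hx ω)) (hZ x hx ω)).le) iR.aestronglyMeasurable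
    have i2 : Integrable (fun ω => q x * b x ω / Z x ω + (-1 - Real.log (q x))) μ :=
      iR.add (integrable_const _)
    have hle : ∫ ω, Real.log (a x ω / Z x ω) ∂μ
        ≤ ∫ ω, (Real.log (a x ω / b x ω) + (q x * b x ω / Z x ω + (-1 - Real.log (q x)))) ∂μ := by
      refine integral_mono (haZ x hx) ((hab x hx).add i2) fun ω => ?_
      have := Real.add_one_le_exp (Real.log (a x ω / Z x ω)
        - Real.log (a x ω / b x ω) + Real.log (q x))
      rw [← e] at this
      simp only
      linarith
    rw [integral_add (hab x hx) i2, integral_add iR (integrable_const _),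
      hR, integral_const] at hle
    simp only [probReal_univ, one_smul] at hle
    rw [ENNReal.toReal_mul, ENNReal.toReal_ofReal h0.le]
    nlinarith
  have hsum : ∑ x ∈ S, (ENNReal.ofReal (p x) * J x).toReal ≤ 1 := by
    rw [← ENNReal.toReal_sum fun x hx => ((hJ x hx).trans_lt ENNReal.one_lt_top).ne]
    exact ENNReal.toReal_mono ENNReal.one_ne_top h1
  have := Finset.sum_le_sum key
  rw [Finset.sum_sub_distrib, Finset.sum_add_distrib, hp1] at this
  linarith

lemma wt_le_wt_fiber {T : Finset ℝ} {w : ℝ → ℝ} (hw : ∀ t, 0 ≤ w t) (β : ℝ → ℝ) {X : Fin n → ℝ}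
    (hX : X ∈ grid n T) : wt w X ≤ wt (fiberWt T w β) fun i => β (X i) :=
  Finset.prod_le_prod (fun _ _ => hw _) fun i _ => le_fiberWt hw β (Fintype.mem_piFinset.1 hX i)

lemma RegularChannel.sum_wt_integral_log_le (h : RegularChannel Δ φ B) (hk : 0 ≤ k) (hs : 0 ≤ s)
    {T : Finset ℝ} {w : ℝ → ℝ} (hw : ∀ t, 0 ≤ w t) (h1 : ∑ t ∈ T, w t = 1) {β : ℝ → ℝ}
    (hβ : ∀ a, β a = 0 ∨ β a = a) (c : ℝ) :
    ∑ X ∈ grid n T, wt w X * ∫ ω, Real.log (lik Δ PA φ k s X X ω / margLik Δ PA φ T w k s X ω)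
        ∂(dataLaw n m PA)
      ≤ ∑ X ∈ grid n T, wt w X * (m * Jinfo Δ PA φ (Real.sqrt (nsq k fun i => β (X i)))
          (Real.sqrt (nsq k (X - fun i => β (X i)))) c
        + s * (∑ i, (X i - β (X i)) ^ 2) / 2 - Real.log (wt (fiberWt T w β) fun i => β (X i))) := by
  have hu (X : Fin n → ℝ) := h.integral_log_lik_div_base (PA := PA) (m := m) hk hs (X := X)
    (u := fun i => β (X i)) (fun i => hβ (X i)) c
  have key := sum_integral_log_le (grid n T) (wt_nonneg hw) (sum_wt h1)
    (fun X hX => wt_le_wt_fiber hw β hX)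
    (a := fun X ω => lik Δ PA φ k s X X ω)
    (b := fun X ω => baseLik Δ PA φ k s c X (fun i => β (X i)) ω)
    (Z := fun X ω => margLik Δ PA φ T w k s X ω) (fun X _ ω => h.lik_pos _ _ _)
    (fun X _ ω => h.baseLik_pos _ _ _ _) (fun X hX ω => (h.margLik_bounds hw h1 hX ω).1)
    (fun X hX => h.integrable_log_lik_div hw h1 hX) (fun X _ => (hu X).1)
    (h.sum_wt_lintegral_le (PA := PA) (n := n) (m := m) (k := k) (s := s) hw h1 β c)
  refine key.trans_eq (Finset.sum_congr rfl fun X _ => ?_)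
  rw [(hu X).2]

end UpperBound

section Concentration

variable {n : ℕ} {k : ℝ} {T : Finset ℝ} {w : ℝ → ℝ}

lemma sum_wt_eval (h1 : ∑ t ∈ T, w t = 1) (g : ℝ → ℝ) (i : Fin n) :
    ∑ X ∈ grid n T, wt w X * g (X i) = ∑ t ∈ T, w t * g t := by
  have e (X : Fin n → ℝ) : wt w X * g (X i)
      = ∏ j, (fun (j : Fin n) t => w t * if j = i then g t else 1) j (X j) := by
    simp only
    rw [Finset.prod_mul_distrib, wt, Finset.prod_ite_eq' Finset.univ i fun j => g (X j)]
    simp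
  refine (Finset.sum_congr rfl fun X _ => e X).trans ((sum_grid_prod T
    fun (j : Fin n) t => w t * if j = i then g t else 1).trans ?_)
  rw [Finset.prod_eq_single i]
  · simp
  · intro j _ hj; simp [hj, h1]
  · simp

lemma sum_wt_eval_mul_eq_zero {g : ℝ → ℝ} (hg : ∑ t ∈ T, w t * g t = 0) {i j : Fin n}
    (hij : i ≠ j) : ∑ X ∈ grid n T, wt w X * (g (X i) * g (X j)) = 0 := by
  have e (X : Fin n → ℝ) : wt w X * (g (X i) * g (X j))
      = ∏ l, (fun (l : Fin n) t => w t * ((if l = i then g t else 1) * if l = j then g t else 1))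
        l (X l) := by
    simp only
    rw [Finset.prod_mul_distrib, Finset.prod_mul_distrib, wt,
      Finset.prod_ite_eq' Finset.univ i fun j => g (X j),
      Finset.prod_ite_eq' Finset.univ j fun j => g (X j)]
    simp
  refine (Finset.sum_congr rfl fun X _ => e X).trans ((sum_grid_prod T fun (l : Fin n) t =>
    w t * ((if l = i then g t else 1) * if l = j then g t else 1)).trans ?_)
  exact Finset.prod_eq_zero (Finset.mem_univ i) (by simpa [hij] using hg)

lemma sum_wt_sum (h1 : ∑ t ∈ T, w t = 1) (g : ℝ → ℝ) :
    ∑ X ∈ grid n T, wt w X * ∑ i, g (X i) = n * ∑ t ∈ T, w t * g t := by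
  simp_rw [Finset.mul_sum]
  rw [Finset.sum_comm, Finset.sum_congr rfl fun i _ => sum_wt_eval h1 g i]
  simp [Finset.mul_sum]

/-- The variance of an empirical sum is at most the sum of the second moments. -/
lemma sum_wt_sq_sub_le (h1 : ∑ t ∈ T, w t = 1) (f : ℝ → ℝ) :
    ∑ X ∈ grid n T, wt w X * ((∑ i, f (X i)) - n * ∑ t ∈ T, w t * f t) ^ 2
      ≤ n * ∑ t ∈ T, w t * f t ^ 2 := by
  obtain ⟨M, hM⟩ : ∃ M, M = ∑ t ∈ T, w t * f t := ⟨_, rfl⟩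
  rw [← hM]
  have hg : ∑ t ∈ T, w t * (f t - M) = 0 := by
    simp_rw [mul_sub]
    rw [Finset.sum_sub_distrib, ← Finset.sum_mul, h1, ← hM]; ring
  have e (X : Fin n → ℝ) : wt w X * ((∑ i, f (X i)) - n * M) ^ 2
      = ∑ i, ∑ j, wt w X * ((f (X i) - M) * (f (X j) - M)) := by
    have : (∑ i, f (X i)) - n * M = ∑ i, (f (X i) - M) := by simp
    rw [this, sq, Finset.sum_mul_sum, Finset.mul_sum]
    simp_rw [Finset.mul_sum]
  simp_rw [e]
  rw [Finset.sum_comm]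
  have hi (i : Fin n) : ∑ X ∈ grid n T, ∑ j, wt w X * ((f (X i) - M) * (f (X j) - M))
      = ∑ t ∈ T, w t * (f t - M) ^ 2 := by
    rw [Finset.sum_comm, Finset.sum_eq_single i]
    · rw [← sum_wt_eval h1 (fun t => (f t - M) ^ 2) i]
      exact Finset.sum_congr rfl fun X _ => by ring
    · exact fun j _ hj => sum_wt_eval_mul_eq_zero (g := fun t => f t - M) hg hj.symm
    · simp
  rw [Finset.sum_congr rfl fun i _ => hi i]
  simp only [Finset.sum_const, Finset.card_univ, Fintype.card_fin, nsmul_eq_mul]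
  refine mul_le_mul_of_nonneg_left ?_ n.cast_nonneg
  have e2 : ∑ t ∈ T, w t * (f t - M) ^ 2 = ∑ t ∈ T, w t * f t ^ 2 - M ^ 2 := by
    have (t : ℝ) : w t * (f t - M) ^ 2 = w t * f t ^ 2 - 2 * M * (w t * f t) + M ^ 2 * w t := by ring
    simp_rw [this]
    rw [Finset.sum_add_distrib, Finset.sum_sub_distrib, ← Finset.mul_sum, ← Finset.mul_sum, h1, ← hM]
    ring
  rw [e2]
  nlinarith [sq_nonneg M]

lemma sum_wt_emp (h1 : ∑ t ∈ T, w t = 1) (f : ℝ → ℝ) :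
    ∑ X ∈ grid n T, wt w X * emp k f X = n * (∑ t ∈ T, w t * f t) / k := by
  unfold emp
  simp_rw [← mul_div_assoc]
  rw [← Finset.sum_div, sum_wt_sum h1]

lemma sum_wt_neg_log_le (hw : ∀ t, 0 ≤ w t) (h1 : ∑ t ∈ T, w t = 1) {w' : ℝ → ℝ} {b : ℝ → ℝ}
    {g : ℝ → ℝ} (hpos : ∀ t ∈ T, 0 < w t → 0 < w' (b t))
    (hg : ∀ t ∈ T, 0 < w t → -Real.log (w' (b t)) ≤ g t) :
    ∑ X ∈ grid n T, wt w X * -Real.log (wt w' fun i => b (X i)) ≤ n * ∑ t ∈ T, w t * g t := by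
  rw [← sum_wt_sum h1]
  refine Finset.sum_le_sum fun X hX => ?_
  have hT i : X i ∈ T := Fintype.mem_piFinset.1 hX i
  rcases (wt_nonneg hw X).eq_or_lt with h0 | h0
  · simp [← h0]
  have hwi i : 0 < w (X i) := (hw _).lt_of_ne fun hc =>
    h0.ne' (Finset.prod_eq_zero (Finset.mem_univ i) hc.symm)
  refine mul_le_mul_of_nonneg_left ?_ h0.le
  rw [wt, Real.log_prod fun i _ => (hpos _ (hT i) (hwi i)).ne', ← Finset.sum_neg_distrib]
  exact Finset.sum_le_sum fun i _ => hg _ (hT i) (hwi i)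

lemma exists_quadratic_lower {ι : Type*} [Fintype ι] {G : (ι → ℝ) → ℝ} {c : ι → ℝ}
    (hc : ContinuousAt G c) {A : Set (ι → ℝ)} {C : ℝ} (hC : ∀ p ∈ A, -C ≤ G p) {ε : ℝ} (hε : 0 < ε) :
    ∃ D, 0 ≤ D ∧ ∀ p ∈ A, G c - ε - D * ∑ i, (p i - c i) ^ 2 ≤ G p := by
  obtain ⟨δ, hδ, hδ'⟩ := Metric.continuousAt_iff.1 hc ε hε
  have hD : 0 ≤ |G c + C| / δ ^ 2 := by positivity
  refine ⟨|G c + C| / δ ^ 2, hD, fun p hp => ?_⟩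
  have hs : 0 ≤ ∑ i, (p i - c i) ^ 2 := Finset.sum_nonneg fun _ _ => sq_nonneg _
  by_cases hd : dist p c < δ
  · have := hδ' hd
    rw [Real.dist_eq, abs_lt] at this
    nlinarith
  · obtain ⟨i, hi⟩ : ∃ i, δ ≤ dist (p i) (c i) := by
      by_contra! hcon
      exact hd ((dist_pi_lt_iff hδ).2 hcon)
    rw [Real.dist_eq] at hi
    have h2 : δ ^ 2 ≤ ∑ i, (p i - c i) ^ 2 := by
      refine le_trans ?_ (Finset.single_le_sum (fun _ _ => sq_nonneg _) (Finset.mem_univ i))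
      rw [← sq_abs (p i - c i)]
      exact pow_le_pow_left₀ hδ.le hi 2
    have h3 : |G c + C| ≤ |G c + C| / δ ^ 2 * ∑ i, (p i - c i) ^ 2 := by
      rw [div_mul_eq_mul_div, le_div_iff₀ (by positivity)]
      exact mul_le_mul_of_nonneg_left h2 (abs_nonneg _)
    have := hC p hp
    have := le_abs_self (G c + C)
    linarith

end Concentration

/-- The weights `w` on `T` describe a random variable that vanishes with probability `1 - ρ` and
is drawn from `P0` otherwise. -/
def IsSparseWeight (T : Finset ℝ) (w : ℝ → ℝ) (ρ : ℝ) (P0 : Measure ℝ) : Prop :=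
  (∀ t, 0 ≤ w t) ∧ ∀ f : ℝ → ℝ, ∑ t ∈ T, w t * f t = (1 - ρ) * f 0 + ρ * ∫ x, f x ∂P0

section Sparse

variable {n : ℕ} {T : Finset ℝ} {w : ℝ → ℝ} {ρ : ℝ} {P0 : Measure ℝ}

lemma IsSparseWeight.sum_eq_one [IsProbabilityMeasure P0]
    (hw : IsSparseWeight T w ρ P0) : ∑ t ∈ T, w t = 1 := by
  have := hw.2 fun _ => 1
  simpa using this

lemma IsSparseWeight.sum_mul_eq (hw : IsSparseWeight T w ρ P0) {f : ℝ → ℝ} (hf : f 0 = 0) :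
    ∑ t ∈ T, w t * f t = ρ * ∫ x, f x ∂P0 := by
  rw [hw.2 f, hf]; ring

lemma IsSparseWeight.sum_wt_emp [IsProbabilityMeasure P0]
    (hw : IsSparseWeight T w ρ P0) (hk : 0 < n * ρ) {f : ℝ → ℝ}
    (hf : f 0 = 0) : ∑ X ∈ grid n T, wt w X * emp (n * ρ) f X = ∫ x, f x ∂P0 := by
  rw [GLM.sum_wt_emp hw.sum_eq_one, hw.sum_mul_eq hf, ← mul_assoc, mul_div_cancel_left₀ _ hk.ne']

/-- Empirical averages concentrate when the number of nonzero entries grows. -/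
lemma IsSparseWeight.sum_wt_sq_emp_sub_le [IsProbabilityMeasure P0]
    (hw : IsSparseWeight T w ρ P0) (hk : 0 < n * ρ)
    {f : ℝ → ℝ} (hf : f 0 = 0) :
    ∑ X ∈ grid n T, wt w X * (emp (n * ρ) f X - ∫ x, f x ∂P0) ^ 2
      ≤ (∫ x, f x ^ 2 ∂P0) * (1 / (n * ρ)) := by
  have key := sum_wt_sq_sub_le (n := n) hw.sum_eq_one f
  rw [hw.sum_mul_eq hf, hw.sum_mul_eq (f := fun t => f t ^ 2) (by simp [hf])] at key
  obtain ⟨k, hk'⟩ : ∃ k, k = n * ρ := ⟨_, rfl⟩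
  rw [← mul_assoc, ← mul_assoc, ← hk'] at key
  rw [← hk'] at hk ⊢
  have e (X : Fin n → ℝ) : wt w X * (emp k f X - ∫ x, f x ∂P0) ^ 2
      = wt w X * ((∑ i, f (X i)) - k * ∫ x, f x ∂P0) ^ 2 / k ^ 2 := by
    unfold emp; field_simp
  simp_rw [e]
  rw [← Finset.sum_div, div_le_iff₀ (by positivity)]
  refine key.trans_eq ?_
  field_simp

lemma nsq_eq_emp (k : ℝ) (X : Fin n → ℝ) : nsq k X = emp k (fun x => x ^ 2) X := rfl

/-- Keep only the entries of absolute value at least `t`. -/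
def keep (t x : ℝ) : ℝ := if t ≤ |x| then x else 0

lemma IsSparseWeight.eq_mul_real (hw : IsSparseWeight T w ρ P0) {a : ℝ} (ha : a ∈ T)
    (ha0 : a ≠ 0) : w a = ρ * P0.real {a} := by
  have := hw.2 (({a} : Set ℝ).indicator fun _ => 1)
  rw [integral_indicator_const _ (measurableSet_singleton a)] at this
  simpa [Set.indicator_apply, ha, ha0.symm] using this

lemma IsSparseWeight.one_sub_le_fiberWt (hw : IsSparseWeight T w ρ P0) (hρ : 0 ≤ ρ) {β : ℝ → ℝ}
    (h0 : β 0 = 0) : 1 - ρ ≤ fiberWt T w β 0 := by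
  classical
  have := hw.2 fun t => if β t = 0 then 1 else 0
  simp only [h0, if_true, mul_ite, mul_one, mul_zero, ← Finset.sum_filter] at this
  rw [fiberWt, this]
  have := integral_nonneg (μ := P0) (f := fun x => if β x = 0 then (1 : ℝ) else 0) fun x => by
    simp only [Pi.zero_apply]; split_ifs <;> simp
  have := mul_nonneg hρ this
  linarith

/-- Entropy of the large entries of a sparse signal. -/
lemma IsSparseWeight.sum_wt_neg_log_le [IsProbabilityMeasure P0]
    (hw : IsSparseWeight T w ρ P0) (hρ0 : 0 < ρ)
    (hρ : ρ ≤ 1 / 2) {t : ℝ} (ht : 0 < t) :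
    ∑ X ∈ grid n T, wt w X * -Real.log (wt (fiberWt T w (keep t)) fun i => keep t (X i))
      ≤ n * ρ * (-Real.log ρ * (∫ x, bigInd t x ∂P0)
        + ((∫ x, (if t ≤ |x| then -Real.log (P0.real {x}) else 0) ∂P0) + 2)) := by
  obtain ⟨H, hH⟩ : ∃ H : ℝ → ℝ, H = fun x => if t ≤ |x| then -Real.log (P0.real {x}) else 0 :=
    ⟨_, rfl⟩
  have h00 : ¬ t ≤ |(0 : ℝ)| := by simpa using ht
  have hF := hw.one_sub_le_fiberWt hρ0.le (β := keep t) (by simp [keep])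
  refine (GLM.sum_wt_neg_log_le (n := n) hw.1 hw.sum_eq_one (w' := fiberWt T w (keep t))
    (b := keep t) (g := fun x => -Real.log ρ * bigInd t x + (H x + 2 * ρ))
    (fun a ha ha0 => ha0.trans_le (le_fiberWt hw.1 (keep t) ha)) fun a ha ha0 => ?_).trans_eq ?_
  · by_cases hta : t ≤ |a|
    · have hne : a ≠ 0 := fun hc => h00 (hc ▸ hta)
      have hwa := hw.eq_mul_real ha hne
      have hp : P0.real {a} ≠ 0 := fun hc => by rw [hwa, hc, mul_zero] at ha0; exact lt_irrefl _ ha0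
      have := Real.log_le_log ha0 (le_fiberWt hw.1 (keep t) ha)
      rw [hwa, Real.log_mul hρ0.ne' hp] at this
      simp only [bigInd, hta, if_true, hH]
      linarith
    · have hk : keep t a = 0 := by simp [keep, hta]
      simp only [bigInd, hta, if_false, hH, hk]
      have h1 : -Real.log (fiberWt T w (keep t) 0) ≤ -Real.log (1 - ρ) :=
        neg_le_neg (Real.log_le_log (by linarith) hF)
      have h2 := Real.one_sub_inv_le_log_of_pos (show 0 < 1 - ρ by linarith)
      have h3 : (1 - ρ)⁻¹ ≤ 1 + 2 * ρ := by
        rw [inv_le_comm₀ (by linarith) (by linarith), inv_le_iff_one_le_mul₀ (by linarith)]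
        nlinarith
      linarith
  · simp_rw [mul_add, Finset.sum_add_distrib, mul_left_comm (w _) (-Real.log ρ), ← Finset.mul_sum,
      ← Finset.sum_mul]
    rw [hw.sum_mul_eq (f := bigInd t) (by simp [bigInd, ht]),
      hw.sum_mul_eq (f := H) (by simp [hH, ht]), hw.sum_eq_one, hH]
    ring

end Sparse

section Bounds

variable {Δ : ℝ} {kA : ℕ} {PA : Measure (Fin kA → ℝ)} [IsProbabilityMeasure PA]
  {φ : ℝ → (Fin kA → ℝ) → ℝ} {B : ℝ} {P0 : Measure ℝ} [IsProbabilityMeasure P0]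

lemma sq_sub_keep (t x : ℝ) : (x - keep t x) ^ 2 = x ^ 2 - bigSq t x := by
  unfold keep bigSq; split_ifs <;> ring

lemma keep_sq (t x : ℝ) : keep t x ^ 2 = bigSq t x := by
  unfold keep bigSq; split_ifs <;> ring

/-- The average of the logarithmic likelihood ratios of a sparse signal. -/
def avgLogLik (Δ : ℝ) {kA : ℕ} (PA : Measure (Fin kA → ℝ)) (φ : ℝ → (Fin kA → ℝ) → ℝ)
    (T : Finset ℝ) (w : ℝ → ℝ) (k s : ℝ) (n m : ℕ) : ℝ :=
  ∑ X ∈ grid n T, wt w X * ∫ ω, Real.log (lik Δ PA φ k s X X ω / margLik Δ PA φ T w k s X ω)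
    ∂(dataLaw n m PA)

/-- Knowing the entries above a threshold bounds the information from above by the potential. -/
lemma RegularChannel.exists_avgLogLik_le (h : RegularChannel Δ φ B) {γ τ t ε : ℝ} (hγ : 0 < γ)
    (hτ : 0 ≤ τ) (ht : 0 < t) (hε : 0 < ε) :
    ∃ C, ∀ (n m : ℕ) (ρ : ℝ) (T : Finset ℝ) (w : ℝ → ℝ), IsSparseWeight T w ρ P0 → 0 < n * ρ →
      0 < ρ → ρ ≤ 1 / 2 → (m : ℝ) = γ * (n * ρ) * -Real.log ρ →
      avgLogLik Δ PA φ T w (n * ρ) (γ * τ * -Real.log ρ) n m ≤ m * (potential Δ PA φ τ γ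
        (∫ x, bigSq t x ∂P0) (∫ x, x ^ 2 ∂P0) (∫ x, bigInd t x ∂P0)
        + ε + C * (1 / (n * ρ) + 1 / -Real.log ρ)) := by
  obtain ⟨q, hq⟩ : ∃ q, q = ∫ x, bigSq t x ∂P0 := ⟨_, rfl⟩
  obtain ⟨S, hS⟩ : ∃ S, S = ∫ x, x ^ 2 ∂P0 := ⟨_, rfl⟩
  obtain ⟨N, hN⟩ : ∃ N, N = ∫ x, bigInd t x ∂P0 := ⟨_, rfl⟩
  obtain ⟨H, hH⟩ : ∃ H, H = ∫ x, (if t ≤ |x| then -Real.log (P0.real {x}) else 0) ∂P0 := ⟨_, rfl⟩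
  obtain ⟨Q4, hQ4⟩ : ∃ Q4, Q4 = (∫ x, bigSq t x ^ 2 ∂P0) + ∫ x, (x ^ 2) ^ 2 ∂P0 := ⟨_, rfl⟩
  obtain ⟨c, hc⟩ : ∃ c, c = Real.sqrt (S - q) := ⟨_, rfl⟩
  have hcont : Continuous fun p : Fin 2 → ℝ =>
      Jinfo Δ PA φ (Real.sqrt (p 0)) (Real.sqrt (p 1 - p 0)) c :=
    h.continuous_Jinfo (by fun_prop) (by fun_prop) continuous_const
  obtain ⟨D, hD0, hD⟩ := exists_quadratic_lower (c := ![q, S]) hcont.neg.continuousAt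
    (A := Set.univ) (C := ∫ z, llrSlope Δ B * (1 + |z|) ∂stdG)
    (fun p _ => neg_le_neg ((le_abs_self _).trans (h.abs_Jinfo_le _ _ _))) hε
  refine ⟨D * Q4 + (|H| + 2) / γ, fun n m ρ T w hw hk hρ0 hρ hm => ?_⟩
  have hHρ := hw.sum_wt_neg_log_le (n := n) hρ0 hρ ht
  rw [← hq, ← hS, ← hN]
  rw [← hN, ← hH] at hHρ
  have b0 : bigSq t 0 = 0 := by simp [bigSq]
  have v1 := hw.sum_wt_sq_emp_sub_le hk b0
  have v2 := hw.sum_wt_sq_emp_sub_le hk (f := fun x => x ^ 2) (by simp)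
  have a1 := hw.sum_wt_emp hk b0
  have a2 := hw.sum_wt_emp hk (f := fun x => x ^ 2) (by simp)
  rw [← hq] at v1 a1
  rw [← hS] at v2 a2
  have hlog : 0 < -Real.log ρ := neg_pos.2 (Real.log_neg hρ0 (by linarith))
  have key := h.sum_wt_integral_log_le (PA := PA) (n := n) (m := m) hk.le
    (s := γ * τ * -Real.log ρ) (by positivity) hw.1 hw.sum_eq_one (β := keep t)
    (fun a => by unfold keep; split_ifs <;> simp) c
  obtain ⟨L, hL⟩ : ∃ L, L = -Real.log ρ := ⟨_, rfl⟩
  obtain ⟨k, hk'⟩ : ∃ k, k = n * ρ := ⟨_, rfl⟩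
  rw [← hL] at hHρ hlog hm key ⊢
  rw [← hk'] at hk hHρ v1 v2 a1 a2 hm key ⊢
  unfold avgLogLik
  refine key.trans ?_
  have hb (X : Fin n → ℝ) : wt w X * (m * Jinfo Δ PA φ (Real.sqrt (nsq k fun i => keep t (X i)))
          (Real.sqrt (nsq k (X - fun i => keep t (X i)))) c
        + γ * τ * L * (∑ i, (X i - keep t (X i)) ^ 2) / 2
        - Real.log (wt (fiberWt T w (keep t)) fun i => keep t (X i)))
      ≤ m * (Jinfo Δ PA φ (Real.sqrt q) (Real.sqrt (S - q)) c + ε) * wt w X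
        + m * D * (wt w X * (emp k (bigSq t) X - q) ^ 2)
        + m * D * (wt w X * (emp k (fun x => x ^ 2) X - S) ^ 2)
        + m * τ / 2 * (wt w X * emp k (fun x => x ^ 2) X)
        - m * τ / 2 * (wt w X * emp k (bigSq t) X)
        + wt w X * -Real.log (wt (fiberWt T w (keep t)) fun i => keep t (X i)) := by
    have e1 : nsq k (fun i => keep t (X i)) = emp k (bigSq t) X := by
      unfold nsq emp; simp_rw [keep_sq]
    have e2 : ∑ i, (X i - keep t (X i)) ^ 2
        = k * (emp k (fun x => x ^ 2) X - emp k (bigSq t) X) := by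
      simp_rw [sq_sub_keep, Finset.sum_sub_distrib]
      unfold emp; field_simp
    have e3 : nsq k (X - fun i => keep t (X i))
        = emp k (fun x => x ^ 2) X - emp k (bigSq t) X := by
      unfold nsq; simp only [Pi.sub_apply]; rw [e2, mul_div_cancel_left₀ _ hk.ne']
    rw [e1, e3, e2]
    have hj := hD ![emp k (bigSq t) X, emp k (fun x => x ^ 2) X] trivial
    simp only [Pi.neg_apply, Fin.sum_univ_two, Matrix.cons_val_zero, Matrix.cons_val_one] at hj
    have hj' := mul_le_mul_of_nonneg_left hj (mul_nonneg m.cast_nonneg (wt_nonneg hw.1 X))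
    rw [show γ * τ * L * (k * (emp k (fun x => x ^ 2) X - emp k (bigSq t) X)) / 2
      = (γ * k * L) * τ * (emp k (fun x => x ^ 2) X - emp k (bigSq t) X) / 2 by ring, ← hm]
    linarith
  refine (Finset.sum_le_sum fun X _ => hb X).trans ?_
  simp only [Finset.sum_add_distrib, Finset.sum_sub_distrib, ← Finset.mul_sum]
  rw [sum_wt hw.sum_eq_one, a1, a2]
  have hmD : 0 ≤ m * D := mul_nonneg m.cast_nonneg hD0
  have w1 := mul_le_mul_of_nonneg_left v1 hmD
  have w2 := mul_le_mul_of_nonneg_left v2 hmD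
  have hkm : k = m * (1 / (γ * L)) := by rw [hm]; field_simp
  have hent : k * (L * N + (H + 2)) ≤ m * (N / γ + (|H| + 2) / γ * (1 / L)) := by
    have : m * (N / γ + (|H| + 2) / γ * (1 / L)) = k * (L * N + (|H| + 2)) := by
      rw [hm]; field_simp
    rw [this]
    have := le_abs_self H
    gcongr
  have hx : 0 ≤ (m : ℝ) * (D * Q4) * (1 / L) := by
    have : 0 ≤ Q4 := by rw [hQ4]; positivity
    positivity
  have hy : 0 ≤ (m : ℝ) * ((|H| + 2) / γ) * (1 / k) := by positivity
  have hI : Iinfo Δ PA φ q (S - q) = Jinfo Δ PA φ (Real.sqrt q) (Real.sqrt (S - q)) c := by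
    rw [Iinfo, hc]
  unfold potential
  rw [hI]
  rw [hQ4] at hx ⊢
  linarith

end Bounds

section LowerBound

variable {Δ : ℝ} {kA : ℕ} {PA : Measure (Fin kA → ℝ)} [IsProbabilityMeasure PA]
  {φ : ℝ → (Fin kA → ℝ) → ℝ} {B : ℝ} {P0 : Measure ℝ} [IsProbabilityMeasure P0]

lemma bigSq_nonneg (t x : ℝ) : 0 ≤ bigSq t x := by unfold bigSq; split_ifs <;> positivity

lemma bigSq_le (t x : ℝ) : bigSq t x ≤ x ^ 2 := by
  unfold bigSq; split_ifs <;> first | exact le_rfl | positivity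

lemma bigInd_nonneg (t x : ℝ) : 0 ≤ bigInd t x := by unfold bigInd; split_ifs <;> simp

lemma emp_nonneg {n : ℕ} {k : ℝ} (hk : 0 ≤ k) {f : ℝ → ℝ} (hf : ∀ x, 0 ≤ f x) (X : Fin n → ℝ) :
    0 ≤ emp k f X := div_nonneg (Finset.sum_nonneg fun _ _ => hf _) hk

lemma emp_mono {n : ℕ} {k : ℝ} (hk : 0 ≤ k) {f g : ℝ → ℝ} (hfg : ∀ x, f x ≤ g x)
    (X : Fin n → ℝ) : emp k f X ≤ emp k g X :=
  div_le_div_of_nonneg_right (Finset.sum_le_sum fun _ _ => hfg _) hk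

/-- The potential at the empirical statistics of a signal is, up to a quadratic error, at least its
value at the population statistics. -/
lemma RegularChannel.exists_potential_emp_ge (h : RegularChannel Δ φ B) {γ τ ε : ℝ} (hγ : 0 < γ)
    (hτ : 0 ≤ τ) (hε : 0 < ε) (t q S N : ℝ) :
    ∃ D, 0 ≤ D ∧ ∀ {n : ℕ} {k : ℝ}, 0 < k → ∀ X : Fin n → ℝ,
      potential Δ PA φ τ γ q S N - ε - D * ((emp k (bigSq t) X - q) ^ 2
          + (emp k (fun x => x ^ 2) X - S) ^ 2 + (emp k (bigInd t) X - N) ^ 2)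
        ≤ potential Δ PA φ τ γ (emp k (bigSq t) X) (nsq k X) (emp k (bigInd t) X) := by
  have hcont : Continuous fun p : Fin 3 → ℝ => potential Δ PA φ τ γ (p 0) (p 1) (p 2) := by
    unfold potential
    exact ((h.continuous_Iinfo (by fun_prop) (by fun_prop)).add (by fun_prop)).add (by fun_prop)
  obtain ⟨D, hD0, hD⟩ := exists_quadratic_lower (c := ![q, S, N]) hcont.continuousAt
    (A := {p | p 0 ≤ p 1 ∧ 0 ≤ p 2}) (C := ∫ z, llrSlope Δ B * (1 + |z|) ∂stdG)
    (fun p hp => by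
      have h1 := (abs_le.1 (h.abs_Jinfo_le (PA := PA) (Real.sqrt (p 0)) (Real.sqrt (p 1 - p 0))
        (Real.sqrt (p 1 - p 0)))).1
      have h2 : 0 ≤ τ * (p 1 - p 0) / 2 :=
        div_nonneg (mul_nonneg hτ (sub_nonneg.2 hp.1)) (by norm_num)
      have h3 : 0 ≤ p 2 / γ := div_nonneg hp.2 hγ.le
      unfold potential Iinfo
      linarith) hε
  refine ⟨D, hD0, fun {n k} hk X => ?_⟩
  have := hD ![emp k (bigSq t) X, emp k (fun x => x ^ 2) X, emp k (bigInd t) X]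
    ⟨emp_mono hk.le (bigSq_le t) X, emp_nonneg hk.le (bigInd_nonneg t) X⟩
  rw [nsq_eq_emp]
  simpa only [Fin.sum_univ_three, Matrix.cons_val_zero, Matrix.cons_val_one,
    Matrix.cons_val] using this

/-- The information is asymptotically at least the smallest potential. -/
lemma RegularChannel.exists_le_avgLogLik (h : RegularChannel Δ φ B) {γ τ ε : ℝ} (hγ : 0 < γ)
    (hτ : 0 ≤ τ) (hε : 0 < ε) {K : ℕ} (hK : 0 < K) {t : ℕ → ℝ} (ht : ∀ j, 0 < t j)
    (hmono : Monotone t) {Ψ : ℝ}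
    (hΨ : ∀ j ≤ K, Ψ ≤ potential Δ PA φ τ γ
        (∫ x, bigSq (t j) x ∂P0) (∫ x, x ^ 2 ∂P0) (∫ x, bigInd (t j) x ∂P0)) :
    ∃ C, ∀ (n m : ℕ) (ρ : ℝ) (T : Finset ℝ) (w : ℝ → ℝ), IsSparseWeight T w ρ P0 → 0 < n * ρ →
      0 < ρ → ρ < 1 → (∀ x ∈ T, x ≠ 0 → t 0 ≤ |x|) → (∀ x ∈ T, |x| < t K) →
      (∀ j < K, ∀ x ∈ T, |x| < t (j + 1) → |x| ≤ t j) →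
      (m : ℝ) = γ * (n * ρ) * -Real.log ρ →
      m * (Ψ - ε - C * (1 / (n * ρ) + 1 / -Real.log ρ))
        ≤ avgLogLik Δ PA φ T w (n * ρ) (γ * τ * -Real.log ρ) n m := by
  have hε2 : 0 < ε / 2 := by positivity
  obtain ⟨S, hS⟩ : ∃ S, S = ∫ x, x ^ 2 ∂P0 := ⟨_, rfl⟩
  choose D hD0 hD using fun j => h.exists_potential_emp_ge (PA := PA) hγ hτ hε2 (t j)
    (∫ x, bigSq (t j) x ∂P0) S (∫ x, bigInd (t j) x ∂P0)
  obtain ⟨Q, hQ⟩ : ∃ Q : ℕ → ℝ, Q = fun j => (∫ x, bigSq (t j) x ^ 2 ∂P0)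
    + (∫ x, (x ^ 2) ^ 2 ∂P0) + ∫ x, bigInd (t j) x ^ 2 ∂P0 := ⟨_, rfl⟩
  obtain ⟨M, hM⟩ : ∃ M, M = mgfConst Δ B + τ * S / 2 := ⟨_, rfl⟩
  have hden : 0 < ε + 2 * |M| := by positivity
  obtain ⟨θ, hθ⟩ : ∃ θ, θ = ε / (ε + 2 * |M|) := ⟨_, rfl⟩
  have hθ0 : 0 < θ := by rw [hθ]; positivity
  have hθ1 : θ ≤ 1 := by rw [hθ, div_le_one hden]; linarith [abs_nonneg M]
  have hθM : θ * M ≤ ε / 2 := by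
    rw [hθ, div_mul_eq_mul_div, div_le_iff₀ hden]
    nlinarith [le_abs_self M]
  refine ⟨(∑ j ∈ Finset.range (K + 1), D j * Q j) + (1 + 1 / θ) * Real.log 2 / γ,
    fun n m ρ T w hw hk hρ0 hρ1 hT0 hTK hgap hm => ?_⟩
  have b0 j : bigSq (t j) 0 = 0 := by simp [bigSq]
  have c0 j : bigInd (t j) 0 = 0 := by simp [bigInd, ht j]
  have v1 j := hw.sum_wt_sq_emp_sub_le hk (b0 j)
  have v2 := hw.sum_wt_sq_emp_sub_le hk (f := fun x => x ^ 2) (by simp)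
  have v3 j := hw.sum_wt_sq_emp_sub_le hk (c0 j)
  have a2 := hw.sum_wt_emp hk (f := fun x => x ^ 2) (by simp)
  rw [← hS] at v2 a2
  have a3 := hw.sum_wt_emp hk (f := fun x => if x ≠ 0 then 1 else 0) (by simp)
  have hone : ∫ x, (if x ≠ 0 then (1 : ℝ) else 0) ∂P0 ≤ 1 := by
    have := integral_mono_of_nonneg (μ := P0) (f := fun x => if x ≠ 0 then (1 : ℝ) else 0)
      (g := fun _ => 1) (Filter.Eventually.of_forall fun x => by
        simp only [Pi.zero_apply]; split_ifs <;> simp) (integrable_const _)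
      (Filter.Eventually.of_forall fun x => by simp only; split_ifs <;> simp)
    simpa using this
  have hfil : ∑ x ∈ T.filter (· ≠ 0), w x ≤ ρ := by
    have := hw.sum_mul_eq (f := fun x => if x ≠ 0 then 1 else 0) (by simp)
    simp only [mul_ite, mul_one, mul_zero, ← Finset.sum_filter] at this
    rw [this]
    exact mul_le_of_le_one_right hρ0.le hone
  have hlog : 0 < -Real.log ρ := neg_pos.2 (Real.log_neg hρ0 hρ1)
  have hexp : ρ = Real.exp (- -Real.log ρ) := by rw [neg_neg, Real.exp_log hρ0]
  rw [hexp] at hfil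
  obtain ⟨L, hL⟩ : ∃ L, L = -Real.log ρ := ⟨_, rfl⟩
  obtain ⟨k, hk'⟩ : ∃ k, k = n * ρ := ⟨_, rfl⟩
  rw [← hL] at hlog hm hfil ⊢
  rw [← hk'] at hk v1 v2 v3 a2 a3 hm ⊢
  obtain ⟨V, hV⟩ : ∃ V : ℕ → (Fin n → ℝ) → ℝ, V = fun j X =>
    (emp k (bigSq (t j)) X - ∫ x, bigSq (t j) x ∂P0) ^ 2 + (emp k (fun x => x ^ 2) X - S) ^ 2
      + (emp k (bigInd (t j)) X - ∫ x, bigInd (t j) x ∂P0) ^ 2 := ⟨_, rfl⟩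
  have hV0 j X : 0 ≤ V j X := by rw [hV]; positivity
  have hVQ j : ∑ X ∈ grid n T, wt w X * V j X ≤ Q j * (1 / k) := by
    rw [hV, hQ]
    simp_rw [mul_add, Finset.sum_add_distrib]
    linarith [v1 j, v2, v3 j]
  have hVs : ∑ X ∈ grid n T, ∑ j ∈ Finset.range (K + 1), D j * (wt w X * V j X)
      ≤ (∑ j ∈ Finset.range (K + 1), D j * Q j) * (1 / k) := by
    rw [Finset.sum_comm, Finset.sum_mul]
    refine Finset.sum_le_sum fun j _ => ?_
    rw [← Finset.mul_sum, mul_assoc]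
    exact mul_le_mul_of_nonneg_left (hVQ j) (hD0 j)
  have hb X (hX : X ∈ grid n T) : m * (Ψ - ε / 2 - θ * mgfConst Δ B) * wt w X
      - m * (∑ j ∈ Finset.range (K + 1), D j * (wt w X * V j X))
      - m * θ * τ / 2 * (wt w X * emp k (fun x => x ^ 2) X)
      - (1 + 1 / θ) * Real.log 2 * k * (wt w X * emp k (fun x => if x ≠ 0 then 1 else 0) X)
      ≤ wt w X * ∫ ω, Real.log (lik Δ PA φ k (γ * τ * L) X X ω
        / margLik Δ PA φ T w k (γ * τ * L) X ω) ∂(dataLaw n m PA) := by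
    have hXT i : X i ∈ T := Fintype.mem_piFinset.1 hX i
    have key := h.le_integral_log_of_potential (PA := PA) (m := m) hk hγ hτ hlog.le rfl hm hK ht
      hmono hθ0 hθ1 hw.1 hw.sum_eq_one hfil hX (fun i => hT0 _ (hXT i)) (fun i => hTK _ (hXT i))
      (fun j hj i => hgap j hj _ (hXT i))
      (Ψ := Ψ - ε / 2 - ∑ j ∈ Finset.range (K + 1), D j * V j X) fun j hj => by
        have h1 := hD j hk X
        have h2 := Finset.single_le_sum (f := fun j => D j * V j X)
          (fun j _ => mul_nonneg (hD0 j) (hV0 j X)) (Finset.mem_range.2 (Nat.lt_succ_of_le hj))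
        have h3 := hΨ j hj
        rw [← hS] at h3
        simp only [hV] at h2 ⊢
        linarith
    have hcard : ((supp X).card : ℝ) = k * emp k (fun x => if x ≠ 0 then 1 else 0) X := by
      unfold emp supp
      rw [mul_div_cancel₀ _ hk.ne', Finset.card_filter]
      push_cast
      rfl
    rw [hcard, nsq_eq_emp] at key
    have e : ∑ j ∈ Finset.range (K + 1), D j * (wt w X * V j X)
        = wt w X * ∑ j ∈ Finset.range (K + 1), D j * V j X := by
      rw [Finset.mul_sum]; exact Finset.sum_congr rfl fun j _ => by ring
    rw [e]
    refine le_trans (le_of_eq ?_) (mul_le_mul_of_nonneg_left key (wt_nonneg hw.1 X))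
    ring
  refine le_trans ?_ (Finset.sum_le_sum hb)
  simp only [Finset.sum_sub_distrib, ← Finset.mul_sum]
  rw [sum_wt hw.sum_eq_one, a2, a3]
  have hb0 : 0 ≤ (1 + 1 / θ) * Real.log 2 := by
    have := Real.log_nonneg (show (1 : ℝ) ≤ 2 by norm_num)
    positivity
  have g1 := mul_le_mul_of_nonneg_left hVs (Nat.cast_nonneg (α := ℝ) m)
  have g2 := mul_le_mul_of_nonneg_left hone (mul_nonneg hb0 hk.le)
  have g3 := mul_le_mul_of_nonneg_left hθM (Nat.cast_nonneg (α := ℝ) m)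
  rw [hM] at g3
  have g4 : (1 + 1 / θ) * Real.log 2 * k = m * ((1 + 1 / θ) * Real.log 2 / γ * (1 / L)) := by
    rw [hm]; field_simp
  have g5 : 0 ≤ (m : ℝ) * (((1 + 1 / θ) * Real.log 2 / γ) * (1 / k)) := by positivity
  have g6 : 0 ≤ (m : ℝ) * ((∑ j ∈ Finset.range (K + 1), D j * Q j) * (1 / L)) := by
    have : 0 ≤ ∑ j ∈ Finset.range (K + 1), D j * Q j := Finset.sum_nonneg fun j _ =>
      mul_nonneg (hD0 j) (by rw [hQ]; positivity)
    positivity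
  linarith

end LowerBound

section Prior

variable {T : Finset ℝ} {P0 : Measure ℝ}

lemma ae_sparsePrior (h0 : (0 : ℝ) ∈ T) (hT : ∀ᵐ x ∂P0, x ∈ T) (ρ : ℝ) :
    ∀ᵐ x ∂(sparsePrior ρ P0), x ∈ T := by
  unfold sparsePrior
  rw [ae_add_measure_iff]
  refine ⟨Measure.ae_smul_measure ?_ _, Measure.ae_smul_measure hT _⟩
  rw [ae_dirac_iff]
  · exact h0
  · exact T.measurableSet

variable [IsProbabilityMeasure P0]

lemma sum_real_singleton_mul (hT : ∀ᵐ x ∂P0, x ∈ T) (f : ℝ → ℝ) :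
    ∑ t ∈ T, P0.real {t} * f t = ∫ x, f x ∂P0 := by
  have hT' : ∀ᵐ x ∂P0, x ∈ (T : Set ℝ) := by simpa using hT
  have := setIntegral_finset (μ := P0) T (f := f) IntegrableOn.finset
  rw [Measure.restrict_eq_self_of_ae_mem hT'] at this
  simpa using this.symm

lemma integrable_of_ae_mem_finset (hT : ∀ᵐ x ∂P0, x ∈ T) (f : ℝ → ℝ) : Integrable f P0 := by
  have hT' : ∀ᵐ x ∂P0, x ∈ (T : Set ℝ) := by simpa using hT
  have : IntegrableOn f T P0 := IntegrableOn.finset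
  rwa [IntegrableOn, Measure.restrict_eq_self_of_ae_mem hT'] at this

lemma isProbabilityMeasure_sparsePrior {ρ : ℝ} (h0 : 0 ≤ ρ) (h1 : ρ ≤ 1) :
    IsProbabilityMeasure (sparsePrior ρ P0) := by
  refine ⟨?_⟩
  simp only [sparsePrior, Measure.coe_add, Measure.coe_smul, Pi.add_apply, Pi.smul_apply,
    measure_univ, smul_eq_mul, mul_one]
  rw [← ENNReal.ofReal_add (by linarith) h0]
  simp

lemma isSparseWeight_sparsePrior {ρ : ℝ} (hρ0 : 0 ≤ ρ) (hρ1 : ρ ≤ 1) (h0 : (0 : ℝ) ∈ T)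
    (hT : ∀ᵐ x ∂P0, x ∈ T) :
    IsSparseWeight T (fun t => (sparsePrior ρ P0).real {t}) ρ P0 := by
  refine ⟨fun t => measureReal_nonneg, fun f => ?_⟩
  have e t : (sparsePrior ρ P0).real {t} = (1 - ρ) * (if t = 0 then 1 else 0)
      + ρ * P0.real {t} := by
    unfold sparsePrior
    rw [Measure.real, Measure.add_apply, Measure.smul_apply, Measure.smul_apply,
      smul_eq_mul, smul_eq_mul, ENNReal.toReal_add, ENNReal.toReal_mul, ENNReal.toReal_mul,
      ENNReal.toReal_ofReal (by linarith), ENNReal.toReal_ofReal hρ0]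
    · congr 2
      by_cases ht : t = 0
      · simp [ht]
      · simp [ht, Ne.symm ht]
    · exact ENNReal.mul_ne_top ENNReal.ofReal_ne_top (measure_ne_top _ _)
    · exact ENNReal.mul_ne_top ENNReal.ofReal_ne_top (measure_ne_top _ _)
  simp_rw [e, add_mul, Finset.sum_add_distrib, mul_assoc, ← Finset.mul_sum]
  rw [sum_real_singleton_mul hT]
  simp [h0]

end Prior

section Limit

variable {Δ : ℝ} {kA : ℕ} {PA : Measure (Fin kA → ℝ)} [IsProbabilityMeasure PA]
  {φ : ℝ → (Fin kA → ℝ) → ℝ} {B : ℝ} {P0 : Measure ℝ}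

lemma RegularChannel.potential_eq_of_lt (h : RegularChannel Δ φ B) {t : ℝ}
    (ht : ∀ᵐ x ∂P0, |x| < t) (γ τ : ℝ) :
    potential Δ PA φ τ γ (∫ x, bigSq t x ∂P0) (∫ x, x ^ 2 ∂P0) (∫ x, bigInd t x ∂P0)
      = IPout Δ PA φ 0 (secondMoment P0) + τ * secondMoment P0 / 2 := by
  have h1 : ∫ x, bigSq t x ∂P0 = 0 :=
    integral_eq_zero_of_ae (ht.mono fun x hx => by simp [bigSq, hx])
  have h2 : ∫ x, bigInd t x ∂P0 = 0 :=
    integral_eq_zero_of_ae (ht.mono fun x hx => by simp [bigInd, hx])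
  have h3 : 0 ≤ secondMoment P0 := integral_nonneg fun x => sq_nonneg x
  rw [h.IPout_eq le_rfl h3, h1, h2, potential]
  simp [secondMoment]

variable [IsProbabilityMeasure P0]

lemma RegularChannel.MIside_eq_avgLogLik (h : RegularChannel Δ φ B) {T : Finset ℝ}
    (h0 : (0 : ℝ) ∈ T) (hT : ∀ᵐ x ∂P0, x ∈ T) {ρ : ℝ} (hρ0 : 0 < ρ) (hρ1 : ρ < 1) (γ τ : ℝ)
    (n m : ℕ) :
    MIside Δ PA φ P0 ρ (γ * ρ * |Real.log ρ|) τ n m = avgLogLik Δ PA φ T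
      (fun t => (sparsePrior ρ P0).real {t}) (n * ρ) (γ * τ * -Real.log ρ) n m := by
  have := isProbabilityMeasure_sparsePrior (P0 := P0) hρ0.le hρ1.le
  rw [h.MIside_eq (ae_sparsePrior h0 hT ρ)
    (isSparseWeight_sparsePrior hρ0.le hρ1.le h0 hT).sum_eq_one]
  have e : γ * ρ * |Real.log ρ| * τ / ρ = γ * τ * -Real.log ρ := by
    rw [abs_of_neg (Real.log_neg hρ0 hρ1)]; field_simp
  rw [e]; rfl

lemma RegularChannel.potential_eq (h : RegularChannel Δ φ B) {T : Finset ℝ}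
    (hT : ∀ᵐ x ∂P0, x ∈ T) (γ τ t : ℝ) :
    potential Δ PA φ τ γ (∫ x, bigSq t x ∂P0) (∫ x, x ^ 2 ∂P0) (∫ x, bigInd t x ∂P0)
      = IPout Δ PA φ (truncSMge P0 t) (secondMoment P0) + τ * headSM P0 t / 2
        + tailProb P0 t / γ := by
  have hi := integrable_of_ae_mem_finset hT
  have h1 : headSM P0 t = secondMoment P0 - truncSMge P0 t := by
    unfold headSM secondMoment truncSMge
    rw [← integral_sub (hi _) (hi _)]
    refine integral_congr_ae (Filter.Eventually.of_forall fun x => ?_)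
    by_cases hx : t ≤ |x|
    · simp [hx, not_lt.2 hx]
    · simp [hx, not_le.1 hx]
  have h2 : tailProb P0 t = ∫ x, bigInd t x ∂P0 := by
    have hm : MeasurableSet {x : ℝ | t ≤ |x|} := measurableSet_le measurable_const measurable_norm
    have := integral_indicator_one (μ := P0) hm
    rw [tailProb]
    refine this.symm.trans (integral_congr_ae (Filter.Eventually.of_forall fun x => ?_))
    simp [Set.indicator_apply, bigInd]
  have h3 : truncSMge P0 t = ∫ x, bigSq t x ∂P0 := rfl
  have h4 : 0 ≤ truncSMge P0 t := integral_nonneg (bigSq_nonneg t)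
  have h5 : truncSMge P0 t ≤ secondMoment P0 := integral_mono (hi _) (hi _) (bigSq_le t)
  rw [h.IPout_eq h4 h5, h1, h2, h3]
  rfl

lemma tendsto_sparsity {lam c1 c2 : ℝ} (hlam0 : 0 < lam) (hlam1 : lam < 1) {ρ : ℕ → ℝ}
    (hρ : ∀ n, 0 < ρ n) (hc1 : 0 < c1)
    (hΘ : ∀ n : ℕ, 1 ≤ n → c1 * (n : ℝ) ^ (-lam) ≤ ρ n ∧ ρ n ≤ c2 * (n : ℝ) ^ (-lam)) :
    Filter.Tendsto ρ Filter.atTop (nhds 0) ∧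
      Filter.Tendsto (fun n => 1 / (n * ρ n) + 1 / -Real.log (ρ n)) Filter.atTop (nhds 0) := by
  have hp : Filter.Tendsto (fun n : ℕ => c2 * (n : ℝ) ^ (-lam)) Filter.atTop (nhds 0) := by
    simpa using ((tendsto_rpow_neg_atTop hlam0).comp tendsto_natCast_atTop_atTop).const_mul c2
  have h0 : Filter.Tendsto ρ Filter.atTop (nhds 0) :=
    tendsto_of_tendsto_of_tendsto_of_le_of_le' tendsto_const_nhds hp
      (Filter.Eventually.of_forall fun n => (hρ n).le)
      (Filter.eventually_atTop.2 ⟨1, fun n hn => (hΘ n hn).2⟩)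
  refine ⟨h0, ?_⟩
  have hq : Filter.Tendsto (fun n : ℕ => c1 * (n : ℝ) ^ (1 - lam)) Filter.atTop Filter.atTop :=
    ((tendsto_rpow_atTop (by linarith)).comp tendsto_natCast_atTop_atTop).const_mul_atTop hc1
  have h1 : Filter.Tendsto (fun n : ℕ => n * ρ n) Filter.atTop Filter.atTop := by
    refine Filter.tendsto_atTop_mono' _ (Filter.eventually_atTop.2 ⟨1, fun n hn => ?_⟩) hq
    have hn' : (0 : ℝ) < n := by exact_mod_cast hn
    rw [sub_eq_add_neg, Real.rpow_add hn', Real.rpow_one]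
    have := mul_le_mul_of_nonneg_left (hΘ n hn).1 hn'.le
    linarith
  have h2 : Filter.Tendsto (fun n => -Real.log (ρ n)) Filter.atTop Filter.atTop :=
    Filter.tendsto_neg_atBot_atTop.comp (Real.tendsto_log_nhdsGT_zero.comp
      (tendsto_nhdsWithin_iff.2 ⟨h0, Filter.Eventually.of_forall hρ⟩))
  simpa using (h1.inv_tendsto_atTop).add h2.inv_tendsto_atTop

end Limit

lemma exists_finset_support {K : ℕ} {v : Fin K → ℝ} {P0 : Measure ℝ}
    (hsupp : ∀ᵐ x ∂P0, ∃ k : Fin K, x = v k ∨ x = -(v k)) :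
    ∃ T : Finset ℝ, 0 ∈ T ∧ (∀ᵐ x ∂P0, x ∈ T) ∧ ∀ x ∈ T, x = 0 ∨ ∃ k, |x| = |v k| := by
  classical
  refine ⟨insert 0 (Finset.univ.image v ∪ Finset.univ.image fun k => -(v k)), by simp, ?_, ?_⟩
  · filter_upwards [hsupp] with x hx
    obtain ⟨k, rfl | rfl⟩ := hx <;> simp
  · intro x hx
    simp only [Finset.mem_insert, Finset.mem_union, Finset.mem_image, Finset.mem_univ,
      true_and] at hx
    rcases hx with rfl | ⟨k, rfl⟩ | ⟨k, rfl⟩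
    · exact Or.inl rfl
    · exact Or.inr ⟨k, rfl⟩
    · exact Or.inr ⟨k, abs_neg _⟩

lemma exists_thresholds {K : ℕ} (hK : 0 < K) {v : Fin K → ℝ} (hvpos : 0 < v ⟨0, hK⟩)
    (hvmono : StrictMono v) :
    ∃ t : ℕ → ℝ, (∀ j, 0 < t j) ∧ Monotone t ∧ (∀ k : Fin K, t k = v k) ∧
      ∀ k : Fin K, v k < t K := by
  have hv0 (k : Fin K) : 0 < v k := hvpos.trans_le (hvmono.monotone (Nat.zero_le _))
  have hvK (k : Fin K) : v k < v ⟨K - 1, by omega⟩ + 1 := by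
    have := hvmono.monotone (show k ≤ ⟨K - 1, by omega⟩ from Nat.le_sub_one_of_lt k.2)
    linarith
  refine ⟨fun j => if hj : j < K then v ⟨j, hj⟩ else v ⟨K - 1, by omega⟩ + 1, fun j => ?_,
    monotone_nat_of_le_succ fun j => ?_, fun k => by simp, fun k => by simpa using hvK k⟩
  · by_cases hj : j < K
    · simpa [hj] using hv0 _
    · simpa [hj] using (hv0 _).trans (hvK ⟨0, hK⟩)
  · by_cases hj : j + 1 < K
    · simpa [hj, (Nat.lt_succ_self j).trans hj] using
        hvmono.monotone (Fin.mk_le_mk.2 (Nat.le_succ j))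
    · by_cases hj' : j < K
      · simpa [hj, hj'] using (hvK _).le
      · simp [hj, hj']

/-- Theorem 7 of the paper: the limit of the mutual information per sample
of the GLM with side information, for a discrete prior with finite support. -/
theorem limit_MI_side_info_discrete_prior
    (Δ : ℝ) (hΔ : 0 < Δ)
    (kA : ℕ) (PA : Measure (Fin kA → ℝ)) [IsProbabilityMeasure PA]
    (φ φ' φ'' : ℝ → (Fin kA → ℝ) → ℝ)
    -- (H2)
    (hφmeas : Measurable fun p : ℝ × (Fin kA → ℝ) => φ p.1 p.2)
    (hφbd : ∃ B, ∀ x a, |φ x a| ≤ B)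
    (hd1 : ∀ a x, HasDerivAt (fun t => φ t a) (φ' x a) x)
    (hd2 : ∀ a x, HasDerivAt (fun t => φ' t a) (φ'' x a) x)
    (hφ'bd : ∃ B, ∀ x a, |φ' x a| ≤ B)
    (hφ''bd : ∃ B, ∀ x a, |φ'' x a| ≤ B)
    (hφ'cont : ∀ a, Continuous fun x => φ' x a)
    (hφ''cont : ∀ a, Continuous fun x => φ'' x a)
    -- discrete prior with finite support, 0 < v 0 < ... < v (K-1)
    (K : ℕ) (hK : 0 < K) (v : Fin K → ℝ) (hvpos : 0 < v ⟨0, hK⟩) (hvmono : StrictMono v)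
    (P0 : Measure ℝ) [IsProbabilityMeasure P0]
    (hsupp : ∀ᵐ x ∂P0, ∃ k : Fin K, x = v k ∨ x = -(v k))
    -- sparsity and sampling rate
    (lam : ℝ) (hlam0 : 0 < lam) (hlam1 : lam < 1 / 9)
    (ρ : ℕ → ℝ) (hρ : ∀ n, 0 < ρ n ∧ ρ n < 1)
    (c1 c2 : ℝ) (hc1 : 0 < c1) (hc12 : c1 ≤ c2)
    (hΘ : ∀ n : ℕ, 1 ≤ n →
      c1 * (n : ℝ) ^ (-lam) ≤ ρ n ∧ ρ n ≤ c2 * (n : ℝ) ^ (-lam))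
    (γ : ℝ) (hγ : 0 < γ)
    (α : ℕ → ℝ) (hα : ∀ n, α n = γ * ρ n * |Real.log (ρ n)|)
    (m : ℕ → ℕ) (hm : ∀ n, (m n : ℝ) = α n * n)
    (τ : ℝ) (hτ0 : 0 ≤ τ)
    (hτ : τ < 2 / (γ * (v ⟨K - 1, by omega⟩) ^ 2)) :
    Filter.Tendsto
      (fun n : ℕ => MIside Δ PA φ P0 (ρ n) (α n) τ n (m n) / (m n : ℝ)) Filter.atTop
      (nhds (⨅ k : Fin (K + 1),
        if h : (k : ℕ) < K then
          IPout Δ PA φ (truncSMge P0 (v ⟨k, h⟩)) (secondMoment P0)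
            + τ * headSM P0 (v ⟨k, h⟩) / 2 + tailProb P0 (v ⟨k, h⟩) / γ
        else IPout Δ PA φ 0 (secondMoment P0) + τ * secondMoment P0 / 2)) := by
  obtain ⟨B, hB⟩ := hφbd
  have h : RegularChannel Δ φ B :=
    ⟨hΔ, hφmeas, hB, fun a => continuous_iff_continuousAt.2 fun x => (hd1 a x).continuousAt⟩
  have hρ' : ∀ n, 0 < ρ n := fun n => (hρ n).1
  obtain ⟨T, h0, hT, hTv⟩ := exists_finset_support hsupp
  obtain ⟨t, htpos, htmono, htv, htK⟩ := exists_thresholds hK hvpos hvmono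
  have hTK : ∀ x ∈ T, |x| < t K := by
    intro x hx
    rcases hTv x hx with rfl | ⟨k, hk⟩
    · simpa using htpos K
    · rw [hk, abs_of_pos (htv k ▸ htpos k)]; exact htK k
  have hgap : ∀ j < K, ∀ x ∈ T, |x| < t (j + 1) → |x| ≤ t j := by
    intro j hj x hx hxt
    rcases hTv x hx with rfl | ⟨k, hk⟩
    · simpa using (htpos j).le
    · rw [hk, abs_of_pos (htv k ▸ htpos k), ← htv k] at hxt ⊢
      refine htmono ?_
      by_contra! hc
      exact absurd (htmono hc) (not_le.2 hxt)
  have hT0 : ∀ x ∈ T, x ≠ 0 → t 0 ≤ |x| := by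
    intro x hx hx0
    rcases hTv x hx with rfl | ⟨k, hk⟩
    · exact absurd rfl hx0
    · rw [hk, abs_of_pos (htv k ▸ htpos k), ← htv k]
      exact htmono (Nat.zero_le _)
  obtain ⟨F, hF⟩ : ∃ F : Fin (K + 1) → ℝ, F = fun k : Fin (K + 1) =>
      if h : (k : ℕ) < K then
        IPout Δ PA φ (truncSMge P0 (v ⟨k, h⟩)) (secondMoment P0)
          + τ * headSM P0 (v ⟨k, h⟩) / 2 + tailProb P0 (v ⟨k, h⟩) / γ
      else IPout Δ PA φ 0 (secondMoment P0) + τ * secondMoment P0 / 2 := ⟨_, rfl⟩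
  have hFt : ∀ k : Fin (K + 1), F k = potential Δ PA φ τ γ (∫ x, bigSq (t k) x ∂P0)
      (∫ x, x ^ 2 ∂P0) (∫ x, bigInd (t k) x ∂P0) := by
    intro k
    rw [hF]
    by_cases hk : (k : ℕ) < K
    · simp only [hk, ↓reduceDIte]
      rw [h.potential_eq hT, htv ⟨k, hk⟩]
    · have hkK : (k : ℕ) = K := by omega
      simp only [hk, ↓reduceDIte]
      rw [h.potential_eq_of_lt]
      rw [hkK]
      exact hT.mono hTK
  rw [← hF]
  have hmin : ∀ k, ⨅ k, F k ≤ F k := ciInf_le (Set.finite_range F).bddBelow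
  obtain ⟨k₀, hk₀⟩ := exists_eq_ciInf_of_finite (f := F)
  obtain ⟨Ψ, hΨ⟩ : ∃ Ψ, Ψ = ⨅ k, F k := ⟨_, rfl⟩
  rw [← hΨ] at hk₀ hmin ⊢
  obtain ⟨hρ0, hδ⟩ := tendsto_sparsity hlam0 (by linarith) hρ' hc1 hΘ
  rw [Metric.tendsto_nhds]
  intro ε hε
  obtain ⟨C₁, hC₁⟩ := h.exists_le_avgLogLik (PA := PA) (P0 := P0) hγ hτ0 (half_pos hε) hK htpos
    htmono (Ψ := Ψ) fun j hj => (hmin ⟨j, by omega⟩).trans_eq (hFt ⟨j, by omega⟩)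
  obtain ⟨C₂, hC₂⟩ := h.exists_avgLogLik_le (PA := PA) (P0 := P0) hγ hτ0 (htpos k₀) (half_pos hε)
  have hδ₁ := (hδ.const_mul C₁).eventually_lt_const (u := ε / 2) (by simpa using half_pos hε)
  have hδ₂ := (hδ.const_mul C₂).eventually_lt_const (u := ε / 2) (by simpa using half_pos hε)
  filter_upwards [hδ₁, hδ₂, hρ0.eventually_le_const (show (0 : ℝ) < 1 / 2 by norm_num),
    Filter.eventually_gt_atTop 0] with n h1 h2 h3 hn
  have hk : 0 < n * ρ n := mul_pos (by exact_mod_cast hn) (hρ' n)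
  have hl : 0 < -Real.log (ρ n) := neg_pos.2 (Real.log_neg (hρ' n) (hρ n).2)
  have hmn : (m n : ℝ) = γ * (n * ρ n) * -Real.log (ρ n) := by
    rw [hm, hα, abs_of_neg (neg_pos.1 hl)]; ring
  have hm0 : (0 : ℝ) < m n := by rw [hmn]; positivity
  have hw := isSparseWeight_sparsePrior (hρ' n).le (hρ n).2.le h0 hT
  have hlow := hC₁ n (m n) (ρ n) T _ hw hk (hρ' n) (hρ n).2 hT0 hTK hgap hmn
  have hupp := hC₂ n (m n) (ρ n) T _ hw hk (hρ' n) h3 hmn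
  rw [← hFt, hk₀] at hupp
  rw [hα, h.MIside_eq_avgLogLik h0 hT (hρ' n) (hρ n).2, Real.dist_eq, abs_lt, lt_sub_iff_add_lt,
    sub_lt_iff_lt_add, lt_div_iff₀' hm0, div_lt_iff₀' hm0]
  exact ⟨(mul_lt_mul_of_pos_left (by linarith) hm0).trans_le hlow,
    hupp.trans_lt (mul_lt_mul_of_pos_left (by linarith) hm0)⟩

end GLM
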